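/- There exists an absolute constant n₀ such that the following holds for all integers n ≥ n₀: for any positive integer m with n ≥ 3m, if F = {F_1, ..., F_m} is a family of 3-graphs on the common vertex set [n] such that |F_i| > f(n,m,3) for every i ∈ [m], then F admits a rainbow matching. -/

import Mathlib

open Finset

/-- `f(n,m,k) = max{C(n,k) - C(n-m+1,k), C(km-1,k)}`. -/
def fEMC (n m k : ℕ) : ℕ :=
  max (Nat.choose n k - Nat.choose (n - m + 1) k) (Nat.choose (k * m - 1) k)

/-- `F` is a `k`-graph on the vertex set `[n] = {1,…,n}`. -/
def IsKGraphOn (n k : ℕ) (F : Finset (Finset ℕ)) : Prop :=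
  ∀ e ∈ F, e ⊆ Finset.Icc 1 n ∧ e.card = k

/-- The family `F = (F_1,…,F_m)` admits a rainbow matching. -/
def HasRainbowMatching {m : ℕ} (F : Fin m → Finset (Finset ℕ)) : Prop :=
  ∃ e : Fin m → Finset ℕ, (∀ i, e i ∈ F i) ∧
    ∀ i j : Fin m, i ≠ j → Disjoint (e i) (e j)

/-- Degree of a vertex `v` in the hypergraph `F`. -/
def degOf (F : Finset (Finset ℕ)) (v : ℕ) : ℕ := (F.filter (fun e => v ∈ e)).card

/-- The family `F` of `k`-graphs on `[n]` is saturated. -/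
def Saturated (n k : ℕ) {m : ℕ} (F : Fin m → Finset (Finset ℕ)) : Prop :=
  ¬ HasRainbowMatching F ∧
    ∀ (i : Fin m) (e : Finset ℕ), e ⊆ Finset.Icc 1 n → e.card = k → e ∉ F i →
      HasRainbowMatching (Function.update F i (insert e (F i)))

/-- Elementwise domination order: the increasing enumeration of `e` is
pointwise at most that of `f` (this forces `e.card = f.card`). -/
def DomLE (e f : Finset ℕ) : Prop :=
  List.Forall₂ (· ≤ ·) (e.sort (· ≤ ·)) (f.sort (· ≤ ·))

/-- `F` is a stable hypergraph on vertex set `[n]`. -/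
def StableGraph (n : ℕ) (F : Finset (Finset ℕ)) : Prop :=
  ∀ e f : Finset ℕ, e ⊆ Finset.Icc 1 n → DomLE e f → f ∈ F → e ∈ F

/-- `S(n,m,k)`: all `k`-subsets of `[n]` meeting `[m-1]`. -/
def SGraph (n m k : ℕ) : Finset (Finset ℕ) :=
  ((Finset.Icc 1 n).powersetCard k).filter (fun e => (e ∩ Finset.Icc 1 (m - 1)).Nonempty)

/-- `D(n,m,k)`: all `k`-subsets of `[km-1]`. -/
def DGraph (n m k : ℕ) : Finset (Finset ℕ) :=
  (Finset.Icc 1 (k * m - 1)).powersetCard k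

/-- `H(F)`: the `(k+1)`-graph on `[n] ∪ {v_1,…,v_m}`, where `v_i` is encoded
as the natural number `n + i`, with edges `e ∪ {v_i}` for `e ∈ F_i`. -/
def HF (n : ℕ) {m : ℕ} (F : Fin m → Finset (Finset ℕ)) : Finset (Finset ℕ) :=
  Finset.univ.biUnion (fun i : Fin m => (F i).image (fun e => insert (n + i.1 + 1) e))

/-- `H_S(n,m,k) = H(F)` with every `F_i = S(n,m,k)`. -/
def HS (n m k : ℕ) : Finset (Finset ℕ) := HF n (fun _ : Fin m => SGraph n m k)

/-- `H_D(n,m,k) = H(F)` with every `F_i = D(n,m,k)`. -/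
def HD (n m k : ℕ) : Finset (Finset ℕ) := HF n (fun _ : Fin m => DGraph n m k)

/-- `H*(F)`: `H(F)` together with the edges `e ∪ {u_j}`, `e` a `k`-subset of `[n]`,
`j ∈ [r]`, `r = ⌊n/k⌋ - m`, where `u_j` is encoded as the natural number `n + m + j`. -/
def HstarF (n k : ℕ) {m : ℕ} (F : Fin m → Finset (Finset ℕ)) : Finset (Finset ℕ) :=
  HF n F ∪ Finset.univ.biUnion (fun j : Fin (n / k - m) =>
    ((Finset.Icc 1 n).powersetCard k).image (fun e => insert (n + m + j.1 + 1) e))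

/-- A set of edges is a matching if its edges are pairwise disjoint. -/
def IsMatching (M : Finset (Finset ℕ)) : Prop :=
  ∀ e ∈ M, ∀ f ∈ M, e ≠ f → Disjoint e f

/-- `H₂` is `ε`-close to `H₁` (as `u`-graphs on a vertex set of size `N`):
`|E(H₁) \ E(H₂)| ≤ ε · N^u`. -/
def IsEpsClose (ε : ℝ) (N u : ℕ) (H₁ H₂ : Finset (Finset ℕ)) : Prop :=
  (((H₁ \ H₂).card : ℝ)) ≤ ε * (N : ℝ) ^ u


/-! Part P1 -/
section
open Finset

noncomputable def indR (x : ℝ) : ℝ := if 1 ≤ x then 1 else 0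

noncomputable def N1 (a : Fin 3 → ℝ) : ℝ := ∑ i, indR (a i)
noncomputable def N2 (a b : Fin 3 → ℝ) : ℝ := ∑ i, ∑ j, indR (a i + b j)
noncomputable def N3 (a b c : Fin 3 → ℝ) : ℝ := ∑ i, ∑ j, ∑ k, indR (a i + b j + c k)

/-- The triple has a coordinate equal to one. -/
def TypS (a : Fin 3 → ℝ) : Prop := ∃ i, a i = 1
/-- All coordinates are one third. -/
def TypD (a : Fin 3 → ℝ) : Prop := ∀ i, a i = 1 / 3
/-- Nonnegative with sum one. -/
def Prob3 (a : Fin 3 → ℝ) : Prop := (∀ i, 0 ≤ a i) ∧ ∑ i, a i = 1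

lemma indR_nonneg (x : ℝ) : 0 ≤ indR x := by unfold indR; split_ifs <;> norm_num
lemma indR_le_one (x : ℝ) : indR x ≤ 1 := by unfold indR; split_ifs <;> norm_num
lemma indR_of_le {x : ℝ} (h : 1 ≤ x) : indR x = 1 := by simp [indR, h]
lemma indR_of_lt {x : ℝ} (h : x < 1) : indR x = 0 := by simp [indR, h]

lemma ind3_le (x y z : ℝ) (h : x + y + z = 3) (hn : ¬ (x = 1 ∧ y = 1 ∧ z = 1)) :
    indR x + indR y + indR z ≤ 2 := by
  unfold indR
  split_ifs with h1 h2 h3 <;> norm_num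
  exact hn ⟨by linarith, by linarith, by linarith⟩

/-- tight class -/
def Tight (a b c : Fin 3 → ℝ) (s t : Fin 3) : Prop := ∀ i, a i + b (i + s) + c (i + t) = 1

lemma Tight_bc (a b c : Fin 3 → ℝ) (hc : ∑ i, c i = 1) (s t t' : Fin 3) (h : t ≠ t')
    (h1 : Tight a b c s t) (h2 : Tight a b c s t') : TypD c := by
  have e0 := h1 0; have e1 := h1 1; have e2 := h1 2
  have f0 := h2 0; have f1 := h2 1; have f2 := h2 2
  rw [Fin.sum_univ_three] at hc
  intro i
  fin_cases t <;> fin_cases t' <;> first | exact absurd rfl h | skip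
  all_goals
    simp only [Fin.isValue, Fin.zero_eta, Fin.mk_one, Fin.reduceFinMk, zero_add, add_zero, Fin.reduceAdd] at *
    fin_cases i <;> simp <;> linarith

lemma Tight_comm (a b c : Fin 3 → ℝ) (s t : Fin 3) (h : Tight a b c s t) : Tight a c b t s := by
  intro i; have := h i; linarith

lemma N3_eq (a b c : Fin 3 → ℝ) : N3 a b c =
    ∑ s : Fin 3, ∑ t : Fin 3, (indR (a 0 + b (0 + s) + c (0 + t)) +
      indR (a 1 + b (1 + s) + c (1 + t)) + indR (a 2 + b (2 + s) + c (2 + t))) := by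
  unfold N3
  simp only [Fin.sum_univ_three, Fin.isValue, zero_add, add_zero, Fin.reduceAdd]
  ring

lemma N3_le (a b c : Fin 3 → ℝ) (ha : Prob3 a) (hb : Prob3 b) (hc : Prob3 c)
    (hn : ¬ (TypD a ∧ TypD b ∧ TypD c)) : N3 a b c ≤ 21 := by
  classical
  have ha := ha.2; have hb := hb.2; have hc := hc.2
  let Z : Finset (Fin 3 × Fin 3) := univ.filter (fun p => Tight a b c p.1 p.2)
  have hZ : Z.card ≤ 3 := by
    by_contra hlt
    push Not at hlt
    apply hn
    have hc3 : (univ : Finset (Fin 3)).card < Z.card := by simpa using hlt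
    obtain ⟨p, hp, q, hq, hpq, he⟩ := Finset.exists_ne_map_eq_of_card_lt_of_maps_to hc3
      (f := Prod.fst) (fun _ _ => by simp)
    obtain ⟨p', hp', q', hq', hpq', he'⟩ := Finset.exists_ne_map_eq_of_card_lt_of_maps_to hc3
      (f := Prod.snd) (fun _ _ => by simp)
    simp only [Z, mem_filter, mem_univ, true_and] at hp hq hp' hq'
    have hDc : TypD c := by
      apply Tight_bc a b c hc p.1 p.2 q.2 _ hp (he ▸ hq)
      intro h; exact hpq (Prod.ext he h)
    have hDb : TypD b := by
      apply Tight_bc a c b hb p'.2 p'.1 q'.1 _ (Tight_comm _ _ _ _ _ hp')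
        (Tight_comm _ _ _ _ _ (he' ▸ hq'))
      intro h; exact hpq' (Prod.ext h he')
    refine ⟨?_, hDb, hDc⟩
    intro i
    have := hp i
    rw [hDb, hDc] at this
    linarith
  have key : ∀ s t : Fin 3, (indR (a 0 + b (0 + s) + c (0 + t)) +
      indR (a 1 + b (1 + s) + c (1 + t)) + indR (a 2 + b (2 + s) + c (2 + t))) ≤
      2 + (if Tight a b c s t then 1 else 0) := by
    intro s t
    split_ifs with h
    · have := indR_le_one (a 0 + b (0 + s) + c (0 + t))
      have := indR_le_one (a 1 + b (1 + s) + c (1 + t))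
      have := indR_le_one (a 2 + b (2 + s) + c (2 + t))
      linarith
    · rw [add_zero]
      apply ind3_le
      · rw [Fin.sum_univ_three] at ha hb hc
        fin_cases s <;> fin_cases t <;>
          simp only [Fin.isValue, Fin.zero_eta, Fin.mk_one, Fin.reduceFinMk, zero_add, add_zero,
            Fin.reduceAdd] <;> linarith
      · rintro ⟨h1, h2, h3⟩
        apply h
        intro i
        fin_cases i
        · exact h1
        · exact h2
        · exact h3
  rw [N3_eq]
  calc _ ≤ ∑ s : Fin 3, ∑ t : Fin 3, ((2:ℝ) + (if Tight a b c s t then 1 else 0)) :=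
        Finset.sum_le_sum fun s _ => Finset.sum_le_sum fun t _ => key s t
    _ = 18 + (Z.card : ℝ) := by
        simp only [Finset.sum_add_distrib]
        congr 1
        · simp; norm_num
        · rw [← Fintype.sum_prod_type' (f := fun s t : Fin 3 => if Tight a b c s t then (1:ℝ) else 0)]
          simp [Z]
    _ ≤ 21 := by
        have : (Z.card : ℝ) ≤ 3 := by exact_mod_cast hZ
        linarith

lemma typS_cases {a : Fin 3 → ℝ} (ha : Prob3 a) (h : TypS a) :
    (a 0 = 1 ∧ a 1 = 0 ∧ a 2 = 0) ∨ (a 0 = 0 ∧ a 1 = 1 ∧ a 2 = 0) ∨ (a 0 = 0 ∧ a 1 = 0 ∧ a 2 = 1) := by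
  obtain ⟨hp, hs⟩ := ha
  rw [Fin.sum_univ_three] at hs
  have h0 := hp 0; have h1 := hp 1; have h2 := hp 2
  obtain ⟨i, hi⟩ := h
  fin_cases i <;> simp only [Fin.isValue, Fin.zero_eta, Fin.mk_one, Fin.reduceFinMk] at hi
  · left; refine ⟨hi, ?_, ?_⟩ <;> linarith
  · right; left; refine ⟨?_, hi, ?_⟩ <;> linarith
  · right; right; refine ⟨?_, ?_, hi⟩ <;> linarith

/-- for type S, sums of functions are explicit -/
lemma typS_sum {a : Fin 3 → ℝ} (ha : Prob3 a) (h : TypS a) (φ : ℝ → ℝ) :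
    ∑ i, φ (a i) = φ 1 + 2 * φ 0 := by
  rw [Fin.sum_univ_three]
  rcases typS_cases ha h with ⟨h0, h1, h2⟩ | ⟨h0, h1, h2⟩ | ⟨h0, h1, h2⟩ <;> rw [h0, h1, h2] <;> ring

lemma N1_S {a : Fin 3 → ℝ} (ha : Prob3 a) (h : TypS a) : N1 a = 1 := by
  unfold N1; rw [typS_sum ha h indR, indR_of_le le_rfl, indR_of_lt (by norm_num)]; norm_num

lemma le_one_of_prob {a : Fin 3 → ℝ} (ha : Prob3 a) (i : Fin 3) : a i ≤ 1 := by
  rw [← ha.2]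
  exact Finset.single_le_sum (f := a) (fun j _ => ha.1 j) (Finset.mem_univ i)

lemma N1_nS {a : Fin 3 → ℝ} (ha : Prob3 a) (h : ¬ TypS a) : N1 a = 0 := by
  unfold N1
  apply Finset.sum_eq_zero
  intro i _
  apply indR_of_lt
  exact lt_of_le_of_ne (le_one_of_prob ha i) (fun e => h ⟨i, e⟩)

lemma N2_comm (a b : Fin 3 → ℝ) : N2 a b = N2 b a := by
  unfold N2; rw [Finset.sum_comm]; simp only [add_comm]

lemma N2_S {a b : Fin 3 → ℝ} (ha : Prob3 a) (hb : Prob3 b) (h : TypS a) : N2 a b = 3 + 2 * N1 b := by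
  unfold N2
  rw [typS_sum ha h (fun x => ∑ j, indR (x + b j))]
  congr 1
  · rw [Finset.sum_congr rfl (g := fun _ => (1:ℝ))]
    · simp
    · intro j _; exact indR_of_le (by linarith [hb.1 j])
  · simp [N1]

lemma N3_S {a b c : Fin 3 → ℝ} (ha : Prob3 a) (hb : Prob3 b) (hc : Prob3 c) (h : TypS a) :
    N3 a b c = 9 + 2 * N2 b c := by
  unfold N3
  rw [typS_sum ha h (fun x => ∑ j, ∑ k, indR (x + b j + c k))]
  congr 1
  · rw [Finset.sum_congr rfl (g := fun _ => (3:ℝ))]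
    · simp; norm_num
    · intro j _
      rw [Finset.sum_congr rfl (g := fun _ => (1:ℝ))]
      · simp
      · intro k _; exact indR_of_le (by linarith [hb.1 j, hc.1 k])
  · simp [N2]

lemma N3_swap12 (a b c : Fin 3 → ℝ) : N3 a b c = N3 b a c := by
  unfold N3; rw [Finset.sum_comm]; simp only [add_comm]
lemma N3_swap23 (a b c : Fin 3 → ℝ) : N3 a b c = N3 a c b := by
  unfold N3
  refine Finset.sum_congr rfl fun i _ => ?_
  rw [Finset.sum_comm]
  refine Finset.sum_congr rfl fun i _ => Finset.sum_congr rfl fun j _ => ?_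
  congr 1; ring

lemma ind2_le (x y z : ℝ) (h : x + y + z = 2) (hx : 0 ≤ x) (hy : 0 ≤ y) (hz : 0 ≤ z) :
    indR x + indR y + indR z ≤ 2 := by
  unfold indR
  split_ifs with h1 h2 h3 <;> norm_num
  linarith

lemma ind2_le' (x y z : ℝ) (h : x + y + z = 2) (hx : 0 ≤ x) (hy : 0 ≤ y) (hz : 0 ≤ z)
    (hn : x ≠ 0 ∧ y ≠ 0 ∧ z ≠ 0) :
    indR x + indR y + indR z ≤ 1 := by
  unfold indR
  have hx' := lt_of_le_of_ne hx (Ne.symm hn.1)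
  have hy' := lt_of_le_of_ne hy (Ne.symm hn.2.1)
  have hz' := lt_of_le_of_ne hz (Ne.symm hn.2.2)
  split_ifs with h1 h2 h3 <;> norm_num <;> linarith

lemma N2_nS {a b : Fin 3 → ℝ} (ha : Prob3 a) (hb : Prob3 b) (hna : ¬ TypS a) (hnb : ¬ TypS b) :
    N2 a b ≤ 4 := by
  have e : N2 a b = (indR (a 0 + b 0) + indR (a 1 + b 1) + indR (a 2 + b 2)) +
      (indR (a 0 + b 1) + indR (a 1 + b 2) + indR (a 2 + b 0)) +
      (indR (a 0 + b 2) + indR (a 1 + b 0) + indR (a 2 + b 1)) := by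
    unfold N2; simp only [Fin.sum_univ_three]; ring
  have hsa := ha.2; have hsb := hb.2
  rw [Fin.sum_univ_three] at hsa hsb
  have a0 := ha.1 0; have a1 := ha.1 1; have a2 := ha.1 2
  have b0 := hb.1 0; have b1 := hb.1 1; have b2 := hb.1 2
  have na : ∀ i, a i ≠ 1 := fun i h => hna ⟨i, h⟩
  have nb : ∀ i, b i ≠ 1 := fun i h => hnb ⟨i, h⟩
  have na0 := na 0; have na1 := na 1; have na2 := na 2
  have nb0 := nb 0; have nb1 := nb 1; have nb2 := nb 2
  have A := ind2_le (a 0 + b 0) (a 1 + b 1) (a 2 + b 2) (by linarith) (by linarith) (by linarith) (by linarith)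
  have B := ind2_le (a 0 + b 1) (a 1 + b 2) (a 2 + b 0) (by linarith) (by linarith) (by linarith) (by linarith)
  have C := ind2_le (a 0 + b 2) (a 1 + b 0) (a 2 + b 1) (by linarith) (by linarith) (by linarith) (by linarith)
  have A' := ind2_le' (a 0 + b 0) (a 1 + b 1) (a 2 + b 2) (by linarith) (by linarith) (by linarith) (by linarith)
  have B' := ind2_le' (a 0 + b 1) (a 1 + b 2) (a 2 + b 0) (by linarith) (by linarith) (by linarith) (by linarith)
  have C' := ind2_le' (a 0 + b 2) (a 1 + b 0) (a 2 + b 1) (by linarith) (by linarith) (by linarith) (by linarith)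
  by_contra hlt
  push Not at hlt
  have z : ∀ x y : ℝ, 0 ≤ x → 0 ≤ y → x + y = 0 → x = 0 ∧ y = 0 := fun x y hx hy h =>
    ⟨by linarith, by linarith⟩
  have zA : ∀ i j : Fin 3, i ≠ j → a i = 0 → a j = 0 → False := by
    intro i j hij h1 h2
    fin_cases i <;> fin_cases j <;> simp only [Fin.isValue, Fin.zero_eta, Fin.mk_one, Fin.reduceFinMk] at * <;>
      first | exact hij rfl | exact na0 (by linarith) | exact na1 (by linarith) | exact na2 (by linarith)
  have zB : ∀ i j : Fin 3, i ≠ j → b i = 0 → b j = 0 → False := by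
    intro i j hij h1 h2
    fin_cases i <;> fin_cases j <;> simp only [Fin.isValue, Fin.zero_eta, Fin.mk_one, Fin.reduceFinMk] at * <;>
      first | exact hij rfl | exact nb0 (by linarith) | exact nb1 (by linarith) | exact nb2 (by linarith)
  have zz : ∀ i j k l : Fin 3, (i ≠ k ∨ j ≠ l) → a i + b j = 0 → a k + b l = 0 → False := by
    intro i j k l h h1 h2
    obtain ⟨p1, p2⟩ := z _ _ (ha.1 i) (hb.1 j) h1
    obtain ⟨q1, q2⟩ := z _ _ (ha.1 k) (hb.1 l) h2
    rcases h with h | h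
    · exact zA i k h p1 q1
    · exact zB j l h p2 q2
  have n1 : ∃ p : Fin 3, ∃ q : Fin 3, ∃ k l, (p ≠ k ∨ q ≠ l) ∧ a p + b q = 0 ∧ a k + b l = 0 := by
    by_cases hA : (a 0 + b 0 ≠ 0 ∧ a 1 + b 1 ≠ 0 ∧ a 2 + b 2 ≠ 0)
    · by_cases hB : (a 0 + b 1 ≠ 0 ∧ a 1 + b 2 ≠ 0 ∧ a 2 + b 0 ≠ 0)
      · have := A' hA; have := B' hB; linarith
      · by_cases hC : (a 0 + b 2 ≠ 0 ∧ a 1 + b 0 ≠ 0 ∧ a 2 + b 1 ≠ 0)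
        · have := A' hA; have := C' hC; linarith
        · simp only [not_and_or, not_not] at hB hC
          rcases hB with h | h | h <;> rcases hC with h' | h' | h' <;>
            exact ⟨_, _, _, _, by decide, h, h'⟩
    · by_cases hB : (a 0 + b 1 ≠ 0 ∧ a 1 + b 2 ≠ 0 ∧ a 2 + b 0 ≠ 0)
      · by_cases hC : (a 0 + b 2 ≠ 0 ∧ a 1 + b 0 ≠ 0 ∧ a 2 + b 1 ≠ 0)
        · have := B' hB; have := C' hC; linarith
        · simp only [not_and_or, not_not] at hA hC
          rcases hA with h | h | h <;> rcases hC with h' | h' | h' <;>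
            exact ⟨_, _, _, _, by decide, h, h'⟩
      · simp only [not_and_or, not_not] at hA hB
        rcases hA with h | h | h <;> rcases hB with h' | h' | h' <;>
            exact ⟨_, _, _, _, by decide, h, h'⟩
  obtain ⟨p, q, k, l, h, h1, h2⟩ := n1
  exact zz _ _ _ _ h h1 h2

noncomputable def HH (κ : ℝ) (a b c : Fin 3 → ℝ) : ℝ :=
  N3 a b c + κ * (N2 a b + N2 a c + N2 b c) + κ ^ 2 * (N1 a + N1 b + N1 c)

noncomputable def boundH (κ : ℝ) : ℝ := max 27 (19 + 15 * κ + 3 * κ ^ 2)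

lemma HH_SSS {κ : ℝ} {a b c : Fin 3 → ℝ} (ha : Prob3 a) (hb : Prob3 b) (hc : Prob3 c)
    (sa : TypS a) (sb : TypS b) (sc : TypS c) : HH κ a b c ≤ boundH κ := by
  unfold HH
  rw [N3_S ha hb hc sa, N2_S ha hb sa, N2_S ha hc sa, N2_S hb hc sb, N1_S ha sa, N1_S hb sb, N1_S hc sc]
  refine le_trans (le_of_eq ?_) (le_max_right _ _)
  ring

lemma HH_S1 {κ : ℝ} (hκ : 0 ≤ κ) {a b c : Fin 3 → ℝ} (ha : Prob3 a) (hb : Prob3 b) (hc : Prob3 c)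
    (sa : TypS a) (hn : ¬ (TypS b ∧ TypS c)) : HH κ a b c ≤ boundH κ - 1 / 10 := by
  unfold HH
  rw [N3_S ha hb hc sa, N2_S ha hb sa, N2_S ha hc sa, N1_S ha sa]
  have hb2 : 19 + 15 * κ + 3 * κ ^ 2 ≤ boundH κ := le_max_right _ _
  have hk2 := sq_nonneg κ
  by_cases sb : TypS b
  · have sc : ¬ TypS c := fun h => hn ⟨sb, h⟩
    rw [N2_S hb hc sb, N1_S hb sb, N1_nS hc sc]
    nlinarith
  · by_cases sc : TypS c
    · rw [N2_comm, N2_S hc hb sc, N1_nS hb sb, N1_S hc sc]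
      nlinarith
    · rw [N1_nS hb sb, N1_nS hc sc]
      have := N2_nS hb hc sb sc
      nlinarith

lemma HH_perm1 (κ : ℝ) (a b c : Fin 3 → ℝ) : HH κ a b c = HH κ b a c := by
  unfold HH; rw [N3_swap12 a b c, N2_comm a b]; ring
lemma HH_perm2 (κ : ℝ) (a b c : Fin 3 → ℝ) : HH κ a b c = HH κ a c b := by
  unfold HH; rw [N3_swap23 a b c, N2_comm b c]; ring

lemma HH_DDD {κ : ℝ} {a b c : Fin 3 → ℝ} 
    (sa : TypD a) (sb : TypD b) (sc : TypD c) : HH κ a b c ≤ boundH κ := by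
  refine le_trans (le_of_eq ?_) (le_max_left _ _)
  have h1 : ∀ a : Fin 3 → ℝ, TypD a → N1 a = 0 := by
    intro a h
    exact Finset.sum_eq_zero fun i _ => indR_of_lt (by rw [h]; norm_num)
  have h2 : ∀ a b : Fin 3 → ℝ, TypD a → TypD b → N2 a b = 0 := by
    intro a b h h'
    exact Finset.sum_eq_zero fun i _ => Finset.sum_eq_zero fun j _ => indR_of_lt (by rw [h, h']; norm_num)
  have h3 : N3 a b c = 27 := by
    unfold N3
    have : ∀ i j k, indR (a i + b j + c k) = 1 := fun i j k => indR_of_le (by rw [sa, sb, sc]; norm_num)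
    simp only [this]; simp; norm_num
  unfold HH
  rw [h1 a sa, h1 b sb, h1 c sc, h2 a b sa sb, h2 a c sa sc, h2 b c sb sc, h3]; ring

lemma HH_main {κ : ℝ} (hκ : 0 ≤ κ) {a b c : Fin 3 → ℝ} (ha : Prob3 a) (hb : Prob3 b) (hc : Prob3 c)
    (hS : ¬ (TypS a ∧ TypS b ∧ TypS c)) (hD : ¬ (TypD a ∧ TypD b ∧ TypD c)) :
    HH κ a b c ≤ boundH κ - 1 / 10 := by
  by_cases sa : TypS a
  · exact HH_S1 hκ ha hb hc sa (fun h => hS ⟨sa, h⟩)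
  by_cases sb : TypS b
  · rw [HH_perm1]; exact HH_S1 hκ hb ha hc sb (fun h => sa h.1)
  by_cases sc : TypS c
  · rw [HH_perm2, HH_perm1]; exact HH_S1 hκ hc ha hb sc (fun h => sa h.1)
  unfold HH
  rw [N1_nS ha sa, N1_nS hb sb, N1_nS hc sc]
  have h1 := N2_nS ha hb sa sb
  have h2 := N2_nS ha hc sa sc
  have h3 := N2_nS hb hc sb sc
  have h4 := N3_le a b c ha hb hc hD
  have hb1 : 27 ≤ boundH κ := le_max_left _ _
  have hb2 : 19 + 15 * κ + 3 * κ ^ 2 ≤ boundH κ := le_max_right _ _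
  by_cases hk : κ ≤ 0.49
  · nlinarith
  · push Not at hk
    nlinarith

end

/-! Part P2 -/
section
open Finset

lemma sep_lemma {ι : Type*} [Fintype ι] [DecidableEq ι] (K : Set (ι → ℝ)) (hK : IsCompact K)
    (hKc : Convex ℝ K) (R : ℝ) :
    (∃ k ∈ K, ∀ j, k j ≤ R) ∨
    (∃ ω : ι → ℝ, (∀ j, 0 ≤ ω j) ∧ ∀ k ∈ K, R * ∑ j, ω j < ∑ j, ω j * k j) := by
  by_cases h : ∃ k ∈ K, ∀ j, k j ≤ R
  · exact Or.inl h
  right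
  push Not at h
  let C : Set (ι → ℝ) := {v | ∀ j, v j ≤ R}
  have hCc : Convex ℝ C := by
    intro x hx y hy a b ha hb hab j
    have h1 := mul_le_mul_of_nonneg_left (hx j) ha
    have h2 := mul_le_mul_of_nonneg_left (hy j) hb
    have : a * R + b * R = R := by rw [← add_mul, hab, one_mul]
    simp only [Pi.add_apply, Pi.smul_apply, smul_eq_mul]
    linarith
  have hCcl : IsClosed C := by
    have : C = ⋂ j, {v : ι → ℝ | v j ≤ R} := by ext v; simp [C]
    rw [this]
    exact isClosed_iInter fun j => isClosed_le (continuous_apply j) continuous_const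
  have hd : Disjoint K C := by
    rw [Set.disjoint_left]
    intro k hk hkC
    obtain ⟨j, hj⟩ := h k hk
    exact absurd (hkC j) (not_le.mpr hj)
  obtain ⟨f, u, v, h1, h2, h3⟩ := geometric_hahn_banach_compact_closed hKc hK hCc hCcl hd
  let ω : ι → ℝ := fun j => - f (Pi.single j 1)
  have hf : ∀ x : ι → ℝ, f x = - ∑ j, ω j * x j := by
    intro x
    have := LinearMap.pi_apply_eq_sum_univ (f : (ι → ℝ) →ₗ[ℝ] ℝ) x
    have e : f x = ∑ i, x i • f (fun j => if i = j then 1 else 0) := this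
    rw [e, ← Finset.sum_neg_distrib]
    refine Finset.sum_congr rfl fun i _ => ?_
    have e2 : (fun j => if i = j then (1:ℝ) else 0) = Pi.single i 1 := by
      ext j; simp [Pi.single_apply, eq_comm]
    rw [e2]; simp only [ω, smul_eq_mul]; ring
  refine ⟨ω, ?_, ?_⟩
  · intro j
    by_contra hneg
    push Not at hneg
    -- move far in direction -e_j
    let s : ℝ := (|v| + |f (fun _ => R)| + 1) / (- ω j)
    have hs : 0 ≤ s := by
      apply div_nonneg _ (by linarith)
      positivity
    have hmem : (fun i => R) - s • (Pi.single j 1 : ι → ℝ) ∈ C := by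
      intro i
      simp only [Pi.sub_apply, Pi.smul_apply, smul_eq_mul, Pi.single_apply]
      split_ifs <;> nlinarith
    have := h3 _ hmem
    rw [map_sub, map_smul] at this
    have e : f (Pi.single j 1) = - ω j := by simp [ω]
    rw [e, smul_eq_mul] at this
    have e2 : s * (- ω j) = |v| + |f (fun _ => R)| + 1 := by
      have : - ω j ≠ 0 := by linarith
      simp only [s]; exact div_mul_cancel₀ _ this
    rw [e2] at this
    have := le_abs_self (f (fun _ => R))
    have := neg_abs_le v
    linarith
  · intro k hk
    have a1 := h1 k hk
    have a2 := h3 (fun _ => R) (fun _ => le_rfl)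
    rw [hf] at a1 a2
    rw [← Finset.sum_mul] at a2
    linarith [mul_comm R (∑ j, ω j)]

section
variable {ι : Type*} [Fintype ι] [DecidableEq ι]

/-- number of occurrences of `j` in a triple -/
noncomputable def occ (T : Fin 3 → ι) (j : ι) : ℝ := ∑ i, if T i = j then 1 else 0

lemma sum_occ_mul (T : Fin 3 → ι) (φ : ι → ℝ) : ∑ j, occ T j * φ j = ∑ i, φ (T i) := by
  unfold occ
  simp only [Finset.sum_mul]
  rw [Finset.sum_comm]
  refine Finset.sum_congr rfl fun i _ => ?_
  simp

def IsCover (G : Finset (Fin 3 → ι)) (ω : ι → ℝ) : Prop :=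
  (∀ j, 0 ≤ ω j) ∧ ∀ T ∈ G, 1 ≤ ∑ i, ω (T i)

lemma exists_min_cover (G : Finset (Fin 3 → ι)) :
    ∃ ω, IsCover G ω ∧ ∀ ω', IsCover G ω' → ∑ j, ω j ≤ ∑ j, ω' j := by
  let S : Set (ι → ℝ) := {ω | IsCover G ω ∧ ∑ j, ω j ≤ Fintype.card ι}
  have h1 : IsCover G (fun _ => (1:ℝ)) := ⟨fun _ => by norm_num, fun T _ => by simp⟩
  have hne : S.Nonempty := ⟨fun _ => 1, h1, by simp⟩
  have hcl : IsClosed S := by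
    have : S = (⋂ j, {ω : ι → ℝ | 0 ≤ ω j}) ∩ (⋂ T ∈ G, {ω : ι → ℝ | 1 ≤ ∑ i, ω (T i)}) ∩
        {ω | ∑ j, ω j ≤ Fintype.card ι} := by
      ext ω; simp [S, IsCover]
    rw [this]
    refine IsClosed.inter (IsClosed.inter ?_ ?_) ?_
    · exact isClosed_iInter fun j => isClosed_le continuous_const (continuous_apply j)
    · refine isClosed_iInter fun T => isClosed_iInter fun _ => isClosed_le continuous_const ?_
      fun_prop
    · exact isClosed_le (by fun_prop) continuous_const
  have hbd : S ⊆ Set.Icc (fun _ => (0:ℝ)) (fun _ => (Fintype.card ι : ℝ)) := by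
    intro ω hω
    refine ⟨fun j => hω.1.1 j, fun j => le_trans ?_ hω.2⟩
    exact Finset.single_le_sum (f := ω) (fun i _ => hω.1.1 i) (Finset.mem_univ j)
  have hcomp : IsCompact S := IsCompact.of_isClosed_subset isCompact_Icc hcl hbd
  obtain ⟨ω, hω, hmin⟩ := hcomp.exists_isMinOn hne
    (f := fun ω : ι → ℝ => ∑ j, ω j) (by fun_prop)
  refine ⟨ω, hω.1, fun ω' h' => ?_⟩
  by_cases hc : ∑ j, ω' j ≤ Fintype.card ι
  · exact hmin ⟨h', hc⟩
  · push Not at hc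
    exact le_trans hω.2 hc.le

lemma lp_duality (G : Finset (Fin 3 → ι)) (hG : G.Nonempty) :
    ∃ (ω : ι → ℝ) (w : (Fin 3 → ι) → ℝ), IsCover G ω ∧ (∀ ω', IsCover G ω' → ∑ j, ω j ≤ ∑ j, ω' j) ∧
      (∀ T, 0 ≤ w T) ∧ (∑ T, w T = ∑ j, ω j) ∧ (∀ j, ∑ T, w T * occ T j ≤ 1) ∧
      (∀ T, w T ≠ 0 → ∑ i, ω (T i) = 1) ∧
      (∀ j, ω j ≠ 0 → ∑ T, w T * occ T j = 1) := by
  obtain ⟨ω, hω, hmin⟩ := exists_min_cover G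
  set τ := ∑ j, ω j with hτ
  have hτ0 : 0 ≤ τ := Finset.sum_nonneg fun j _ => hω.1 j
  let Φ : ((G → ℝ)) →ₗ[ℝ] (ι → ℝ) :=
    { toFun := fun u j => τ * ∑ T : G, u T * occ T.1 j
      map_add' := by
        intro x y; ext j; simp [add_mul, Finset.sum_add_distrib, mul_add]
      map_smul' := by
        intro c x; ext j; simp only [Pi.smul_apply, smul_eq_mul, RingHom.id_apply, mul_assoc]
        rw [← Finset.mul_sum]; ring }
  let K : Set (ι → ℝ) := Φ '' stdSimplex ℝ G
  have hK : IsCompact K := (isCompact_stdSimplex ℝ G).image (LinearMap.continuous_of_finiteDimensional Φ)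
  have hKc : Convex ℝ K := (convex_stdSimplex ℝ G).linear_image Φ
  have key : ∃ k ∈ K, ∀ j, k j ≤ 1 := by
    rcases sep_lemma K hK hKc 1 with h | ⟨ρ, hρ0, hρ⟩
    · exact h
    exfalso
    have hT : ∀ T ∈ G, ∑ j, ρ j < τ * ∑ i, ρ (T i) := by
      intro T hT
      have := hρ (Φ (Pi.single ⟨T, hT⟩ 1)) ⟨_, single_mem_stdSimplex ℝ _, rfl⟩
      rw [one_mul] at this
      refine lt_of_lt_of_eq this ?_
      have e : ∀ j, Φ (Pi.single ⟨T, hT⟩ 1) j = τ * occ T j := by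
        intro j
        simp only [Φ, LinearMap.coe_mk, AddHom.coe_mk]
        congr 1
        rw [Finset.sum_eq_single (⟨T, hT⟩ : G)]
        · simp
        · intro b _ hb; simp [hb]
        · simp
      simp only [e]
      rw [← sum_occ_mul, Finset.mul_sum]
      refine Finset.sum_congr rfl fun j _ => by ring
    obtain ⟨T0, hT0, hmin0⟩ := G.exists_min_image (fun T => ∑ i, ρ (T i)) hG
    set μ := ∑ i, ρ (T0 i) with hμ
    have hρs : 0 ≤ ∑ j, ρ j := Finset.sum_nonneg fun j _ => hρ0 j
    have h0 := hT T0 hT0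
    have hμ0 : 0 ≤ μ := Finset.sum_nonneg fun i _ => hρ0 _
    have hμpos : 0 < μ := by
      rcases hμ0.lt_or_eq with h | h
      · exact h
      · rw [← hμ, ← h] at h0; linarith
    have hcov : IsCover G (fun j => ρ j / μ) := by
      refine ⟨fun j => div_nonneg (hρ0 j) hμ0, fun T hT => ?_⟩
      rw [← Finset.sum_div, le_div_iff₀ hμpos, one_mul]
      exact hmin0 T hT
    have := hmin _ hcov
    rw [← Finset.sum_div, le_div_iff₀ hμpos] at this
    linarith
  obtain ⟨k, ⟨u, hu, rfl⟩, hk⟩ := key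
  let w : (Fin 3 → ι) → ℝ := fun T => if h : T ∈ G then τ * u ⟨T, h⟩ else 0
  have hw0 : ∀ T, 0 ≤ w T := by
    intro T; simp only [w]; split_ifs with h
    · exact mul_nonneg hτ0 (hu.1 _)
    · exact le_rfl
  have hsum : ∀ g : (Fin 3 → ι) → ℝ, ∑ T, w T * g T = τ * ∑ T : G, u T * g T.1 := by
    intro g
    rw [Finset.mul_sum, ← Finset.sum_subset (Finset.subset_univ G)]
    · rw [← Finset.sum_coe_sort G]
      refine Finset.sum_congr rfl fun T _ => ?_
      simp only [w, T.2, dite_true]; ring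
    · intro T _ hT; simp [w, hT]
  have hwτ : ∑ T, w T = τ := by
    have := hsum (fun _ => 1)
    simp only [mul_one] at this
    rw [this, hu.2, mul_one]
  have hload : ∀ j, ∑ T, w T * occ T j ≤ 1 := by
    intro j; rw [hsum]; exact hk j
  have hwG : ∀ T, w T ≠ 0 → T ∈ G := by
    intro T h; by_contra hn; exact h (by simp [w, hn])
  -- slackness
  have e1 : ∑ T, w T * ∑ i, ω (T i) = ∑ j, (∑ T, w T * occ T j) * ω j := by
    simp only [← sum_occ_mul, Finset.mul_sum, Finset.sum_mul]
    rw [Finset.sum_comm]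
    refine Finset.sum_congr rfl fun j _ => Finset.sum_congr rfl fun T _ => by ring
  have i1 : ∀ T, w T ≤ w T * ∑ i, ω (T i) := by
    intro T
    by_cases h : w T = 0
    · simp [h]
    · have := hω.2 T (hwG T h)
      nlinarith [hw0 T]
  have i2 : ∀ j, (∑ T, w T * occ T j) * ω j ≤ ω j := by
    intro j
    have := hload j
    nlinarith [hω.1 j]
  have hA : ∑ T, w T ≤ ∑ T, w T * ∑ i, ω (T i) := Finset.sum_le_sum fun T _ => i1 T
  have hB : ∑ j, (∑ T, w T * occ T j) * ω j ≤ ∑ j, ω j := Finset.sum_le_sum fun j _ => i2 j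
  have hAe : ∑ T, w T = ∑ T, w T * ∑ i, ω (T i) := by linarith
  have hBe : ∑ j, (∑ T, w T * occ T j) * ω j = ∑ j, ω j := by linarith
  refine ⟨ω, w, hω, hmin, hw0, hwτ, hload, ?_, ?_⟩
  · intro T hT
    have := (Finset.sum_eq_sum_iff_of_le fun T _ => i1 T).1 hAe T (Finset.mem_univ T)
    have h2 : w T * (∑ i, ω (T i) - 1) = 0 := by linarith
    rcases mul_eq_zero.1 h2 with h | h
    · exact absurd h hT
    · linarith
  · intro j hj
    have := (Finset.sum_eq_sum_iff_of_le fun j _ => i2 j).1 hBe j (Finset.mem_univ j)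
    have h2 : (∑ T, w T * occ T j - 1) * ω j = 0 := by linarith
    rcases mul_eq_zero.1 h2 with h | h
    · linarith
    · exact absurd h hj

end

end

/-! Part P2b -/
section
open Finset
section
variable {ι : Type*} [Fintype ι] [DecidableEq ι]

/-- the weighted functional over triples -/
noncomputable def EE (w : (Fin 3 → ι) → ℝ) (ω : ι → ℝ) (φ : ℝ → ℝ) : ℝ :=
  ∑ T, w T * ∑ i, φ (ω (T i))

lemma EE_add (w : (Fin 3 → ι) → ℝ) (ω : ι → ℝ) (φ ψ : ℝ → ℝ) :
    EE w ω (fun x => φ x + ψ x) = EE w ω φ + EE w ω ψ := by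
  unfold EE; simp only [Finset.sum_add_distrib, mul_add]

lemma EE_mul (w : (Fin 3 → ι) → ℝ) (ω : ι → ℝ) (c : ℝ) (φ : ℝ → ℝ) :
    EE w ω (fun x => c * φ x) = c * EE w ω φ := by
  unfold EE; simp only [← Finset.mul_sum]
  rw [Finset.mul_sum]
  refine Finset.sum_congr rfl fun T _ => by ring

lemma EE_EE (w : (Fin 3 → ι) → ℝ) (ω : ι → ℝ) (F : ℝ → (Fin 3 → ι) → ℝ) :
    EE w ω (fun x => ∑ T, w T * F x T) = ∑ T, ∑ T', w T * w T' * ∑ i, F (ω (T i)) T' := by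
  unfold EE
  refine Finset.sum_congr rfl fun T _ => ?_
  rw [Finset.sum_comm, Finset.mul_sum]
  refine Finset.sum_congr rfl fun T' _ => ?_
  rw [← Finset.mul_sum]; ring

lemma sum_fun3 (f : ι → ι → ι → ℝ) :
    ∑ T : Fin 3 → ι, f (T 0) (T 1) (T 2) = ∑ j, ∑ k, ∑ l, f j k l := by
  let e : (Fin 3 → ι) ≃ ι × ι × ι :=
    { toFun := fun T => (T 0, T 1, T 2)
      invFun := fun p => ![p.1, p.2.1, p.2.2]
      left_inv := by intro T; ext i; fin_cases i <;> rfl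
      right_inv := by intro p; rfl }
  refine (Fintype.sum_equiv e (fun T => f (T 0) (T 1) (T 2)) (fun p => f p.1 p.2.1 p.2.2) (fun T => rfl)).trans ?_
  rw [Fintype.sum_prod_type]
  refine Finset.sum_congr rfl fun j _ => ?_
  rw [Fintype.sum_prod_type]

lemma sum_expand (ω : ι → ℝ) (w : (Fin 3 → ι) → ℝ) (Z : ℝ)
    (hφ : ∀ φ : ℝ → ℝ, ∑ j, φ (ω j) = EE w ω φ + Z * φ 0) :
    ∑ j, ∑ k, ∑ l, indR (ω j + ω k + ω l) =
      ∑ T, ∑ T', ∑ T'', w T * w T' * w T'' * N3 (fun i => ω (T i)) (fun i => ω (T' i)) (fun i => ω (T'' i))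
      + 3 * Z * ∑ T, ∑ T', w T * w T' * N2 (fun i => ω (T i)) (fun i => ω (T' i))
      + 3 * Z ^ 2 * ∑ T, w T * N1 (fun i => ω (T i)) := by
  have h1 : ∀ x y, ∑ l, indR (x + y + ω l) = EE w ω (fun z => indR (x + y + z)) + Z * indR (x + y) := by
    intro x y
    rw [hφ (fun z => indR (x + y + z)), add_zero]
  have h2 : ∀ x, ∑ k, ∑ l, indR (x + ω k + ω l) =
      EE w ω (fun y => EE w ω (fun z => indR (x + y + z))) + 2 * Z * EE w ω (fun y => indR (x + y))
        + Z ^ 2 * indR x := by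
    intro x
    rw [hφ (fun y => ∑ l, indR (x + y + ω l))]
    simp only [h1, add_zero]
    have h0 := hφ (fun y => indR (x + y))
    simp only [add_zero] at h0
    rw [h0, EE_add, EE_mul]; ring
  have h3 : ∑ j, ∑ k, ∑ l, indR (ω j + ω k + ω l) =
      EE w ω (fun x => EE w ω (fun y => EE w ω (fun z => indR (x + y + z))))
      + 3 * Z * EE w ω (fun x => EE w ω (fun y => indR (x + y)))
      + 3 * Z ^ 2 * EE w ω indR := by
    rw [hφ (fun x => ∑ k, ∑ l, indR (x + ω k + ω l))]
    simp only [h2, zero_add]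
    have h20 := h2 0
    simp only [zero_add] at h20
    rw [h20]
    rw [EE_add, EE_add, EE_mul, EE_mul]
    have : indR 0 = 0 := indR_of_lt (by norm_num)
    rw [this]
    have : EE w ω (fun y => indR y) = EE w ω indR := rfl
    rw [this]; ring
  rw [h3]
  congr 1
  · congr 1
    · have : ∀ x, EE w ω (fun y => EE w ω (fun z => indR (x + y + z))) =
          ∑ T, w T * ∑ T', w T' * ∑ i, ∑ j, indR (x + ω (T i) + ω (T' j)) := by
        intro x
        have e : (fun y => EE w ω (fun z => indR (x + y + z))) =
          (fun y => ∑ T, w T * (fun y T => ∑ j, indR (x + y + ω (T j))) y T) := rfl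
        rw [e, EE_EE]
        refine Finset.sum_congr rfl fun T _ => ?_
        rw [Finset.mul_sum]
        refine Finset.sum_congr rfl fun T' _ => by ring
      simp only [this]
      rw [EE_EE w ω (fun x T => ∑ T', w T' * ∑ i, ∑ j, indR (x + ω (T i) + ω (T' j)))]
      refine Finset.sum_congr rfl fun T _ => Finset.sum_congr rfl fun T' _ => ?_
      rw [Finset.sum_comm, Finset.mul_sum]
      refine Finset.sum_congr rfl fun T'' _ => ?_
      rw [← Finset.mul_sum]; unfold N3; ring
    · congr 1
      have e : (fun x => EE w ω (fun y => indR (x + y))) =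
          (fun x => ∑ T, w T * (fun x T => ∑ j, indR (x + ω (T j))) x T) := rfl
      rw [e, EE_EE]
      rfl

lemma slack_identity (ω : ι → ℝ) (w : (Fin 3 → ι) → ℝ) (τ : ℝ) (hτ : ∑ T, w T = τ)
    (hs : ∀ j, ω j ≠ 0 → ∑ T, w T * occ T j = 1) (φ : ℝ → ℝ) :
    ∑ j, φ (ω j) = EE w ω φ + (Fintype.card ι - 3 * τ) * φ 0 := by
  have e1 : EE w ω φ = ∑ j, (∑ T, w T * occ T j) * φ (ω j) := by
    unfold EE
    have : ∀ T : Fin 3 → ι, ∑ i, φ (ω (T i)) = ∑ j, occ T j * φ (ω j) :=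
      fun T => (sum_occ_mul T (fun j => φ (ω j))).symm
    simp only [this, Finset.mul_sum, Finset.sum_mul]
    rw [Finset.sum_comm]
    refine Finset.sum_congr rfl fun j _ => Finset.sum_congr rfl fun T _ => by ring
  have e2 : ∑ j, (∑ T, w T * occ T j) = 3 * τ := by
    rw [Finset.sum_comm, ← hτ, Finset.mul_sum]
    refine Finset.sum_congr rfl fun T _ => ?_
    rw [← Finset.mul_sum]
    have := sum_occ_mul T (fun _ => (1:ℝ))
    simp only [mul_one] at this
    rw [this]; simp; ring
  have e3 : ((Fintype.card ι : ℝ) - 3 * τ) * φ 0 = ∑ j, (1 - ∑ T, w T * occ T j) * φ 0 := by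
    rw [← Finset.sum_mul, Finset.sum_sub_distrib, e2]; simp
  rw [e1, e3, ← Finset.sum_add_distrib]
  refine Finset.sum_congr rfl fun j _ => ?_
  by_cases h : ω j = 0
  · rw [h]; ring
  · rw [hs j h]; ring

open Classical in
theorem SG_lemma (G : Finset (Fin 3 → ι)) (hG : G.Nonempty) :
    ∃ (τ σ d : ℝ) (AS AD : Finset ι), 0 ≤ τ ∧ 3 * τ ≤ Fintype.card ι ∧
      (∀ ω', IsCover G ω' → τ ≤ ∑ j, ω' j) ∧ 0 ≤ σ ∧ 0 ≤ d ∧ σ + d ≤ τ ∧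
      (G.card : ℝ) ≤ max ((3 * τ) ^ 3) ((Fintype.card ι : ℝ) ^ 3 - (Fintype.card ι - τ) ^ 3)
        - (1 / 10) * (τ ^ 3 - σ ^ 3 - d ^ 3) ∧
      (AS.card : ℝ) ≤ τ ∧ (AD.card : ℝ) ≤ 3 * τ ∧
      ((G.filter (fun T => ∀ i, T i ∉ AS)).card : ℝ) ≤ 9 * (τ - σ) * (Fintype.card ι) ^ 2 ∧
      ((G.filter (fun T => ¬ ∀ i, T i ∈ AD)).card : ℝ) ≤ 9 * (τ - d) * (Fintype.card ι) ^ 2 := by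
  obtain ⟨ω, w, hω, hmin, hw0, hwτ', hload, htight, hsat⟩ := lp_duality G hG
  obtain ⟨τ, hτ⟩ : ∃ τ, τ = ∑ j, ω j := ⟨_, rfl⟩
  have hwτ : ∑ T, w T = τ := by rw [hwτ', hτ]
  set L : ℝ := (Fintype.card ι : ℝ) with hL
  obtain ⟨Z, hZ⟩ : ∃ Z, Z = L - 3 * τ := ⟨_, rfl⟩
  have hφ : ∀ φ : ℝ → ℝ, ∑ j, φ (ω j) = EE w ω φ + Z * φ 0 := by
    intro φ; rw [hZ]; exact slack_identity ω w τ hwτ hsat φ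
  have hZ0 : 0 ≤ Z := by
    have e2 : ∑ j, (∑ T, w T * occ T j) = 3 * τ := by
      rw [Finset.sum_comm, ← hwτ, Finset.mul_sum]
      refine Finset.sum_congr rfl fun T _ => ?_
      rw [← Finset.mul_sum]
      have := sum_occ_mul T (fun _ => (1:ℝ))
      simp only [mul_one] at this
      rw [this]; simp; ring
    have : ∑ j, (∑ T, w T * occ T j) ≤ ∑ j : ι, (1:ℝ) := Finset.sum_le_sum fun j _ => hload j
    rw [e2] at this
    simp at this
    rw [hZ, hL]; linarith
  have hτpos : 0 < τ := by
    obtain ⟨T, hT⟩ := hG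
    have h1 := hω.2 T hT
    have h2 : ∃ i, 0 < ω (T i) := by
      by_contra hn
      push Not at hn
      have : ∑ i, ω (T i) ≤ 0 := Finset.sum_nonpos fun i _ => hn i
      linarith
    obtain ⟨i, hi⟩ := h2
    rw [hτ]
    exact lt_of_lt_of_le hi (Finset.single_le_sum (f := ω) (fun j _ => hω.1 j) (Finset.mem_univ _))
  have hP : ∀ T, w T ≠ 0 → Prob3 (fun i => ω (T i)) := fun T hT => ⟨fun i => hω.1 _, htight T hT⟩
  let sI : (Fin 3 → ι) → ℝ := fun T => if TypS (fun i => ω (T i)) then 1 else 0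
  let dI : (Fin 3 → ι) → ℝ := fun T => if TypD (fun i => ω (T i)) then 1 else 0
  obtain ⟨σ, hσ⟩ : ∃ σ, σ = ∑ T, w T * sI T := ⟨_, rfl⟩
  obtain ⟨d, hd⟩ : ∃ d, d = ∑ T, w T * dI T := ⟨_, rfl⟩
  have sI0 : ∀ T, 0 ≤ sI T := fun T => by simp only [sI]; split_ifs <;> norm_num
  have dI0 : ∀ T, 0 ≤ dI T := fun T => by simp only [dI]; split_ifs <;> norm_num
  have sdI : ∀ T, sI T + dI T ≤ 1 := by
    intro T
    simp only [sI, dI]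
    split_ifs with h1 h2 <;> norm_num
    obtain ⟨i, hi⟩ := h1
    have := h2 i
    linarith
  have hσ0 : 0 ≤ σ := by rw [hσ]; exact Finset.sum_nonneg fun T _ => mul_nonneg (hw0 T) (sI0 T)
  have hd0 : 0 ≤ d := by rw [hd]; exact Finset.sum_nonneg fun T _ => mul_nonneg (hw0 T) (dI0 T)
  have hσd : σ + d ≤ τ := by
    rw [hσ, hd, ← hwτ, ← Finset.sum_add_distrib]
    refine Finset.sum_le_sum fun T _ => ?_
    have := mul_le_mul_of_nonneg_left (sdI T) (hw0 T)
    linarith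
  obtain ⟨κ, hκ⟩ : ∃ κ, κ = Z / τ := ⟨_, rfl⟩
  have hκ0 : 0 ≤ κ := by rw [hκ]; exact div_nonneg hZ0 hτpos.le
  have hκτ : κ * τ = Z := by rw [hκ]; exact div_mul_cancel₀ _ hτpos.ne'
  -- counting
  have hcount : (G.card : ℝ) ≤ ∑ j, ∑ k, ∑ l, indR (ω j + ω k + ω l) := by
    rw [← sum_fun3 (fun j k l => indR (ω j + ω k + ω l))]
    rw [Finset.card_eq_sum_ones, Nat.cast_sum]
    calc ∑ T ∈ G, ((1:ℕ):ℝ) ≤ ∑ T ∈ G, indR (ω (T 0) + ω (T 1) + ω (T 2)) := by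
          refine Finset.sum_le_sum fun T hT => ?_
          have := hω.2 T hT
          rw [Fin.sum_univ_three] at this
          rw [indR_of_le this]; norm_num
      _ ≤ _ := Finset.sum_le_sum_of_subset_of_nonneg (Finset.subset_univ _) fun _ _ _ => indR_nonneg _
  have hexp := sum_expand ω w Z hφ
  have hHH : ∑ j, ∑ k, ∑ l, indR (ω j + ω k + ω l) = ∑ T, ∑ T', ∑ T'', w T * w T' * w T'' *
      HH κ (fun i => ω (T i)) (fun i => ω (T' i)) (fun i => ω (T'' i)) := by
    rw [hexp]
    unfold HH
    have q1 : ∀ f : (Fin 3 → ι) → (Fin 3 → ι) → ℝ,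
        ∑ T, ∑ T', ∑ T'', w T * w T' * w T'' * (f T T') = τ * ∑ T, ∑ T', w T * w T' * f T T' := by
      intro f
      rw [Finset.mul_sum]
      refine Finset.sum_congr rfl fun T _ => ?_
      rw [Finset.mul_sum]
      refine Finset.sum_congr rfl fun T' _ => ?_
      rw [← hwτ, Finset.sum_mul]
      refine Finset.sum_congr rfl fun T'' _ => by ring
    have q2 : ∀ f : (Fin 3 → ι) → (Fin 3 → ι) → ℝ,
        ∑ T, ∑ T', ∑ T'', w T * w T' * w T'' * (f T T'') = τ * ∑ T, ∑ T', w T * w T' * f T T' := by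
      intro f
      rw [← q1]
      refine Finset.sum_congr rfl fun T _ => ?_
      rw [Finset.sum_comm]
      refine Finset.sum_congr rfl fun T' _ => Finset.sum_congr rfl fun T'' _ => by ring
    have q3 : ∀ f : (Fin 3 → ι) → (Fin 3 → ι) → ℝ,
        ∑ T, ∑ T', ∑ T'', w T * w T' * w T'' * (f T' T'') = τ * ∑ T, ∑ T', w T * w T' * f T T' := by
      intro f
      rw [← hwτ, Finset.sum_mul]
      refine Finset.sum_congr rfl fun T _ => ?_
      rw [Finset.mul_sum]
      refine Finset.sum_congr rfl fun T' _ => ?_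
      rw [Finset.mul_sum]
      refine Finset.sum_congr rfl fun T'' _ => by ring
    have r1 : ∀ f : (Fin 3 → ι) → ℝ, ∑ T, ∑ T', w T * w T' * f T = τ * ∑ T, w T * f T := by
      intro f
      rw [Finset.mul_sum]
      refine Finset.sum_congr rfl fun T _ => ?_
      rw [← hwτ, Finset.sum_mul]
      refine Finset.sum_congr rfl fun T' _ => by ring
    have r2 : ∀ f : (Fin 3 → ι) → ℝ, ∑ T, ∑ T', w T * w T' * f T' = τ * ∑ T, w T * f T := by
      intro f
      rw [← r1, Finset.sum_comm]
      refine Finset.sum_congr rfl fun T _ => Finset.sum_congr rfl fun T' _ => by ring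
    have expand : ∀ T T' T'' : Fin 3 → ι, w T * w T' * w T'' *
        (N3 (fun i => ω (T i)) (fun i => ω (T' i)) (fun i => ω (T'' i)) +
          κ * (N2 (fun i => ω (T i)) (fun i => ω (T' i)) + N2 (fun i => ω (T i)) (fun i => ω (T'' i)) +
            N2 (fun i => ω (T' i)) (fun i => ω (T'' i))) +
          κ ^ 2 * (N1 (fun i => ω (T i)) + N1 (fun i => ω (T' i)) + N1 (fun i => ω (T'' i)))) =
        w T * w T' * w T'' * N3 (fun i => ω (T i)) (fun i => ω (T' i)) (fun i => ω (T'' i)) +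
        (w T * w T' * w T'' * (κ * N2 (fun i => ω (T i)) (fun i => ω (T' i)))
        + w T * w T' * w T'' * (κ * N2 (fun i => ω (T i)) (fun i => ω (T'' i)))
        + w T * w T' * w T'' * (κ * N2 (fun i => ω (T' i)) (fun i => ω (T'' i))))
        + (w T * w T' * w T'' * (κ ^ 2 * N1 (fun i => ω (T i)))
        + w T * w T' * w T'' * (κ ^ 2 * N1 (fun i => ω (T' i)))
        + w T * w T' * w T'' * (κ ^ 2 * N1 (fun i => ω (T'' i)))) := by
      intros; ring
    simp only [expand, Finset.sum_add_distrib]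
    rw [q1 (fun T T' => κ * N2 (fun i => ω (T i)) (fun i => ω (T' i))),
      q2 (fun T T' => κ * N2 (fun i => ω (T i)) (fun i => ω (T' i))),
      q3 (fun T T' => κ * N2 (fun i => ω (T i)) (fun i => ω (T' i))),
      q1 (fun T T' => κ ^ 2 * N1 (fun i => ω (T i))),
      q1 (fun T T' => κ ^ 2 * N1 (fun i => ω (T' i))),
      q3 (fun T T' => κ ^ 2 * N1 (fun i => ω (T' i))), 
      r1 (fun T => κ ^ 2 * N1 (fun i => ω (T i))), r2 (fun T => κ ^ 2 * N1 (fun i => ω (T i)))]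
    have m1 : ∑ T, ∑ T', w T * w T' * (κ * N2 (fun i => ω (T i)) (fun i => ω (T' i))) =
        κ * ∑ T, ∑ T', w T * w T' * (N2 (fun i => ω (T i)) (fun i => ω (T' i))) := by
      simp only [Finset.mul_sum]
      refine Finset.sum_congr rfl fun T _ => Finset.sum_congr rfl fun T' _ => by ring
    have m2 : ∑ T, w T * (κ ^ 2 * N1 (fun i => ω (T i))) =
        κ ^ 2 * ∑ T, w T * (N1 (fun i => ω (T i))) := by
      simp only [Finset.mul_sum]
      refine Finset.sum_congr rfl fun T _ => by ring
    rw [m1, m2, ← hκτ]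
    ring
  have hbd : ∑ j, ∑ k, ∑ l, indR (ω j + ω k + ω l) ≤
      boundH κ * τ ^ 3 - (1 / 10) * (τ ^ 3 - σ ^ 3 - d ^ 3) := by
    rw [hHH]
    have cube : ∀ f : (Fin 3 → ι) → ℝ, ∑ T, ∑ T', ∑ T'', w T * w T' * w T'' * (f T * f T' * f T'') =
        (∑ T, w T * f T) ^ 3 := by
      intro f
      rw [pow_three, Finset.sum_mul]
      refine Finset.sum_congr rfl fun T _ => ?_
      rw [Finset.sum_mul, Finset.mul_sum]
      refine Finset.sum_congr rfl fun T' _ => ?_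
      rw [Finset.mul_sum, Finset.mul_sum]
      refine Finset.sum_congr rfl fun T'' _ => by ring
    have pull : ∀ (c : ℝ) (f : (Fin 3 → ι) → (Fin 3 → ι) → (Fin 3 → ι) → ℝ),
        ∑ T, ∑ T', ∑ T'', c * f T T' T'' = c * ∑ T, ∑ T', ∑ T'', f T T' T'' := by
      intro c f
      simp only [Finset.mul_sum]
    have c1 := cube (fun _ => 1)
    simp only [mul_one] at c1
    rw [hwτ] at c1
    have c2 := cube sI
    have c3 := cube dI
    rw [← hσ] at c2
    rw [← hd] at c3
    calc _ ≤ ∑ T, ∑ T', ∑ T'', ((boundH κ - 1 / 10) * (w T * w T' * w T'') +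
          ((1 / 10) * (w T * w T' * w T'' * (sI T * sI T' * sI T'')) +
           (1 / 10) * (w T * w T' * w T'' * (dI T * dI T' * dI T'')))) := by
          refine Finset.sum_le_sum fun T _ => Finset.sum_le_sum fun T' _ => Finset.sum_le_sum fun T'' _ => ?_
          by_cases h1 : w T = 0
          · simp [h1]
          by_cases h2 : w T' = 0
          · simp [h2]
          by_cases h3 : w T'' = 0
          · simp [h3]
          have hw3 : 0 ≤ w T * w T' * w T'' := mul_nonneg (mul_nonneg (hw0 _) (hw0 _)) (hw0 _)
          have : HH κ (fun i => ω (T i)) (fun i => ω (T' i)) (fun i => ω (T'' i)) ≤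
              boundH κ - 1 / 10 + (1 / 10) * (sI T * sI T' * sI T'') + (1 / 10) * (dI T * dI T' * dI T'') := by
            have s0 : 0 ≤ sI T * sI T' * sI T'' := mul_nonneg (mul_nonneg (sI0 _) (sI0 _)) (sI0 _)
            have d0 : 0 ≤ dI T * dI T' * dI T'' := mul_nonneg (mul_nonneg (dI0 _) (dI0 _)) (dI0 _)
            by_cases hS : (TypS (fun i => ω (T i)) ∧ TypS (fun i => ω (T' i)) ∧ TypS (fun i => ω (T'' i)))
            · have := HH_SSS (κ := κ) (hP T h1) (hP T' h2) (hP T'' h3) hS.1 hS.2.1 hS.2.2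
              have e : sI T * sI T' * sI T'' = 1 := by simp [sI, hS.1, hS.2.1, hS.2.2]
              rw [e]; linarith
            by_cases hD : (TypD (fun i => ω (T i)) ∧ TypD (fun i => ω (T' i)) ∧ TypD (fun i => ω (T'' i)))
            · have := HH_DDD (κ := κ) hD.1 hD.2.1 hD.2.2
              have e : dI T * dI T' * dI T'' = 1 := by simp [dI, hD.1, hD.2.1, hD.2.2]
              rw [e]; linarith
            have := HH_main hκ0 (hP T h1) (hP T' h2) (hP T'' h3) hS hD
            linarith
          have := mul_le_mul_of_nonneg_left this hw3
          linarith
      _ = _ := by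
          simp only [Finset.sum_add_distrib]
          rw [pull, pull, pull, c1, c2, c3]; ring
  have hbe : boundH κ * τ ^ 3 = max ((3 * τ) ^ 3) (L ^ 3 - (L - τ) ^ 3) := by
    unfold boundH
    rw [max_mul_of_nonneg _ _ (by positivity)]
    have hLe : L = κ * τ + 3 * τ := by rw [hκτ, hZ]; ring
    congr 1
    · ring
    · rw [hLe]; ring
  -- the small sets
  have cnt : ∀ P : ℝ → Prop, ¬ P 0 → ((univ.filter (fun j => P (ω j))).card : ℝ) =
      ∑ T, w T * ∑ i, if P (ω (T i)) then (1:ℝ) else 0 := by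
    intro P hP0
    have := hφ (fun x => if P x then 1 else 0)
    simp only [hP0, if_false, mul_zero, add_zero] at this
    rw [← Finset.sum_boole, this]; rfl
  have cov : ∀ (B : Finset ι) (Q : (Fin 3 → ι) → Prop) (_ : ∀ T ∈ G, Q T → ∃ i, T i ∈ B),
      ((G.filter Q).card : ℝ) ≤ 3 * B.card * L ^ 2 := by
    intro B Q hQ
    have hsub : G.filter Q ⊆ univ.biUnion (fun i : Fin 3 => univ.filter (fun T : Fin 3 → ι => T i ∈ B)) := by
      intro T hT
      rw [Finset.mem_filter] at hT
      obtain ⟨i, hi⟩ := hQ T hT.1 hT.2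
      simp only [mem_biUnion, mem_filter, mem_univ, true_and]
      exact ⟨i, hi⟩
    have hc : ∀ i : Fin 3, (univ.filter (fun T : Fin 3 → ι => T i ∈ B)).card =
        B.card * (Fintype.card ι) ^ 2 := by
      intro i
      have : univ.filter (fun T : Fin 3 → ι => T i ∈ B) =
          Fintype.piFinset (fun k => if k = i then B else univ) := by
        ext T
        simp only [mem_filter, mem_univ, true_and, Fintype.mem_piFinset]
        constructor
        · intro h k
          split_ifs with hk
          · rw [hk]; exact h
          · simp
        · intro h; have := h i; simpa using this
      rw [this, Fintype.card_piFinset, Fin.prod_univ_three]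
      fin_cases i <;> simp <;> ring
    have := (Finset.card_le_card hsub).trans (Finset.card_biUnion_le)
    simp only [hc] at this
    have h2 : ((G.filter Q).card : ℝ) ≤ ((∑ i : Fin 3, B.card * (Fintype.card ι) ^ 2 : ℕ) : ℝ) := by
      exact_mod_cast this
    refine h2.trans (le_of_eq ?_)
    simp; ring
  refine ⟨τ, σ, d, univ.filter (fun j => ω j = 1), univ.filter (fun j => ω j = 1 / 3), hτpos.le,
    by rw [hZ] at hZ0; linarith, fun ω' h => by rw [hτ]; exact hmin ω' h, hσ0, hd0, hσd, ?_, ?_, ?_, ?_, ?_⟩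
  · rw [← hbe]; exact hcount.trans hbd
  · rw [← Finset.sum_boole, hτ]
    refine Finset.sum_le_sum fun j _ => ?_
    split_ifs with h
    · rw [h]
    · exact hω.1 j
  · rw [← Finset.sum_boole, hτ, Finset.mul_sum]
    refine Finset.sum_le_sum fun j _ => ?_
    split_ifs with h
    · rw [h]; norm_num
    · exact mul_nonneg (by norm_num) (hω.1 j)
  · have hB := cov (univ.filter (fun j => ω j ≠ 0 ∧ ω j ≠ 1)) (fun T => ∀ i, T i ∉ univ.filter (fun j => ω j = 1)) (by
      intro T hT h
      by_contra hn
      push Not at hn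
      simp only [mem_filter, mem_univ, true_and, not_and_or, not_not] at h hn
      have : ∑ i, ω (T i) = 0 := Finset.sum_eq_zero fun i _ => (hn i).resolve_right (h i)
      have := hω.2 T hT
      linarith)
    refine le_trans (le_of_eq (by congr)) (hB.trans ?_)
    have hc : ((univ.filter (fun j => ω j ≠ 0 ∧ ω j ≠ 1)).card : ℝ) =
        ∑ T, w T * ∑ i, (if ω (T i) ≠ 0 ∧ ω (T i) ≠ 1 then (1:ℝ) else 0) := by
      convert cnt (fun x => x ≠ 0 ∧ x ≠ 1) (by simp)
    rw [hc]
    have : ∑ T, w T * ∑ i, (if ω (T i) ≠ 0 ∧ ω (T i) ≠ 1 then (1:ℝ) else 0) ≤ 3 * (τ - σ) := by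
      rw [← hwτ, hσ, ← Finset.sum_sub_distrib, Finset.mul_sum]
      refine Finset.sum_le_sum fun T _ => ?_
      by_cases h1 : w T = 0
      · simp [h1]
      by_cases hs : TypS (fun i => ω (T i))
      · have e := typS_sum (hP T h1) hs (fun x => if x ≠ 0 ∧ x ≠ 1 then (1:ℝ) else 0)
        rw [e]; simp [sI, hs]
      · have e : ∑ i, (if ω (T i) ≠ 0 ∧ ω (T i) ≠ 1 then (1:ℝ) else 0) ≤ ∑ i : Fin 3, (1:ℝ) :=
          Finset.sum_le_sum fun i _ => by split_ifs <;> norm_num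
        simp only [sum_const, card_univ, Fintype.card_fin, nsmul_eq_mul, mul_one] at e
        have := mul_le_mul_of_nonneg_left e (hw0 T)
        simp only [sI, hs, if_false]
        push_cast at this
        linarith
    have hL2 : 0 ≤ L ^ 2 := sq_nonneg L
    nlinarith
  · have hB := cov (univ.filter (fun j => ω j ≠ 0 ∧ ω j ≠ 1 / 3)) (fun T => ¬ ∀ i, T i ∈ univ.filter (fun j => ω j = 1 / 3)) (by
      intro T hT h
      by_contra hn
      push Not at hn
      simp only [mem_filter, mem_univ, true_and, not_and_or, not_not, not_forall] at h hn
      obtain ⟨i, hi⟩ := h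
      have h0 : ω (T i) = 0 := (hn i).resolve_right hi
      have : ∑ k, ω (T k) < ∑ k : Fin 3, (1 / 3 : ℝ) := by
        apply Finset.sum_lt_sum
        · intro k _
          rcases hn k with h | h <;> rw [h]; norm_num
        · exact ⟨i, Finset.mem_univ _, by rw [h0]; norm_num⟩
      have h2 := hω.2 T hT
      simp at this
      linarith)
    refine le_trans (le_of_eq (by congr)) (hB.trans ?_)
    have hc : ((univ.filter (fun j => ω j ≠ 0 ∧ ω j ≠ 1 / 3)).card : ℝ) =
        ∑ T, w T * ∑ i, (if ω (T i) ≠ 0 ∧ ω (T i) ≠ 1 / 3 then (1:ℝ) else 0) := by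
      convert cnt (fun x => x ≠ 0 ∧ x ≠ 1 / 3) (by simp)
    rw [hc]
    have : ∑ T, w T * ∑ i, (if ω (T i) ≠ 0 ∧ ω (T i) ≠ 1 / 3 then (1:ℝ) else 0) ≤ 3 * (τ - d) := by
      rw [← hwτ, hd, ← Finset.sum_sub_distrib, Finset.mul_sum]
      refine Finset.sum_le_sum fun T _ => ?_
      by_cases h1 : w T = 0
      · simp [h1]
      by_cases hs : TypD (fun i => ω (T i))
      · have e : ∑ i, (if ω (T i) ≠ 0 ∧ ω (T i) ≠ 1 / 3 then (1:ℝ) else 0) = 0 :=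
          Finset.sum_eq_zero fun i _ => by
            have := hs i
            simp only at this
            simp [this]
        rw [e]; simp [dI, hs]
      · have e : ∑ i, (if ω (T i) ≠ 0 ∧ ω (T i) ≠ 1 / 3 then (1:ℝ) else 0) ≤ ∑ i : Fin 3, (1:ℝ) :=
          Finset.sum_le_sum fun i _ => by split_ifs <;> norm_num
        simp only [sum_const, card_univ, Fintype.card_fin, nsmul_eq_mul, mul_one] at e
        have := mul_le_mul_of_nonneg_left e (hw0 T)
        simp only [dI, hs, if_false]
        push_cast at this
        linarith
    have hL2 : 0 ≤ L ^ 2 := sq_nonneg L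
    nlinarith
end

end

/-! Part P4 -/
section
open Finset

/-- rainbow matching for the colours in `I` -/
def RM {ι : Type*} (I : Finset ι) (F : ι → Finset (Finset ℕ)) : Prop :=
  ∃ e : ι → Finset ℕ, (∀ i ∈ I, e i ∈ F i) ∧ ∀ i ∈ I, ∀ j ∈ I, i ≠ j → Disjoint (e i) (e j)

/-- 3-graph on `[n]` -/
def KG (n : ℕ) (F : Finset (Finset ℕ)) : Prop := ∀ e ∈ F, e ⊆ Finset.Icc 1 n ∧ e.card = 3

/-- closed under replacing an element by a smaller one -/
def ShiftedP (F : Finset (Finset ℕ)) : Prop :=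
  ∀ e ∈ F, ∀ i j : ℕ, 1 ≤ i → i < j → j ∈ e → i ∉ e → insert i (e.erase j) ∈ F

def cmpE (i j : ℕ) (e : Finset ℕ) : Finset ℕ := if j ∈ e ∧ i ∉ e then insert i (e.erase j) else e

def gE (i j : ℕ) (F : Finset (Finset ℕ)) (e : Finset ℕ) : Finset ℕ :=
  if cmpE i j e ∈ F then e else cmpE i j e

def shF (i j : ℕ) (F : Finset (Finset ℕ)) : Finset (Finset ℕ) := F.image (gE i j F)

def swE (i j : ℕ) (e : Finset ℕ) : Finset ℕ := e.map (Equiv.swap i j).toEmbedding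

lemma mem_swE (i j : ℕ) (e : Finset ℕ) (x : ℕ) : x ∈ swE i j e ↔ Equiv.swap i j x ∈ e := by
  unfold swE
  rw [Finset.mem_map_equiv, Equiv.symm_swap]

lemma swE_swE (i j : ℕ) (e : Finset ℕ) : swE i j (swE i j e) = e := by
  ext x; rw [mem_swE, mem_swE, Equiv.swap_apply_self]

lemma swE_eq_cmp (i j : ℕ) (e : Finset ℕ) (h1 : j ∈ e) (h2 : i ∉ e) : swE i j e = cmpE i j e := by
  have hij : i ≠ j := by rintro rfl; exact h2 h1
  unfold cmpE
  rw [if_pos ⟨h1, h2⟩]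
  ext x
  rw [mem_swE, Equiv.swap_apply_def]
  split_ifs with h3 h4
  · subst h3; simp [h1]
  · subst h4; simp [h2, hij.symm]
  · simp [h3, h4]

lemma swE_self (i j : ℕ) (e : Finset ℕ) (h1 : j ∉ e) (h2 : i ∉ e) : swE i j e = e := by
  ext x
  rw [mem_swE, Equiv.swap_apply_def]
  split_ifs with h3 h4
  · subst h3; simp [h1, h2]
  · subst h4; simp [h1, h2]
  · rfl

lemma mem_shF {i j : ℕ} {F : Finset (Finset ℕ)} {a : Finset ℕ} (h : a ∈ shF i j F) :
    (a ∈ F ∧ cmpE i j a ∈ F) ∨ (a ∉ F ∧ swE i j a ∈ F ∧ i ∈ a ∧ j ∉ a) := by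
  unfold shF at h
  rw [Finset.mem_image] at h
  obtain ⟨e, he, rfl⟩ := h
  unfold gE
  split_ifs with h1
  · exact Or.inl ⟨he, h1⟩
  · right
    have h2 : j ∈ e ∧ i ∉ e := by
      by_contra hn
      apply h1; unfold cmpE; rw [if_neg hn]; exact he
    refine ⟨h1, ?_, ?_, ?_⟩
    · rw [← swE_eq_cmp i j e h2.1 h2.2, swE_swE]; exact he
    · rw [← swE_eq_cmp i j e h2.1 h2.2, mem_swE]; simpa using h2.1
    · rw [← swE_eq_cmp i j e h2.1 h2.2, mem_swE]; simpa using h2.2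

lemma gE_inj (i j : ℕ) (F : Finset (Finset ℕ)) : Set.InjOn (gE i j F) F := by
  intro a ha b hb hab
  have key : ∀ e ∈ F, cmpE i j e ∉ F → cmpE i j e = swE i j e := by
    intro e he h1
    have h2 : j ∈ e ∧ i ∉ e := by
      by_contra hn
      apply h1; unfold cmpE; rw [if_neg hn]; exact he
    exact (swE_eq_cmp i j e h2.1 h2.2).symm
  unfold gE at hab
  split_ifs at hab with h1 h2 h2
  · exact hab
  · rw [← hab] at h2; exact absurd ha h2
  · rw [hab] at h1; exact absurd hb h1
  · rw [key a ha h1, key b hb h2] at hab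
    have := congrArg (swE i j) hab
    rwa [swE_swE, swE_swE] at this

lemma shF_card (i j : ℕ) (F : Finset (Finset ℕ)) : (shF i j F).card = F.card :=
  Finset.card_image_of_injOn (gE_inj i j F)

lemma shF_KG {n i j : ℕ} (hi : 1 ≤ i) (hij : i < j) {F : Finset (Finset ℕ)} (h : KG n F) : KG n (shF i j F) := by
  intro a ha
  rcases mem_shF ha with h1 | ⟨_, h2, h3, h4⟩
  · exact h a h1.1
  · have := h _ h2
    refine ⟨?_, ?_⟩
    · have hj : j ≤ n := by
        have : j ∈ swE i j a := by rw [mem_swE]; simpa using h3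
        have := (h _ h2).1 this
        simp at this; omega
      intro x hx
      by_cases hxi : x = i
      · subst hxi; simp; omega
      · apply this.1
        rw [mem_swE, Equiv.swap_apply_of_ne_of_ne hxi]
        · exact hx
        · rintro rfl; exact h4 hx
    · rw [← this.2]; unfold swE; simp

lemma shF_RM {ι : Type*} {I : Finset ι} {F : ι → Finset (Finset ℕ)} {i j : ℕ} 
    (h : RM I (fun l => shF i j (F l))) : RM I F := by
  obtain ⟨e, he, hd⟩ := h
  by_cases hall : ∀ l ∈ I, e l ∈ F l
  · exact ⟨e, hall, hd⟩
  push Not at hall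
  obtain ⟨l, hl, hlF⟩ := hall
  have hl2 := (mem_shF (he l hl)).resolve_left (fun h => hlF h.1)
  refine ⟨fun k => swE i j (e k), ?_, ?_⟩
  · intro k hk
    by_cases hkl : k = l
    · subst hkl; exact hl2.2.1
    · have hik : i ∉ e k := fun h => Finset.disjoint_left.mp (hd k hk l hl hkl) h hl2.2.2.1
      have h2 := (mem_shF (he k hk)).resolve_right (fun h => hik h.2.2.1)
      by_cases hj : j ∈ e k
      · simp only; rw [swE_eq_cmp i j _ hj hik]; exact h2.2
      · simp only; rw [swE_self i j _ hj hik]; exact h2.1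
  · intro a ha b hb hab
    have := hd a ha b hb hab
    unfold swE
    rw [Finset.disjoint_map]; exact this

def wtF (F : Finset (Finset ℕ)) : ℕ := ∑ e ∈ F, ∑ v ∈ e, v

lemma cmpE_sum {i j : ℕ} {e : Finset ℕ} (h1 : j ∈ e) (h2 : i ∉ e) :
    ∑ v ∈ cmpE i j e, v + j = ∑ v ∈ e, v + i := by
  unfold cmpE
  rw [if_pos ⟨h1, h2⟩, Finset.sum_insert (by simp [h2])]
  have := Finset.add_sum_erase e (fun v => v) h1
  omega

lemma gE_sum_le {i j : ℕ} (hij : i < j) (F : Finset (Finset ℕ)) (e : Finset ℕ) : ∑ v ∈ gE i j F e, v ≤ ∑ v ∈ e, v := by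
  unfold gE
  split_ifs with h
  · exact le_rfl
  · by_cases h2 : j ∈ e ∧ i ∉ e
    · have := cmpE_sum h2.1 h2.2; omega
    · unfold cmpE; rw [if_neg h2]

lemma wtF_le {i j : ℕ} (hij : i < j) (F : Finset (Finset ℕ)) : wtF (shF i j F) ≤ wtF F := by
  unfold wtF shF
  rw [Finset.sum_image (gE_inj i j F)]
  exact Finset.sum_le_sum fun e _ => gE_sum_le hij F e

lemma wtF_lt {i j : ℕ} (hij : i < j) (F : Finset (Finset ℕ)) (e : Finset ℕ) (he : e ∈ F)
    (h1 : j ∈ e) (h2 : i ∉ e) (h3 : cmpE i j e ∉ F) : wtF (shF i j F) < wtF F := by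
  unfold wtF shF
  rw [Finset.sum_image (gE_inj i j F)]
  refine Finset.sum_lt_sum (fun e _ => gE_sum_le hij F e) ⟨e, he, ?_⟩
  unfold gE; rw [if_neg h3]
  have := cmpE_sum h1 h2; omega

lemma exists_shifted {ι : Type*} (I : Finset ι) (n : ℕ) (N : ℕ) : ∀ (F : ι → Finset (Finset ℕ)),
    ∑ l ∈ I, wtF (F l) = N → (∀ l ∈ I, KG n (F l)) → ¬ RM I F →
    ∃ F' : ι → Finset (Finset ℕ), (∀ l ∈ I, KG n (F' l)) ∧ (∀ l ∈ I, ShiftedP (F' l)) ∧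
      (∀ l ∈ I, (F' l).card = (F l).card) ∧ ¬ RM I F' := by
  induction N using Nat.strong_induction_on with
  | _ N ih =>
    intro F hN hK hR
    by_cases hs : ∀ l ∈ I, ShiftedP (F l)
    · exact ⟨F, hK, hs, fun _ _ => rfl, hR⟩
    · unfold ShiftedP at hs
      push Not at hs
      obtain ⟨l, hl, e, he, i, j, hi, hij, hj, hie, hne⟩ := hs
      have h3 : cmpE i j e ∉ F l := by unfold cmpE; rw [if_pos ⟨hj, hie⟩]; exact hne
      have hlt : ∑ l ∈ I, wtF (shF i j (F l)) < N := by
        rw [← hN]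
        exact Finset.sum_lt_sum (fun l _ => wtF_le hij (F l)) ⟨l, hl, wtF_lt hij (F l) e he hj hie h3⟩
      obtain ⟨F', a1, a2, a3, a4⟩ := ih _ hlt (fun l => shF i j (F l)) rfl
        (fun l hl => shF_KG hi hij (hK l hl)) (fun h => hR (shF_RM h))
      exact ⟨F', a1, a2, fun l hl => (a3 l hl).trans (shF_card i j _), a4⟩

lemma shifted_triple {F : Finset (Finset ℕ)} (hF : ShiftedP F) {a b c p q r : ℕ} (hab : a < b) (hbc : b < c)
    (hpq : p < q) (hqr : q < r) (hp : 1 ≤ p) (hpa : p ≤ a) (hqb : q ≤ b) (hrc : r ≤ c)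
    (h : ({a, b, c} : Finset ℕ) ∈ F) : ({p, q, r} : Finset ℕ) ∈ F := by
  have s1 : ({p, b, c} : Finset ℕ) ∈ F := by
    rcases hpa.eq_or_lt with rfl | hlt
    · exact h
    · have := hF _ h p a hp hlt (by simp) (by simp; omega)
      convert this using 1
      ext x; simp only [mem_insert, mem_singleton, mem_erase]; omega
  have s2 : ({p, q, c} : Finset ℕ) ∈ F := by
    rcases hqb.eq_or_lt with rfl | hlt
    · exact s1
    · have := hF _ s1 q b (by omega) hlt (by simp) (by simp; omega)
      convert this using 1
      ext x; simp only [mem_insert, mem_singleton, mem_erase]; omega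
  rcases hrc.eq_or_lt with rfl | hlt
  · exact s2
  · have := hF _ s2 r c (by omega) hlt (by simp) (by simp; omega)
    convert this using 1
    ext x; simp only [mem_insert, mem_singleton, mem_erase]; omega

lemma card3_sorted {e : Finset ℕ} (he : e.card = 3) : ∃ a b c, a < b ∧ b < c ∧ e = {a, b, c} := by
  obtain ⟨x, y, z, hxy, hxz, hyz, rfl⟩ := Finset.card_eq_three.mp he
  have perm : ∀ a b c : ℕ, (∀ t, (t = x ∨ t = y ∨ t = z) ↔ (t = a ∨ t = b ∨ t = c)) →
      ({x, y, z} : Finset ℕ) = {a, b, c} := by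
    intro a b c h; ext t; simpa using h t
  rcases lt_or_gt_of_ne hxy with h1 | h1 <;> rcases lt_or_gt_of_ne hxz with h2 | h2 <;>
    rcases lt_or_gt_of_ne hyz with h3 | h3
  · exact ⟨x, y, z, h1, h3, rfl⟩
  · exact ⟨x, z, y, h2, h3, perm _ _ _ (by intro; omega)⟩
  · omega
  · exact ⟨z, x, y, h2, h1, perm _ _ _ (by intro; omega)⟩
  · exact ⟨y, x, z, h1, h2, perm _ _ _ (by intro; omega)⟩
  · omega
  · exact ⟨y, z, x, h3, h2, perm _ _ _ (by intro; omega)⟩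
  · exact ⟨z, y, x, h3, h1, perm _ _ _ (by intro; omega)⟩

lemma shifted_image {F : Finset (Finset ℕ)} (hF : ShiftedP F) {e : Finset ℕ} (he : e ∈ F) (hc : e.card = 3)
    (g : ℕ → ℕ) (hg1 : ∀ v ∈ e, 1 ≤ g v) (hg : ∀ v ∈ e, g v ≤ v) (hinj : Set.InjOn g e) : e.image g ∈ F := by
  obtain ⟨a, b, c, hab, hbc, rfl⟩ := card3_sorted hc
  have hc' : (Finset.image g {a, b, c}).card = 3 := by rw [Finset.card_image_of_injOn hinj, hc]
  obtain ⟨p, q, r, hpq, hqr, heq⟩ := card3_sorted hc'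
  rw [heq]
  have ga := hg a (by simp)
  have gb := hg b (by simp)
  have gc := hg c (by simp)
  have ga1 := hg1 a (by simp)
  have gb1 := hg1 b (by simp)
  have gc1 := hg1 c (by simp)
  have m : ∀ t, (t = g a ∨ t = g b ∨ t = g c) ↔ (t = p ∨ t = q ∨ t = r) := by
    intro t
    have : t ∈ Finset.image g {a, b, c} ↔ t ∈ ({p, q, r} : Finset ℕ) := by rw [heq]
    simpa [eq_comm] using this
  have mp := m p
  have mq := m q
  have mr := m r
  have ma := m (g a)
  have mb := m (g b)
  have mc := m (g c)
  apply shifted_triple hF hab hbc hpq hqr _ _ _ _ he <;> omega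

end

/-! Part P5 -/
section
open Finset

lemma card_supset {V : Finset ℕ} {F : Finset (Finset ℕ)} (hF : ∀ e ∈ F, e ⊆ V ∧ e.card = 3) (S : Finset ℕ) :
    (F.filter (fun e => S ⊆ e)).card ≤ (V \ S).card.choose (3 - S.card) := by
  rw [← Finset.card_powersetCard]
  apply Finset.card_le_card_of_injOn (fun e => e \ S)
  · intro e he
    simp only [coe_filter, Set.mem_setOf_eq] at he
    simp only [mem_coe, mem_powersetCard]
    refine ⟨Finset.sdiff_subset_sdiff (hF e he.1).1 (Finset.Subset.refl _), ?_⟩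
    rw [Finset.card_sdiff_of_subset he.2, (hF e he.1).2]
  · intro a ha b hb hab
    simp only [coe_filter, Set.mem_setOf_eq] at ha hb
    simp only at hab
    rw [← Finset.sdiff_union_of_subset ha.2, hab, Finset.sdiff_union_of_subset hb.2]

lemma card_deg {V : Finset ℕ} {F : Finset (Finset ℕ)} (hF : ∀ e ∈ F, e ⊆ V ∧ e.card = 3) {v : ℕ} (hv : v ∈ V) :
    (F.filter (fun e => v ∈ e)).card ≤ (V.card - 1).choose 2 := by
  have := card_supset hF {v}
  simp only [Finset.singleton_subset_iff, Finset.card_singleton] at this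
  rwa [Finset.sdiff_singleton_eq_erase, Finset.card_erase_of_mem hv] at this

lemma card_codeg {V : Finset ℕ} {F : Finset (Finset ℕ)} (hF : ∀ e ∈ F, e ⊆ V ∧ e.card = 3) {v w : ℕ} (hvw : v ≠ w) :
    (F.filter (fun e => v ∈ e ∧ w ∈ e)).card ≤ V.card := by
  have := card_supset hF {v, w}
  rw [Finset.card_pair hvw] at this
  simp only [Finset.insert_subset_iff, Finset.singleton_subset_iff] at this
  norm_num at this
  exact this.trans (Finset.card_le_card Finset.sdiff_subset)

lemma card_hit_le {F : Finset (Finset ℕ)} (W : Finset ℕ) (D : ℕ) 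
    (h : ∀ w ∈ W, (F.filter (fun e => w ∈ e)).card ≤ D) :
    (F.filter (fun e => ¬ Disjoint e W)).card ≤ W.card * D := by
  have : F.filter (fun e => ¬ Disjoint e W) ⊆ W.biUnion (fun w => F.filter (fun e => w ∈ e)) := by
    intro e he
    rw [Finset.mem_filter, Finset.not_disjoint_iff] at he
    obtain ⟨h1, w, h2, h3⟩ := he
    simp only [mem_biUnion, mem_filter]
    exact ⟨w, h3, h1, h2⟩
  refine (Finset.card_le_card this).trans (Finset.card_biUnion_le.trans ?_)
  refine (Finset.sum_le_sum h).trans ?_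
  simp

lemma exists_avoid {F : Finset (Finset ℕ)} (W : Finset ℕ) (D : ℕ) 
    (h : ∀ w ∈ W, (F.filter (fun e => w ∈ e)).card ≤ D) (hc : W.card * D < F.card) :
    ∃ e ∈ F, Disjoint e W := by
  by_contra hn
  push Not at hn
  have : F.filter (fun e => ¬ Disjoint e W) = F := Finset.filter_true_of_mem hn
  have h2 := card_hit_le W D h
  rw [this] at h2
  omega

lemma choose_lower (k m : ℕ) : k.choose 3 + m * k.choose 2 ≤ (k + m).choose 3 := by
  induction m with
  | zero => simp
  | succ m ih =>
    have e : (k + (m + 1)).choose 3 = (k + m).choose 2 + (k + m).choose 3 := Nat.choose_succ_succ _ _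
    have : k.choose 2 ≤ (k + m).choose 2 := Nat.choose_le_choose 2 (by omega)
    rw [e]; nlinarith

/-- extending a matching by one colour -/
lemma RM_extend {ι : Type*} [DecidableEq ι] {I : Finset ι} {F : ι → Finset (Finset ℕ)} {i : ι} (hi : i ∈ I)
    (e : ι → Finset ℕ) (h1 : ∀ l ∈ I.erase i, e l ∈ F l)
    (h2 : ∀ k ∈ I.erase i, ∀ l ∈ I.erase i, k ≠ l → Disjoint (e k) (e l))
    (a : Finset ℕ) (ha : a ∈ F i) (hd : Disjoint a ((I.erase i).biUnion e)) : RM I F := by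
  have hd' : ∀ l ∈ I.erase i, Disjoint a (e l) := fun l hl => (Finset.disjoint_biUnion_right _ _ _).mp hd l hl
  refine ⟨fun l => if l = i then a else e l, ?_, ?_⟩
  · intro l hl
    simp only
    split_ifs with h
    · rw [h]; exact ha
    · exact h1 l (Finset.mem_erase.mpr ⟨h, hl⟩)
  · intro k hk l hl hkl
    simp only
    split_ifs with h h' h'
    · exact absurd (h.trans h'.symm) hkl
    · exact hd' l (Finset.mem_erase.mpr ⟨h', hl⟩)
    · exact (hd' k (Finset.mem_erase.mpr ⟨h, hk⟩)).symm
    · exact h2 k (Finset.mem_erase.mpr ⟨h, hk⟩) l (Finset.mem_erase.mpr ⟨h', hl⟩) hkl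

lemma small_m {ι : Type*} [DecidableEq ι] (m : ℕ) : ∀ (I : Finset ι) (V : Finset ℕ) (F : ι → Finset (Finset ℕ)),
    I.card = m → 30 * m ≤ V.card → (∀ i ∈ I, ∀ e ∈ F i, e ⊆ V ∧ e.card = 3) →
    (∀ i ∈ I, V.card.choose 3 < (F i).card + (V.card - m + 1).choose 3) → RM I F := by
  induction m with
  | zero =>
    intro I V F hI _ _ _
    rw [Finset.card_eq_zero] at hI
    subst hI
    exact ⟨fun _ => ∅, by simp, by simp⟩
  | succ m ih =>
    intro I V F hI hV hF hc
    obtain ⟨n, hn⟩ : ∃ n, n = V.card := ⟨_, rfl⟩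
    rw [← hn] at hV hc
    have hW : ∀ (i : ι) (hi : i ∈ I) (e : ι → Finset ℕ) (G : ι → Finset (Finset ℕ)) (_ : ∀ l ∈ I, G l ⊆ F l)
      (h1 : ∀ l ∈ I.erase i, e l ∈ G l), ((I.erase i).biUnion e).card ≤ 3 * m := by
      intro i hi e G hG h1
      refine Finset.card_biUnion_le.trans ?_
      have : ∀ l ∈ I.erase i, (e l).card ≤ 3 := fun l hl => by
        have hl' := Finset.mem_of_mem_erase hl
        rw [(hF l hl' _ (hG l hl' (h1 l hl))).2]
      refine (Finset.sum_le_sum this).trans ?_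
      rw [Finset.sum_const, Finset.card_erase_of_mem hi, hI]; simp [mul_comm]
    by_cases hcase : ∃ i ∈ I, ∃ v ∈ V, 3 * m * n < ((F i).filter (fun e => v ∈ e)).card
    · obtain ⟨i, hi, v, hv, hdeg⟩ := hcase
      have hV' : (V.erase v).card = n - 1 := by rw [Finset.card_erase_of_mem hv, hn]
      obtain ⟨e, h1, h2⟩ := ih (I.erase i) (V.erase v) (fun l => (F l).filter (fun e => v ∉ e))
        (by rw [Finset.card_erase_of_mem hi, hI]; rfl) (by rw [hV']; omega)
        (by
          intro l hl e he
          rw [Finset.mem_filter] at he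
          have := hF l (Finset.mem_of_mem_erase hl) e he.1
          exact ⟨Finset.subset_erase.mpr ⟨this.1, he.2⟩, this.2⟩)
        (by
          intro l hl
          have hl' := Finset.mem_of_mem_erase hl
          have a1 := hc l hl'
          have a2 := card_deg (hF l hl') hv
          have a3 := Finset.card_filter_add_card_filter_not (s := F l) (fun e => v ∈ e)
          rw [hV']
          rw [← hn] at a2
          have a4 : n.choose 3 = (n - 1).choose 2 + (n - 1).choose 3 := by
            obtain ⟨k, rfl⟩ : ∃ k, n = k + 1 := ⟨n - 1, by omega⟩
            exact Nat.choose_succ_succ _ _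
          have a5 : n - (m + 1) + 1 = n - 1 - m + 1 := by omega
          rw [a5] at a1
          omega)
      have h1' : ∀ l ∈ I.erase i, e l ∈ F l := fun l hl => (Finset.mem_filter.mp (h1 l hl)).1
      have hvW : v ∉ (I.erase i).biUnion e := by
        rw [Finset.mem_biUnion]
        rintro ⟨l, hl, hvl⟩
        exact (Finset.mem_filter.mp (h1 l hl)).2 hvl
      obtain ⟨a, ha, had⟩ := exists_avoid (F := (F i).filter (fun e => v ∈ e)) ((I.erase i).biUnion e) n
        (by
          intro w hw
          rw [Finset.filter_filter, hn]
          exact card_codeg (hF i hi) (fun h => hvW (h ▸ hw)))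
        (by
          refine lt_of_le_of_lt ?_ hdeg
          exact Nat.mul_le_mul_right _ (hW i hi e F (fun _ _ => Finset.Subset.refl _) h1'))
      exact RM_extend hi e h1' h2 a (Finset.mem_filter.mp ha).1 had
    · push Not at hcase
      obtain ⟨i, hi⟩ : I.Nonempty := by rw [← Finset.card_pos, hI]; omega
      obtain ⟨e, h1, h2⟩ := ih (I.erase i) V F (by rw [Finset.card_erase_of_mem hi, hI]; rfl) (by omega)
        (fun l hl => hF l (Finset.mem_of_mem_erase hl))
        (by
          intro l hl
          have := hc l (Finset.mem_of_mem_erase hl)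
          have h3 : (n - (m + 1) + 1).choose 3 ≤ (n - m + 1).choose 3 := Nat.choose_le_choose 3 (by omega)
          rw [← hn]; omega)
      have hw := hW i hi e F (fun _ _ => Finset.Subset.refl _) h1
      obtain ⟨a, ha, had⟩ := exists_avoid (F := F i) ((I.erase i).biUnion e) (3 * m * n)
        (by
          intro w hw
          apply hcase i hi w
          rw [Finset.mem_biUnion] at hw
          obtain ⟨l, hl, hwl⟩ := hw
          exact (hF l (Finset.mem_of_mem_erase hl) _ (h1 l hl)).1 hwl)
        (by
          refine lt_of_le_of_lt (Nat.mul_le_mul_right _ hw) ?_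
          have a1 := hc i hi
          obtain ⟨k, rfl⟩ : ∃ k, n = k + m := ⟨n - m, by omega⟩
          have a2 := choose_lower k m
          have a3 : k + m - (m + 1) + 1 = k := by omega
          rw [a3] at a1
          have a4 : 2 * k.choose 2 = k * (k - 1) := by
            rw [Nat.choose_two_right, Nat.mul_div_cancel' (Nat.even_mul_pred_self k).two_dvd]
          obtain ⟨j, rfl⟩ : ∃ j, k = j + 1 := ⟨k - 1, by omega⟩
          simp only [Nat.add_sub_cancel] at a4
          have hj : 29 * m + 29 ≤ j := by omega
          have : 3 * m * (3 * m * (j + 1 + m)) ≤ m * (j + 1).choose 2 := by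
            have : 2 * (9 * m * (j + 1 + m)) ≤ (j + 1) * j := by nlinarith
            have : 9 * m * (j + 1 + m) ≤ (j + 1).choose 2 := by omega
            calc 3 * m * (3 * m * (j + 1 + m)) = m * (9 * m * (j + 1 + m)) := by ring
              _ ≤ _ := Nat.mul_le_mul_left _ this
          omega)
      exact RM_extend hi e h1 h2 a ha had

end

/-! Part P3 -/
section
open Finset

lemma simplex_avg {A : Type*} [Fintype A] {u : A → ℝ} (hu : u ∈ stdSimplex ℝ A) (f : A → ℝ)
    (h : ∑ a, u a * f a ≤ 0) : ∃ a, f a ≤ 0 := by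
  by_contra hn
  push Not at hn
  have h1 : ∃ a, 0 < u a := by
    by_contra hne
    push Not at hne
    have : ∑ a, u a ≤ 0 := Finset.sum_nonpos fun a _ => hne a
    rw [hu.2] at this; linarith
  obtain ⟨a, ha⟩ := h1
  have : 0 < ∑ a, u a * f a :=
    Finset.sum_pos' (fun a _ => mul_nonneg (hu.1 a) (hn a).le) ⟨a, Finset.mem_univ _, mul_pos ha (hn a)⟩
  linarith

lemma sum_sq_le_nine {κ : Type*} [Fintype κ] (a : κ → ℝ) (h0 : ∀ j, 0 ≤ a j) (h : ∑ j, a j ≤ 3) :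
    ∑ j, a j ^ 2 ≤ 9 := by
  have h1 : ∑ j, a j ^ 2 ≤ ∑ j, a j * ∑ k, a k := by
    refine Finset.sum_le_sum fun j _ => ?_
    rw [sq]
    exact mul_le_mul_of_nonneg_left (Finset.single_le_sum (f := a) (fun k _ => h0 k) (Finset.mem_univ j)) (h0 j)
  rw [← Finset.sum_mul] at h1
  have h2 : 0 ≤ ∑ j, a j := Finset.sum_nonneg fun j _ => h0 j
  nlinarith

open Classical in
lemma round_lemma {ι κ : Type*} [Fintype κ] {A : ι → Type*} [∀ i, Fintype (A i)] (vec : ∀ i, A i → κ → ℝ)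
    (hv0 : ∀ i a j, 0 ≤ vec i a j) (hv3 : ∀ i a, ∑ j, vec i a j ≤ 3) (u : ∀ i, A i → ℝ)
    (hu : ∀ i, u i ∈ stdSimplex ℝ (A i)) (I : Finset ι) :
    ∃ ch : ∀ i, A i, ∑ j, (∑ i ∈ I, (vec i (ch i) j - ∑ a, u i a * vec i a j)) ^ 2 ≤ 36 * I.card := by
  induction I using Finset.induction_on with
  | empty =>
    refine ⟨fun i => (simplex_avg (hu i) (fun _ => 0) (by simp)).choose, by simp⟩
  | insert i I hi ih =>
    obtain ⟨ch, hch⟩ := ih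
    obtain ⟨D, hD⟩ : ∃ D : κ → ℝ, D = fun j => ∑ i ∈ I, (vec i (ch i) j - ∑ a, u i a * vec i a j) := ⟨_, rfl⟩
    obtain ⟨c, hc⟩ : ∃ c : κ → ℝ, c = fun j => ∑ a, u i a * vec i a j := ⟨_, rfl⟩
    have hcj : ∀ j, ∑ a, u i a * vec i a j = c j := fun j => by rw [hc]
    have hDj : ∀ j, ∑ i ∈ I, (vec i (ch i) j - ∑ a, u i a * vec i a j) = D j := fun j => by rw [hD]
    simp only [hDj] at hch
    obtain ⟨a, ha⟩ := simplex_avg (hu i) (fun a => ∑ j, D j * (vec i a j - c j)) (by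
      have : ∑ a, u i a * ∑ j, D j * (vec i a j - c j) = ∑ j, D j * (∑ a, u i a * vec i a j - (∑ a, u i a) * c j) := by
        simp only [Finset.mul_sum, mul_sub, Finset.sum_mul, ← Finset.sum_sub_distrib]
        rw [Finset.sum_comm]
        refine Finset.sum_congr rfl fun j _ => ?_
        refine Finset.sum_congr rfl fun a _ => by ring
      rw [this, (hu i).2]
      simp [hcj])
    refine ⟨Function.update ch i a, ?_⟩
    have e : ∀ j, ∑ k ∈ insert i I, (vec k (Function.update ch i a k) j - ∑ a, u k a * vec k a j) =
        D j + (vec i a j - c j) := by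
      intro j
      rw [Finset.sum_insert hi, Function.update_self, hcj, ← hDj, add_comm]
      congr 1
      refine Finset.sum_congr rfl fun k hk => ?_
      rw [Function.update_of_ne (by rintro rfl; exact hi hk)]
    simp only [e]
    have e2 : ∑ j, (D j + (vec i a j - c j)) ^ 2 = ∑ j, D j ^ 2 + 2 * ∑ j, D j * (vec i a j - c j)
        + ∑ j, (vec i a j - c j) ^ 2 := by
      rw [Finset.mul_sum, ← Finset.sum_add_distrib, ← Finset.sum_add_distrib]
      refine Finset.sum_congr rfl fun j _ => by ring
    have hc0 : ∀ j, 0 ≤ c j := fun j => by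
      rw [← hcj]; exact Finset.sum_nonneg fun a _ => mul_nonneg ((hu i).1 a) (hv0 i a j)
    have hc3 : ∑ j, c j ≤ 3 := by
      simp only [← hcj]
      rw [Finset.sum_comm]
      calc ∑ a, ∑ j, u i a * vec i a j ≤ ∑ a, u i a * 3 := by
            refine Finset.sum_le_sum fun a _ => ?_
            rw [← Finset.mul_sum]
            exact mul_le_mul_of_nonneg_left (hv3 i a) ((hu i).1 a)
        _ = 3 := by rw [← Finset.sum_mul, (hu i).2, one_mul]
    have e3 : ∑ j, (vec i a j - c j) ^ 2 ≤ ∑ j, vec i a j ^ 2 + ∑ j, c j ^ 2 := by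
      rw [← Finset.sum_add_distrib]
      refine Finset.sum_le_sum fun j _ => ?_
      have := mul_nonneg (hv0 i a j) (hc0 j)
      nlinarith
    have e4 := sum_sq_le_nine _ (hv0 i a) (hv3 i a)
    have e5 := sum_sq_le_nine _ hc0 hc3
    rw [e2, Finset.card_insert_of_notMem hi]
    push_cast
    linarith

/-- number of vertices of `e` in block `j` -/
noncomputable def ldE (b : ℕ) {L : ℕ} (e : Finset ℕ) (j : Fin L) : ℝ :=
  ((e.filter (fun v => (v - 1) / b = j.1 + 1)).card : ℝ)

lemma ldE_nonneg (b : ℕ) {L : ℕ} (e : Finset ℕ) (j : Fin L) : 0 ≤ ldE b e j := Nat.cast_nonneg _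

lemma ldE_sum (b : ℕ) {L : ℕ} (e : Finset ℕ) (he : e.card = 3) : ∑ j : Fin L, ldE b e j ≤ 3 := by
  unfold ldE
  rw [← Nat.cast_sum]
  have : ∑ j : Fin L, (e.filter (fun v => (v - 1) / b = j.1 + 1)).card ≤ e.card := by
    rw [← Finset.card_biUnion]
    · apply Finset.card_le_card
      intro x hx
      simp only [mem_biUnion, mem_filter] at hx
      obtain ⟨_, _, h, _⟩ := hx
      exact h
    · intro x _ y _ hxy
      rw [Function.onFun, Finset.disjoint_left]
      intro v hv hv'
      simp only [mem_filter] at hv hv'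
      apply hxy; ext; omega
  rw [he] at this
  exact_mod_cast this

open Classical in
/-- balanced choice gives a rainbow matching -/
lemma RM_of_loads {ι : Type*} [Fintype ι] (F : ι → Finset (Finset ℕ)) (hs : ∀ i, ShiftedP (F i)) (b L : ℕ) (hb : 1 ≤ b)
    (e : ι → Finset ℕ) (he : ∀ i, e i ∈ F i) (h3 : ∀ i, (e i).card = 3)
    (hin : ∀ i, ∀ v ∈ e i, 1 ≤ (v - 1) / b ∧ (v - 1) / b ≤ L)
    (hload : ∀ j : Fin L, ∑ i, ldE b (e i) j ≤ b) : RM univ F := by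
  let P : ℕ → Finset (Σ _ : ι, ℕ) := fun j => Finset.univ.sigma (fun i => (e i).filter (fun v => (v - 1) / b = j + 1))
  have hP : ∀ j, j < L → (P j).card ≤ (Finset.Ioc (j * b) ((j + 1) * b)).card := by
    intro j hj
    have := hload ⟨j, hj⟩
    unfold ldE at this
    simp only at this
    rw [Finset.card_sigma, Nat.card_Ioc]
    have e1 : (j + 1) * b - j * b = b := by rw [add_mul, one_mul, Nat.add_sub_cancel_left]
    rw [e1]
    exact_mod_cast this
  have hφ : ∀ j, ∃ φ : (Σ _ : ι, ℕ) → ℕ, j < L → (∀ p ∈ P j, φ p ∈ Finset.Ioc (j * b) ((j + 1) * b)) ∧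
      Set.InjOn φ (P j) := by
    intro j
    by_cases hj : j < L
    · have : Fintype.card (P j) ≤ Fintype.card (Finset.Ioc (j * b) ((j + 1) * b)) := by
        simpa using hP j hj
      obtain ⟨ψ⟩ := Function.Embedding.nonempty_of_card_le this
      refine ⟨fun p => if h : p ∈ P j then (ψ ⟨p, h⟩).1 else 0, fun _ => ⟨?_, ?_⟩⟩
      · intro p hp
        simp only [dif_pos hp]
        exact (ψ ⟨p, hp⟩).2
      · intro p hp q hq hpq
        have hp' : p ∈ P j := hp
        have hq' : q ∈ P j := hq
        simp only [dif_pos hp', dif_pos hq'] at hpq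
        have := ψ.injective (Subtype.ext hpq)
        exact congrArg Subtype.val this
    · exact ⟨fun _ => 0, fun h => absurd h hj⟩
  choose φ hφ using hφ
  let g : ι → ℕ → ℕ := fun i v => φ ((v - 1) / b - 1) ⟨i, v⟩
  have hmem : ∀ i, ∀ v ∈ e i, (⟨i, v⟩ : Σ _ : ι, ℕ) ∈ P ((v - 1) / b - 1) ∧ (v - 1) / b - 1 < L := by
    intro i v hv
    have := hin i v hv
    refine ⟨?_, by omega⟩
    simp only [P, mem_sigma, mem_univ, mem_filter, true_and]
    exact ⟨hv, by omega⟩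
  have hg : ∀ i, ∀ v ∈ e i, ((v - 1) / b - 1) * b < g i v ∧ g i v ≤ ((v - 1) / b - 1 + 1) * b := by
    intro i v hv
    obtain ⟨h1, h2⟩ := hmem i v hv
    have := (hφ _ h2).1 _ h1
    rw [Finset.mem_Ioc] at this
    exact this
  have hinj : ∀ i, ∀ v ∈ e i, ∀ k, ∀ w ∈ e k, g i v = g k w → (⟨i, v⟩ : Σ _ : ι, ℕ) = ⟨k, w⟩ := by
    intro i v hv k w hw hgg
    have a1 := hg i v hv
    have a2 := hg k w hw
    have hj : (v - 1) / b - 1 = (w - 1) / b - 1 := by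
      rw [hgg] at a1
      rcases lt_trichotomy ((v - 1) / b - 1) ((w - 1) / b - 1) with h | h | h
      · have := Nat.mul_le_mul_right b (Nat.succ_le_of_lt h)
        simp only [Nat.succ_eq_add_one] at this
        omega
      · exact h
      · have := Nat.mul_le_mul_right b (Nat.succ_le_of_lt h)
        simp only [Nat.succ_eq_add_one] at this
        omega
    obtain ⟨h1, h2⟩ := hmem i v hv
    obtain ⟨h3, h4⟩ := hmem k w hw
    rw [← hj] at h3
    apply (hφ _ h2).2 h1 h3
    simp only [g] at hgg
    rw [hgg, hj]
  refine ⟨fun i => (e i).image (g i), ?_, ?_⟩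
  · intro i _
    apply shifted_image (hs i) (he i) (h3 i)
    · intro v hv; have := (hg i v hv).1; omega
    · intro v hv
      have h1 := (hg i v hv).2
      have h2 := hin i v hv
      have h4 : (v - 1) / b - 1 + 1 = (v - 1) / b := by omega
      rw [h4] at h1
      have := Nat.div_mul_le_self (v - 1) b
      omega
    · intro v hv w hw h
      have := hinj i v hv i w hw h
      simpa using this
  · intro i _ k _ hik
    rw [Finset.disjoint_left]
    intro x hx hx'
    rw [Finset.mem_image] at hx hx'
    obtain ⟨v, hv, rfl⟩ := hx
    obtain ⟨w, hw, hw2⟩ := hx'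
    have := hinj i v hv k w hw hw2.symm
    simp only [Sigma.mk.injEq] at this
    exact hik this.1

open Classical in
/-- fractional/rounding dichotomy -/
lemma rainbow_lp {ι : Type*} [Fintype ι] (F F' : ι → Finset (Finset ℕ)) (hs : ∀ i, ShiftedP (F i)) (b L : ℕ) (hb : 1 ≤ b)
    (hsub : ∀ i, F' i ⊆ F i) (hne : ∀ i, (F' i).Nonempty)
    (h3 : ∀ i, ∀ e ∈ F' i, e.card = 3)
    (hin : ∀ i, ∀ e ∈ F' i, ∀ v ∈ e, 1 ≤ (v - 1) / b ∧ (v - 1) / b ≤ L) (R : ℝ)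
    (hR : R ≤ b) (hRm : 36 * (Fintype.card ι : ℝ) ≤ (b - R) ^ 2) (hno : ¬ RM univ F) :
    ∃ (ω : Fin L → ℝ) (y : ι → ℝ), (∀ j, 0 ≤ ω j) ∧ (∀ i, ∀ e ∈ F' i, y i ≤ ∑ j, ω j * ldE b e j) ∧
      R * ∑ j, ω j < ∑ i, y i := by
  let Φ : ((i : ι) → (F' i → ℝ)) →ₗ[ℝ] (Fin L → ℝ) :=
    { toFun := fun u j => ∑ i, ∑ e : F' i, u i e * ldE b e.1 j
      map_add' := by
        intro x y; ext j; simp [add_mul, Finset.sum_add_distrib]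
      map_smul' := by
        intro c x; ext j
        simp only [Pi.smul_apply, smul_eq_mul, RingHom.id_apply, mul_assoc, Finset.mul_sum] }
  let K : Set (Fin L → ℝ) := Φ '' (Set.pi Set.univ (fun i => stdSimplex ℝ (F' i)))
  have hK : IsCompact K := (isCompact_univ_pi fun i => isCompact_stdSimplex ℝ (F' i)).image
    (LinearMap.continuous_of_finiteDimensional Φ)
  have hKc : Convex ℝ K := (convex_pi fun i _ => convex_stdSimplex ℝ (F' i)).linear_image Φ
  rcases sep_lemma K hK hKc R with ⟨k, ⟨u, hu, rfl⟩, hk⟩ | ⟨ω, hω0, hω⟩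
  · exfalso
    apply hno
    obtain ⟨ch, hch⟩ := round_lemma (fun i (e : F' i) (j : Fin L) => ldE b e.1 j)
      (fun i e j => ldE_nonneg _ _ _) (fun i e => ldE_sum _ _ (h3 i e.1 e.2)) u (fun i => hu i (Set.mem_univ i)) univ
    apply RM_of_loads F hs b L hb (fun i => (ch i).1) (fun i => hsub i (ch i).2) (fun i => h3 i _ (ch i).2)
      (fun i => hin i _ (ch i).2)
    intro j
    have h1 := hk j
    have h2 := (Finset.single_le_sum (f := fun j : Fin L => (∑ i, (ldE b (ch i).1 j - ∑ a : F' i, u i a * ldE b a.1 j)) ^ 2)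
      (fun j _ => sq_nonneg _) (Finset.mem_univ j)).trans hch
    simp only [Finset.sum_sub_distrib, Finset.card_univ] at h2
    have h4 : ∑ i, ∑ a : F' i, u i a * ldE b a.1 j ≤ R := h1
    have h5 := abs_le_of_sq_le_sq (h2.trans hRm) (by linarith)
    linarith [le_abs_self (∑ x, ldE b (ch x).1 j - ∑ x, ∑ a : F' x, u x a * ldE b a.1 j)]
  · have hmin : ∀ i, ∃ e ∈ F' i, ∀ e' ∈ F' i, ∑ j, ω j * ldE b e j ≤ ∑ j, ω j * ldE b e' j :=
      fun i => Finset.exists_min_image (F' i) _ (hne i)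
    choose e he hemin using hmin
    refine ⟨ω, fun i => ∑ j, ω j * ldE b (e i) j, hω0, hemin, ?_⟩
    have := hω (Φ (fun i => Pi.single ⟨e i, he i⟩ 1)) ⟨_, fun i _ => single_mem_stdSimplex ℝ _, rfl⟩
    refine lt_of_lt_of_eq this ?_
    have e1 : ∀ j, Φ (fun i => Pi.single ⟨e i, he i⟩ 1) j = ∑ i, ldE b (e i) j := by
      intro j
      simp only [Φ, LinearMap.coe_mk, AddHom.coe_mk]
      refine Finset.sum_congr rfl fun i _ => ?_
      rw [Finset.sum_eq_single (⟨e i, he i⟩ : F' i)]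
      · simp
      · intro b _ hb; simp [hb]
      · simp
    simp only [e1, Finset.mul_sum]
    rw [Finset.sum_comm]

end

/-! Part P7a -/
section
open Finset

noncomputable def gg (x : ℝ) : ℝ := max (27 * x ^ 3) (1 - (1 - x) ^ 3)

lemma gg_lower {α x : ℝ} (hα : 1 / 30 ≤ α) (hα3 : α ≤ 1 / 3) (hx : 0 ≤ x) (hxa : x ≤ α) :
    gg x + (3 / 100) * (α - x) ≤ gg α := by
  unfold gg
  rw [max_add]
  apply max_le_max
  · have : 27 * α ^ 3 - 27 * x ^ 3 = 27 * (α - x) * (α ^ 2 + α * x + x ^ 2) := by ring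
    have h2 : (1 : ℝ) / 900 ≤ α ^ 2 + α * x + x ^ 2 := by nlinarith [mul_nonneg hx (by linarith : 0 ≤ α)]
    nlinarith
  · have : (1 - x) ^ 3 - (1 - α) ^ 3 = (α - x) * ((1 - x) ^ 2 + (1 - x) * (1 - α) + (1 - α) ^ 2) := by ring
    have h2 : (3 : ℝ) / 100 ≤ (1 - x) ^ 2 + (1 - x) * (1 - α) + (1 - α) ^ 2 := by nlinarith
    nlinarith

lemma gg_upper {α x s : ℝ} (hα : 0 ≤ α) (hα3 : α ≤ 1 / 3) (hx : 0 ≤ x) (hx3 : x ≤ 1 / 3) (hs : 0 ≤ s) (hxs : x ≤ α + s) :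
    gg x ≤ gg α + 9 * s := by
  unfold gg
  rw [max_add]
  apply max_le_max
  · have : 27 * x ^ 3 - 27 * α ^ 3 = 27 * (x - α) * (α ^ 2 + α * x + x ^ 2) := by ring
    have h2 : α ^ 2 + α * x + x ^ 2 ≤ 1 / 3 := by nlinarith
    have h0 : 0 ≤ α ^ 2 + α * x + x ^ 2 := by positivity
    by_cases h : x ≤ α
    · nlinarith
    · push Not at h; nlinarith
  · have : (1 - α) ^ 3 - (1 - x) ^ 3 = (x - α) * ((1 - x) ^ 2 + (1 - x) * (1 - α) + (1 - α) ^ 2) := by ring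
    have h2 : (1 - x) ^ 2 + (1 - x) * (1 - α) + (1 - α) ^ 2 ≤ 3 := by nlinarith
    have h0 : 0 ≤ (1 - x) ^ 2 + (1 - x) * (1 - α) + (1 - α) ^ 2 := by nlinarith
    by_cases h : x ≤ α
    · nlinarith
    · push Not at h; nlinarith

/-- block index -/
def blk (b L : ℕ) [NeZero L] (v : ℕ) : Fin L := Fin.ofNat L ((v - 1) / b - 1)

lemma blk_val (b L : ℕ) [NeZero L] {v : ℕ} (h : 1 ≤ (v - 1) / b ∧ (v - 1) / b ≤ L) :
    (blk b L v).1 + 1 = (v - 1) / b := by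
  unfold blk
  rw [Fin.val_ofNat, Nat.mod_eq_of_lt (by omega)]; omega

lemma ld_sum (b L : ℕ) [NeZero L] (e : Finset ℕ) (he : ∀ v ∈ e, 1 ≤ (v - 1) / b ∧ (v - 1) / b ≤ L) (ω : Fin L → ℝ) :
    ∑ j, ω j * ldE b e j = ∑ v ∈ e, ω (blk b L v) := by
  unfold ldE
  simp only [← Finset.sum_boole, Finset.mul_sum]
  rw [Finset.sum_comm]
  refine Finset.sum_congr rfl fun v hv => ?_
  rw [Finset.sum_eq_single (blk b L v)]
  · rw [if_pos (blk_val b L (he v hv)).symm, mul_one]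
  · intro j _ hj
    rw [if_neg, mul_zero]
    intro h
    apply hj
    have := blk_val b L (he v hv)
    ext; omega
  · simp

lemma count_lemma (b L : ℕ) [NeZero L] (hb : 1 ≤ b) (F : Finset (Finset ℕ)) (h3 : ∀ e ∈ F, e.card = 3)
    (hin : ∀ e ∈ F, ∀ v ∈ e, 1 ≤ (v - 1) / b ∧ (v - 1) / b ≤ L) (Q : Finset (Fin 3 → Fin L))
    (hQ : ∀ e ∈ F, ∀ t : Fin 3 → ℕ, Function.Injective t → (∀ v, v ∈ e ↔ ∃ i, t i = v) →
      (fun i => blk b L (t i)) ∈ Q) : 6 * F.card ≤ b ^ 3 * Q.card := by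
  classical
  let O : Finset (Fin 3 → ℕ) := Q.biUnion (fun T => Fintype.piFinset (fun i =>
    Finset.Ioc (((T i).1 + 1) * b) (((T i).1 + 2) * b)))
  have hO : O.card ≤ b ^ 3 * Q.card := by
    refine Finset.card_biUnion_le.trans ?_
    have : ∀ T ∈ Q, (Fintype.piFinset (fun i => Finset.Ioc (((T i).1 + 1) * b) (((T i).1 + 2) * b))).card ≤ b ^ 3 := by
      intro T _
      rw [Fintype.card_piFinset, Fin.prod_univ_three]
      simp only [Nat.card_Ioc]
      have e : ∀ a : ℕ, (a + 2) * b - (a + 1) * b = b := by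
        intro a
        have : (a + 2) * b = (a + 1) * b + b := by ring
        omega
      simp only [e]
      apply le_of_eq; ring
    refine (Finset.sum_le_sum this).trans ?_
    simp [mul_comm]
  let en : (F × Equiv.Perm (Fin 3)) → (Fin 3 → ℕ) := fun p i => (p.1.1.orderEmbOfFin (h3 p.1.1 p.1.2)) (p.2 i)
  have hrange : ∀ p v, v ∈ p.1.1 ↔ ∃ i, en p i = v := by
    intro p v
    have := Finset.range_orderEmbOfFin p.1.1 (h3 p.1.1 p.1.2)
    rw [← Finset.mem_coe, ← this]
    constructor
    · rintro ⟨i, rfl⟩; exact ⟨p.2.symm i, by simp [en]⟩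
    · rintro ⟨i, rfl⟩; exact ⟨p.2 i, rfl⟩
  have heninj : ∀ p, Function.Injective (en p) := by
    intro p i j h
    simp only [en] at h
    exact p.2.injective ((p.1.1.orderEmbOfFin (h3 p.1.1 p.1.2)).injective h)
  have hcard : (Finset.univ : Finset (F × Equiv.Perm (Fin 3))).card = 6 * F.card := by
    rw [Finset.card_univ, Fintype.card_prod, Fintype.card_perm, Fintype.card_fin, Fintype.card_coe, mul_comm]
    rfl
  rw [← hcard]
  refine le_trans ?_ hO
  apply Finset.card_le_card_of_injOn en
  · intro p _
    have hT := hQ p.1.1 p.1.2 (en p) (heninj p) (hrange p)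
    simp only [O, coe_biUnion, Set.mem_iUnion, mem_coe, Fintype.mem_piFinset, Finset.mem_Ioc]
    refine ⟨_, hT, ?_⟩
    intro i
    have hv : en p i ∈ p.1.1 := (hrange p _).mpr ⟨i, rfl⟩
    have h1 := hin p.1.1 p.1.2 _ hv
    have h2 := blk_val b L h1
    have h4 : (blk b L (en p i)).1 + 2 = (en p i - 1) / b + 1 := by omega
    rw [h2, h4]
    have h5 := Nat.div_mul_le_self (en p i - 1) b
    have h6 := Nat.lt_div_mul_add (a := en p i - 1) (b := b) (by omega)
    have h7 : ((en p i - 1) / b + 1) * b = (en p i - 1) / b * b + b := by ring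
    have h8 : 1 ≤ en p i - 1 := by
      by_contra h0
      have : en p i - 1 = 0 := by omega
      rw [this] at h1; simp at h1
    rw [h7]
    omega
  · intro p _ q _ hpq
    have h1 : p.1.1 = q.1.1 := by
      ext v; rw [hrange p v, hrange q v, hpq]
    obtain ⟨⟨e, he⟩, σ⟩ := p
    obtain ⟨⟨e', he'⟩, σ'⟩ := q
    simp only at h1
    subst h1
    congr 1
    ext i
    have := congrFun hpq i
    simp only [en] at this
    have := (e.orderEmbOfFin (h3 e he)).injective this
    rw [this]

lemma sg_norm (L : ℕ) [NeZero L] (ω : Fin L → ℝ) (hω : ∀ j, 0 ≤ ω j) (y : ℝ) (hy : 0 < y)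
    (G : Finset (Fin 3 → Fin L)) (hG : ∀ T ∈ G, y ≤ ∑ i, ω (T i)) (γ : ℝ) (hγ : 0 < γ)
    (hc : (L : ℝ) ^ 3 * γ ≤ G.card) :
    ∃ (x σ d : ℝ) (AS AD : Finset (Fin L)), 0 ≤ x ∧ x ≤ 1 / 3 ∧ x * L * y ≤ ∑ j, ω j ∧ 0 ≤ σ ∧ 0 ≤ d ∧ σ + d ≤ x ∧
      γ ≤ gg x - (1 / 10) * (x ^ 3 - σ ^ 3 - d ^ 3) ∧ (AS.card : ℝ) ≤ x * L ∧ (AD.card : ℝ) ≤ 3 * (x * L) ∧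
      ((G.filter (fun T => ∀ i, T i ∉ AS)).card : ℝ) ≤ 9 * (x - σ) * L ^ 3 ∧
      ((G.filter (fun T => ¬ ∀ i, T i ∈ AD)).card : ℝ) ≤ 9 * (x - d) * L ^ 3 := by
  have hL : (0 : ℝ) < L := by exact_mod_cast Nat.pos_of_ne_zero (NeZero.ne L)
  have hne : G.Nonempty := by
    rw [← Finset.card_pos]
    have : (0 : ℝ) < G.card := lt_of_lt_of_le (by positivity) hc
    exact_mod_cast this
  obtain ⟨τ, σ, d, AS, AD, h1, h2, h3, h4, h5, h6, h7, h8, h9, h10, h11⟩ := SG_lemma G hne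
  rw [Fintype.card_fin] at h2 h7 h10 h11
  obtain ⟨x, rfl⟩ : ∃ x, τ = x * L := ⟨τ / L, by field_simp⟩
  obtain ⟨s, rfl⟩ : ∃ x, σ = x * L := ⟨σ / L, by field_simp⟩
  obtain ⟨t, rfl⟩ : ∃ x, d = x * L := ⟨d / L, by field_simp⟩
  refine ⟨x, s, t, AS, AD, nonneg_of_mul_nonneg_left h1 hL, ?_, ?_, nonneg_of_mul_nonneg_left h4 hL,
    nonneg_of_mul_nonneg_left h5 hL, ?_, ?_, h8, h9, ?_, ?_⟩
  · have : (3 * x) * L ≤ 1 * L := by linarith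
    have := le_of_mul_le_mul_right this hL
    linarith
  · have := h3 (fun j => ω j / y) ⟨fun j => div_nonneg (hω j) hy.le, fun T hT => by
      rw [← Finset.sum_div, le_div_iff₀ hy, one_mul]; exact hG T hT⟩
    rw [← Finset.sum_div, le_div_iff₀ hy] at this
    exact this
  · have : (s + t) * L ≤ x * L := by linarith
    exact le_of_mul_le_mul_right this hL
  · have := hc.trans h7
    have e : max ((3 * (x * L)) ^ 3) ((L:ℝ) ^ 3 - (L - x * L) ^ 3) = L ^ 3 * gg x := by
      unfold gg
      rw [mul_max_of_nonneg _ _ (by positivity)]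
      congr 1 <;> ring
    rw [e] at this
    have h12 : (L:ℝ) ^ 3 * γ ≤ L ^ 3 * (gg x - (1 / 10) * (x ^ 3 - s ^ 3 - t ^ 3)) := by
      refine this.trans (le_of_eq ?_); ring
    exact le_of_mul_le_mul_left h12 (by positivity)
  · refine (le_of_eq (by congr)).trans (h10.trans (le_of_eq ?_)); ring
  · refine (le_of_eq (by congr)).trans (h11.trans (le_of_eq ?_)); ring

end

/-! Part P7b -/
section
open Finset

lemma six_choose (k : ℕ) : (6 : ℝ) * (k.choose 3 : ℝ) = k * (k - 1) * (k - 2) := by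
  induction k with
  | zero => simp
  | succ k ih =>
    rw [Nat.choose_succ_succ' k 2]
    push_cast
    rw [Nat.cast_choose_two]
    linear_combination ih

lemma size_lower {n m N : ℕ} (hm : 1 ≤ m) (hmn : 3 * m ≤ n) (h1 : n.choose 3 < N + (n - m + 1).choose 3)
    (h2 : (3 * m - 1).choose 3 < N) : (n : ℝ) ^ 3 * gg (m / n) - 6 * n ^ 2 ≤ 6 * N := by
  have hn : (0 : ℝ) < n := by exact_mod_cast (by omega : 0 < n)
  have hm' : (1 : ℝ) ≤ m := by exact_mod_cast hm
  have hmn' : 3 * (m : ℝ) ≤ n := by exact_mod_cast hmn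
  have e : (n : ℝ) ^ 3 * gg (m / n) = max (27 * (m : ℝ) ^ 3) ((n : ℝ) ^ 3 - (n - m) ^ 3) := by
    unfold gg
    rw [mul_max_of_nonneg _ _ (by positivity)]
    congr 1 <;> field_simp
  rw [e, sub_le_iff_le_add]
  apply max_le
  · have h : ((3 * m - 1).choose 3 : ℝ) ≤ N := by exact_mod_cast h2.le
    have := six_choose (3 * m - 1)
    rw [Nat.cast_sub (by omega)] at this
    push_cast at this
    nlinarith
  · have h : (n.choose 3 : ℝ) ≤ N + (n - m + 1).choose 3 := by exact_mod_cast h1.le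
    have a := six_choose n
    have c := six_choose (n - m + 1)
    rw [Nat.cast_add, Nat.cast_sub (by omega)] at c
    push_cast at c
    nlinarith

def inrg (b L : ℕ) (e : Finset ℕ) : Prop := ∀ v ∈ e, 1 ≤ (v - 1) / b ∧ (v - 1) / b ≤ L
instance (b L : ℕ) : DecidablePred (inrg b L) := fun e => by unfold inrg; infer_instance

lemma removed_le {n L : ℕ} (hL : 1 ≤ L) (hn : L ^ 2 + L ≤ n) {F : Finset (Finset ℕ)} (hF : KG n F) :
    ((F.filter (fun e => ¬ inrg (n / (L + 1)) L e)).card : ℝ) ≤ n ^ 3 / L := by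
  set b := n / (L + 1) with hb
  have hb1 : 1 ≤ b := by
    rw [hb, Nat.one_le_div_iff (by omega)]; nlinarith
  have hbn : b * (L + 1) ≤ n := Nat.div_mul_le_self n (L + 1)
  have hbn2 : n < b * (L + 1) + (L + 1) := Nat.lt_div_mul_add (by omega)
  let W : Finset ℕ := Finset.Icc 1 b ∪ Finset.Ioc (b * (L + 1)) n
  have hWc : W.card ≤ b + L := by
    refine (Finset.card_union_le _ _).trans ?_
    simp only [Nat.card_Icc, Nat.card_Ioc]; omega
  have hsub : F.filter (fun e => ¬ inrg b L e) ⊆ F.filter (fun e => ¬ Disjoint e W) := by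
    intro e he
    simp only [Finset.mem_filter, inrg, not_forall] at he ⊢
    obtain ⟨he, v, hv, hv2⟩ := he
    refine ⟨he, Finset.not_disjoint_iff.mpr ⟨v, hv, ?_⟩⟩
    have hvn := Finset.mem_Icc.mp ((hF e he).1 hv)
    simp only [W, Finset.mem_union, Finset.mem_Icc, Finset.mem_Ioc]
    by_contra hc
    apply hv2
    constructor
    · rw [Nat.one_le_div_iff (by omega)]; omega
    · have : (v - 1) / b < L + 1 := by
        rw [Nat.div_lt_iff_lt_mul (by omega), mul_comm]; omega
      omega
  have h1 : (F.filter (fun e => ¬ inrg b L e)).card ≤ W.card * (n - 1).choose 2 := by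
    refine (Finset.card_le_card hsub).trans ?_
    apply card_hit_le
    intro v hv
    have hvn : v ∈ Finset.Icc 1 n := by
      simp only [W, Finset.mem_union, Finset.mem_Icc, Finset.mem_Ioc] at hv
      rw [Finset.mem_Icc]
      have : b ≤ n := Nat.div_le_self _ _
      omega
    have := card_deg hF hvn
    simpa using this
  have h2 : ((n - 1).choose 2 : ℝ) ≤ n ^ 2 / 2 := by
    rw [Nat.cast_choose_two, Nat.cast_sub (by nlinarith)]
    have : (1:ℝ) ≤ n := by exact_mod_cast (by nlinarith : 1 ≤ n)
    push_cast; nlinarith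
  have hL' : (0 : ℝ) < L := by exact_mod_cast hL
  have h3 : (W.card : ℝ) ≤ 2 * (n / L) := by
    have e1 : (W.card : ℝ) ≤ b + L := by exact_mod_cast hWc
    have e2 : (b : ℝ) * (L + 1) ≤ n := by exact_mod_cast hbn
    have e3 : (L : ℝ) ^ 2 + L ≤ n := by exact_mod_cast hn
    have e4 : (b : ℝ) ≤ n / L := by
      rw [le_div_iff₀ hL']; have : (0:ℝ) ≤ b := by positivity
      nlinarith
    have e5 : (L : ℝ) ≤ n / L := by
      rw [le_div_iff₀ hL']; nlinarith
    linarith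
  calc ((F.filter (fun e => ¬ inrg b L e)).card : ℝ) ≤ W.card * (n - 1).choose 2 := by exact_mod_cast h1
    _ ≤ (2 * (n / L)) * (n ^ 2 / 2) := mul_le_mul h3 h2 (by positivity) (by positivity)
    _ = n ^ 3 / L := by ring

lemma sum_enum (b L : ℕ) [NeZero L] (ω : Fin L → ℝ) (e : Finset ℕ) (he : inrg b L e) (t : Fin 3 → ℕ)
    (ht : Function.Injective t) (hte : ∀ v, v ∈ e ↔ ∃ i, t i = v) :
    ∑ j, ω j * ldE b e j = ∑ i, ω (blk b L (t i)) := by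
  rw [ld_sum b L e he]
  have : e = Finset.univ.image t := by
    ext v; simp [hte]
  rw [this, Finset.sum_image (fun a _ c _ h => ht h)]

lemma G_card {n b L : ℕ} [NeZero L] (hb : 1 ≤ b) (hbn : b * L ≤ n) (F : Finset (Finset ℕ)) (h3 : ∀ e ∈ F, e.card = 3)
    (hin : ∀ e ∈ F, inrg b L e) (ω : Fin L → ℝ) (y : ℝ) (hy : ∀ e ∈ F, y ≤ ∑ j, ω j * ldE b e j)
    (γ : ℝ) (hγ : 0 < γ) (hc : (n : ℝ) ^ 3 * γ ≤ 6 * F.card) :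
    (L : ℝ) ^ 3 * γ ≤ ((Finset.univ : Finset (Fin 3 → Fin L)).filter (fun T => y ≤ ∑ i, ω (T i))).card := by
  have h := count_lemma b L hb F h3 hin (Finset.univ.filter (fun T => y ≤ ∑ i, ω (T i))) (by
    intro e he t ht hte
    simp only [Finset.mem_filter, Finset.mem_univ, true_and]
    rw [← sum_enum b L ω e (hin e he) t ht hte]
    exact hy e he)
  have h' : (6 : ℝ) * F.card ≤ (b:ℝ) ^ 3 * ((Finset.univ : Finset (Fin 3 → Fin L)).filter (fun T => y ≤ ∑ i, ω (T i))).card := by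
    exact_mod_cast h
  have hb' : (0:ℝ) < b := by exact_mod_cast hb
  have e1 : (b : ℝ) * L ≤ n := by exact_mod_cast hbn
  have e2 : ((b : ℝ) * L) ^ 3 * γ ≤ (n:ℝ) ^ 3 * γ := by gcongr
  have e3 : (b : ℝ) ^ 3 * (L ^ 3 * γ) ≤ (b:ℝ) ^ 3 * ((Finset.univ : Finset (Fin 3 → Fin L)).filter (fun T => y ≤ ∑ i, ω (T i))).card := by
    calc _ = ((b : ℝ) * L) ^ 3 * γ := by ring
      _ ≤ _ := by linarith
  exact le_of_mul_le_mul_left e3 (by positivity)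

def VAset (n b L : ℕ) [NeZero L] (A : Finset (Fin L)) : Finset ℕ :=
  (Finset.Icc 1 n).filter (fun v => (1 ≤ (v - 1) / b ∧ (v - 1) / b ≤ L) ∧ blk b L v ∈ A)

lemma VAset_card {n b L : ℕ} [NeZero L] (hb : 1 ≤ b) (A : Finset (Fin L)) : (VAset n b L A).card ≤ b * A.card := by
  classical
  have : VAset n b L A ⊆ A.biUnion (fun j => Finset.Ioc ((j.1 + 1) * b) ((j.1 + 2) * b)) := by
    intro v hv
    simp only [VAset, Finset.mem_filter] at hv
    obtain ⟨hv1, h1, h2⟩ := hv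
    simp only [Finset.mem_biUnion, Finset.mem_Ioc]
    refine ⟨_, h2, ?_⟩
    have h2 := blk_val b L h1
    have h4 : (blk b L v).1 + 2 = (v - 1) / b + 1 := by omega
    rw [h2, h4]
    have h5 := Nat.div_mul_le_self (v - 1) b
    have h6 := Nat.lt_div_mul_add (a := v - 1) (b := b) (by omega)
    have h7 : ((v - 1) / b + 1) * b = (v - 1) / b * b + b := by ring
    have := (Finset.mem_Icc.mp hv1).1
    rw [h7]
    omega
  refine (Finset.card_le_card this).trans (Finset.card_biUnion_le.trans ?_)
  have e : ∀ a : ℕ, (a + 2) * b - (a + 1) * b = b := by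
    intro a
    have : (a + 2) * b = (a + 1) * b + b := by ring
    omega
  simp only [Nat.card_Ioc, e, Finset.sum_const, smul_eq_mul]
  rw [mul_comm]

lemma bad_count {n b L : ℕ} [NeZero L] (hb : 1 ≤ b) (hbn : b * L ≤ n) (F : Finset (Finset ℕ)) (h3 : ∀ e ∈ F, e.card = 3)
    (ω : Fin L → ℝ) (y : ℝ) (hy : ∀ e ∈ F, inrg b L e → y ≤ ∑ j, ω j * ldE b e j)
    (P : (Fin 3 → Fin L) → Prop) [DecidablePred P] (B : Finset ℕ → Prop) [DecidablePred B]
    (hPB : ∀ e ∈ F, inrg b L e → B e → ∀ t : Fin 3 → ℕ, (∀ v, v ∈ e ↔ ∃ i, t i = v) → P (fun i => blk b L (t i)))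
    (r κ : ℝ) (hκ : 0 ≤ κ) (hr : ((F.filter (fun e => ¬ inrg b L e)).card : ℝ) ≤ r)
    (hP : (((Finset.univ.filter (fun T : Fin 3 → Fin L => y ≤ ∑ i, ω (T i))).filter P).card : ℝ) ≤ κ * L ^ 3) :
    ((F.filter B).card : ℝ) ≤ r + κ / 6 * n ^ 3 := by
  have hsub : F.filter B ⊆ F.filter (fun e => ¬ inrg b L e) ∪ F.filter (fun e => inrg b L e ∧ B e) := by
    intro e he
    simp only [Finset.mem_union, Finset.mem_filter] at he ⊢
    by_cases hi : inrg b L e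
    · exact Or.inr ⟨he.1, hi, he.2⟩
    · exact Or.inl ⟨he.1, hi⟩
  have h1 := (Finset.card_le_card hsub).trans (Finset.card_union_le _ _)
  have h := count_lemma b L hb (F.filter (fun e => inrg b L e ∧ B e)) (fun e he => h3 e (Finset.mem_filter.mp he).1)
    (fun e he => (Finset.mem_filter.mp he).2.1) ((Finset.univ.filter (fun T : Fin 3 → Fin L => y ≤ ∑ i, ω (T i))).filter P) (by
    intro e he t ht hte
    have he' := Finset.mem_filter.mp he
    simp only [Finset.mem_filter, Finset.mem_univ, true_and]
    rw [← sum_enum b L ω e he'.2.1 t ht hte]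
    exact ⟨hy e he'.1 he'.2.1, hPB e he'.1 he'.2.1 he'.2.2 t hte⟩)
  have h1' : ((F.filter B).card : ℝ) ≤ (F.filter (fun e => ¬ inrg b L e)).card + (F.filter (fun e => inrg b L e ∧ B e)).card := by
    exact_mod_cast h1
  have h' : (6 : ℝ) * (F.filter (fun e => inrg b L e ∧ B e)).card ≤ (b:ℝ) ^ 3 * 
     ((Finset.univ.filter (fun T : Fin 3 → Fin L => y ≤ ∑ i, ω (T i))).filter P).card := by
    exact_mod_cast h
  have e1 : (b : ℝ) * L ≤ n := by exact_mod_cast hbn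
  have e2 : ((b : ℝ) * L) ^ 3 ≤ (n:ℝ) ^ 3 := by gcongr
  have e3 : (b:ℝ) ^ 3 * ((Finset.univ.filter (fun T : Fin 3 → Fin L => y ≤ ∑ i, ω (T i))).filter P).card ≤ κ * n ^ 3 := by
    calc _ ≤ (b:ℝ) ^ 3 * (κ * L ^ 3) := by gcongr
      _ = κ * ((b:ℝ) * L) ^ 3 := by ring
      _ ≤ _ := by gcongr
  linarith

lemma num_x {α x σ d l : ℝ} (hα : 1 / 30 ≤ α) (hα3 : α ≤ 1 / 3) (hx : 0 ≤ x) (hσ : 0 ≤ σ) (hd : 0 ≤ d) (hs : σ + d ≤ x)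
    (hl : 0 ≤ l) (h : gg α - 12 * l ≤ gg x - (1 / 10) * (x ^ 3 - σ ^ 3 - d ^ 3)) : α - 400 * l ≤ x := by
  have h3 : σ ^ 3 + d ^ 3 ≤ x ^ 3 := by
    have : (σ + d) ^ 3 ≤ x ^ 3 := by gcongr
    have h' : 0 ≤ 3 * σ * d * (σ + d) := by positivity
    nlinarith
  by_contra hc
  push Not at hc
  have := gg_lower hα hα3 hx (by linarith)
  nlinarith

lemma num_y {α x y W LL l : ℝ} (hα : 1 / 30 ≤ α) (hx : α - 400 * l ≤ x) (hl : 0 ≤ l) (hl2 : 24000 * l ≤ 1) (hy : 0 < y)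
    (hLL : 0 < LL) (hW : x * LL * y ≤ W) : y ≤ (1 + 24000 * l) * (W / (α * LL)) := by
  have hα0 : 0 < α := by linarith
  rw [mul_div_assoc', le_div_iff₀ (by positivity)]
  have h1 : α * (1 - 12000 * l) ≤ x := by nlinarith
  have h2 : α * (1 - 12000 * l) * LL * y ≤ W := le_trans (by gcongr) hW
  have h3 : (1:ℝ) ≤ (1 - 12000 * l) * (1 + 24000 * l) := by nlinarith
  have h4 : (1 + 24000 * l) * (α * (1 - 12000 * l) * LL * y) ≤ (1 + 24000 * l) * W := by gcongr
  have h5 : 1 * (α * LL * y) ≤ ((1 - 12000 * l) * (1 + 24000 * l)) * (α * LL * y) := by gcongr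
  nlinarith

lemma num_M {x σ d η : ℝ} (hx : 1 / 31 ≤ x) (hσ : 0 ≤ σ) (hd : 0 ≤ d) (hs : σ + d ≤ x) 
    (h : x ^ 3 - σ ^ 3 - d ^ 3 ≤ 100 * η) : x - σ ≤ 96100 * η ∨ x - d ≤ 96100 * η := by
  have key : ∀ M, 0 ≤ M → σ ≤ M → d ≤ M → M ≤ x → x - M ≤ 96100 * η := by
    intro M hM h1 h2 hMx
    have e1 : σ ^ 3 + d ^ 3 ≤ M ^ 2 * (σ + d) := by
      have a : σ ^ 2 ≤ M ^ 2 := by gcongr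
      have c : d ^ 2 ≤ M ^ 2 := by gcongr
      nlinarith
    have e2 : M ^ 2 * (σ + d) ≤ M ^ 2 * x := by gcongr
    have e3 : x ^ 2 * (x - M) ≤ 100 * η := by
      have : 0 ≤ x * M * (x - M) := mul_nonneg (mul_nonneg (by linarith) hM) (by linarith)
      nlinarith
    have e4 : (1 / 31) ^ 2 ≤ x ^ 2 := by gcongr
    nlinarith
  rcases le_total σ d with h1 | h1
  · right; exact key d hd h1 le_rfl (by linarith)
  · left; exact key σ hσ le_rfl h1 (by linarith)

end

/-! Part P7c -/
section
open Finset

set_option maxHeartbeats 4000000 in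
theorem stability (δ : ℝ) (hδ : 0 < δ) (hδ1 : δ < 1) : ∃ n₀ : ℕ, ∀ n : ℕ, n₀ ≤ n → ∀ m : ℕ, 3 * m ≤ n → n ≤ 30 * m →
    ∀ F : Fin m → Finset (Finset ℕ), (∀ i, KG n (F i)) → (∀ i, ShiftedP (F i)) →
    (∀ i, n.choose 3 < (F i).card + (n - m + 1).choose 3) → (∀ i, (3 * m - 1).choose 3 < (F i).card) →
    ¬ RM univ F → ∃ (VA : Finset ℕ) (Bd : Finset (Fin m)), VA ⊆ Finset.Icc 1 n ∧ (Bd.card : ℝ) ≤ δ * m ∧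
      (((VA.card : ℝ) ≤ (1 + δ) * m ∧ ∀ i ∉ Bd, (((F i).filter (fun e => Disjoint e VA)).card : ℝ) ≤ δ * n ^ 3) ∨
       ((VA.card : ℝ) ≤ (1 + δ) * (3 * m) ∧ ∀ i ∉ Bd, (((F i).filter (fun e => ¬ e ⊆ VA)).card : ℝ) ≤ δ * n ^ 3)) := by
  obtain ⟨η, hη⟩ : ∃ η, η = δ / 150000 := ⟨_, rfl⟩
  have hη0 : 0 < η := by rw [hη]; positivity
  have hη1 : η ≤ 1 / 150000 := by rw [hη]; linarith
  obtain ⟨L, hL⟩ := exists_nat_ge (1000000 / (η * δ))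
  have hLηδ : 1000000 ≤ L * (η * δ) := by
    rwa [div_le_iff₀ (by positivity)] at hL
  have hLη : 1000000 ≤ L * η := by
    have : L * (η * δ) ≤ L * (η * 1) := by gcongr
    linarith
  have hLδ : 1000000 ≤ L * δ := by
    have : L * (η * δ) ≤ L * (1 * δ) := by gcongr; linarith
    linarith
  have hL6 : (1000000 : ℝ) ≤ L := by
    have : L * η ≤ L * 1 := by gcongr; linarith
    linarith
  have hL0 : (0 : ℝ) < L := by linarith
  have hLN : 1000000 ≤ L := by exact_mod_cast hL6
  haveI : NeZero L := ⟨by omega⟩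
  obtain ⟨l, hl⟩ : ∃ l : ℝ, l = 1 / L := ⟨_, rfl⟩
  have hl0 : 0 < l := by rw [hl]; positivity
  have hlL : l * L = 1 := by rw [hl]; field_simp
  have hlη : 1000000 * l ≤ η := by
    have : 1000000 * l ≤ (L * η) * l := by gcongr
    (first | linarith | nlinarith)
  have hlηδ : 1000000 * l ≤ η * δ := by
    have : 1000000 * l ≤ (L * (η * δ)) * l := by gcongr
    (first | linarith | nlinarith)
  refine ⟨100 * L ^ 4, ?_⟩
  intro n hn m hmn hnm F hKG hSh hc1 hc2 hno
  have hn' : 100 * (L : ℝ) ^ 4 ≤ n := by exact_mod_cast hn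
  have hLsq : L ^ 2 + L ≤ n := by
    have : L ^ 2 + L ≤ 100 * L ^ 4 := by
      have a : L ^ 2 * 1 ≤ L ^ 2 * L ^ 2 := Nat.mul_le_mul_left _ (Nat.one_le_pow _ _ (by omega))
      have c : L * 1 ≤ L * L := Nat.mul_le_mul_left _ (by omega)
      (first | linarith | nlinarith)
    omega
  have hnpos : 0 < n := by (first | linarith | nlinarith)
  have hn0 : (0 : ℝ) < n := by exact_mod_cast hnpos
  have hm1 : 1 ≤ m := by omega
  have hm0 : (0 : ℝ) < m := by exact_mod_cast hm1
  have hmn' : 3 * (m : ℝ) ≤ n := by exact_mod_cast hmn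
  have hnm' : (n : ℝ) ≤ 30 * m := by exact_mod_cast hnm
  obtain ⟨b, hb⟩ : ∃ b, b = n / (L + 1) := ⟨_, rfl⟩
  have hb1 : 1 ≤ b := by
    rw [hb, Nat.one_le_div_iff (by omega)]; (first | linarith | nlinarith)
  have hbn : b * (L + 1) ≤ n := by rw [hb]; exact Nat.div_mul_le_self n (L + 1)
  have hbn2 : n < b * (L + 1) + (L + 1) := by rw [hb]; exact Nat.lt_div_mul_add (by omega)
  have hbL : b * L ≤ n := by (first | linarith | nlinarith)
  have hb0 : (0:ℝ) < b := by exact_mod_cast hb1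
  have hbn' : (b : ℝ) * (L + 1) ≤ n := by exact_mod_cast hbn
  have hbn2' : (n : ℝ) < b * (L + 1) + (L + 1) := by exact_mod_cast hbn2
  have hbL' : (b:ℝ) * L ≤ n := by exact_mod_cast hbL
  have hLsq' : (L : ℝ) ^ 2 + L ≤ n := by exact_mod_cast hLsq
  -- lower bound for b
  have hblow : (n : ℝ) * (1 - 2 * l) ≤ b * L := by
    -- b*(L+1) ≥ n - L - 1
    have e1 : (L : ℝ) + 1 ≤ n * l := by
      have : ((L:ℝ) ^ 2 + L) * l ≤ n * l := by gcongr
      (first | linarith | nlinarith)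
    have e2 : (b : ℝ) ≤ n * l := by
      have : (b : ℝ) * L * l ≤ n * l := by gcongr
      (first | linarith | nlinarith)
    (first | linarith | nlinarith)
  obtain ⟨α, hα⟩ : ∃ α : ℝ, α = m / n := ⟨_, rfl⟩
  have hαn : α * n = m := by rw [hα]; field_simp
  have hα30 : 1 / 30 ≤ α := by rw [hα, le_div_iff₀ hn0]; linarith
  have hα3 : α ≤ 1 / 3 := by rw [hα, div_le_iff₀ hn0]; linarith
  have hα0 : 0 < α := by linarith
  obtain ⟨F', hF'⟩ : ∃ F' : Fin m → Finset (Finset ℕ), F' = fun i => (F i).filter (inrg b L) := ⟨_, rfl⟩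
  have hmemF' : ∀ i e, e ∈ F' i ↔ e ∈ F i ∧ inrg b L e := by
    intro i e; rw [hF']; simp
  have hrem : ∀ i, (((F i).filter (fun e => ¬ inrg b L e)).card : ℝ) ≤ n ^ 3 * l := by
    intro i
    have := removed_le (by omega : 1 ≤ L) hLsq (hKG i)
    rw [← hb] at this
    rw [hl]; refine this.trans (le_of_eq (by ring))
  obtain ⟨γ, hγ⟩ : ∃ γ, γ = gg α - 12 * l := ⟨_, rfl⟩
  have hγ0 : 0 < γ := by
    have : 1 - (1 - α) ^ 3 ≤ gg α := le_max_right _ _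
    have h2 : (1 - α) ^ 3 ≤ 1 - α := pow_le_of_le_one (by linarith) (by linarith) (by norm_num)
    rw [hγ]; linarith
  have hcard : ∀ i, (n : ℝ) ^ 3 * γ ≤ 6 * (F' i).card := by
    intro i
    have h1 := size_lower hm1 hmn (hc1 i) (hc2 i)
    rw [← hα] at h1
    have h2 : ((F i).card : ℝ) = (F' i).card + ((F i).filter (fun e => ¬ inrg b L e)).card := by
      rw [hF']
      exact_mod_cast (Finset.card_filter_add_card_filter_not (s := F i) (inrg b L)).symm
    have h3 := hrem i
    have h4 : (6:ℝ) * n ^ 2 ≤ 6 * (n ^ 3 * l) := by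
      have : 1 ≤ n * l := by
        have : ((L:ℝ) ^ 2 + L) * l ≤ n * l := by gcongr
        (first | linarith | nlinarith)
      have : (n:ℝ) ^ 2 * 1 ≤ n ^ 2 * (n * l) := by gcongr
      (first | linarith | nlinarith)
    rw [hγ]
    (first | linarith | nlinarith)
  have hne : ∀ i, (F' i).Nonempty := by
    intro i
    rw [← Finset.card_pos]
    have := hcard i
    have h2 : (0:ℝ) < n ^ 3 * γ := by positivity
    have : (0:ℝ) < (F' i).card := by linarith
    exact_mod_cast this
  have h3 : ∀ i, ∀ e ∈ F' i, e.card = 3 := fun i e he => (hKG i e ((hmemF' i e).mp he).1).2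
  have hin : ∀ i, ∀ e ∈ F' i, inrg b L e := fun i e he => ((hmemF' i e).mp he).2
  obtain ⟨ω, y, hω, hy, hsum⟩ := rainbow_lp F F' hSh b L hb1 (fun i e he => ((hmemF' i e).mp he).1) hne h3 hin
    ((1 - l) * b) (by (first | linarith | nlinarith)) (by
      rw [Fintype.card_fin]
      have e1 : (n : ℝ) / 2 ≤ b * L := by (first | linarith | nlinarith)
      have e2 : n * l / 2 ≤ b := by
        have : (n : ℝ) / 2 * l ≤ b * L * l := by gcongr
        (first | linarith | nlinarith)
      have e3 : n * l ^ 2 / 2 ≤ b - (1 - l) * b := by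
        have : n * l / 2 * l ≤ b * l := by gcongr
        (first | linarith | nlinarith)
      have e4 : (n * l ^ 2 / 2) ^ 2 ≤ (b - (1 - l) * b) ^ 2 := by gcongr
      have e5 : 100 ≤ n * l ^ 4 := by
        have : 100 * (L : ℝ) ^ 4 * l ^ 4 ≤ n * l ^ 4 := by gcongr
        have h' : 100 * (L : ℝ) ^ 4 * l ^ 4 = 100 * (l * L) ^ 4 := by ring
        rw [h', hlL] at this; linarith
      have e6 : (100 : ℝ) * n ≤ (n * l ^ 4) * n := by gcongr
      (first | linarith | nlinarith)) hno
  obtain ⟨W, hW⟩ : ∃ W, W = ∑ j, ω j := ⟨_, rfl⟩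
  rw [← hW] at hsum
  have hW0 : 0 < W := by
    have h0 : 0 ≤ W := by rw [hW]; exact Finset.sum_nonneg fun j _ => hω j
    rcases h0.eq_or_lt with h | h
    · exfalso
      rw [← h] at hW hsum
      have hz := (Finset.sum_eq_zero_iff_of_nonneg (fun j _ => hω j)).mp hW.symm
      have : ∑ i, y i ≤ 0 := by
        apply Finset.sum_nonpos
        intro i _
        obtain ⟨e, he⟩ := hne i
        refine (hy i e he).trans (le_of_eq ?_)
        apply Finset.sum_eq_zero
        intro j hj
        rw [hz j hj, zero_mul]
      linarith
    · exact h
  obtain ⟨Y, hY⟩ : ∃ Y, Y = W / (α * L) := ⟨_, rfl⟩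
  have hY0 : 0 < Y := by rw [hY]; positivity
  have hWY : W = α * L * Y := by rw [hY]; field_simp
  have hyup : ∀ i, y i ≤ (1 + 24000 * l) * Y := by
    intro i
    by_cases hyi : 0 < y i
    · have hG := G_card hb1 hbL (F' i) (h3 i) (hin i) ω (y i) (hy i) γ hγ0 (hcard i)
      obtain ⟨x, σ, d, AS, AD, g1, g2, g3, g4, g5, g6, g7, -⟩ := sg_norm L ω hω (y i) hyi _ 
        (fun T hT => (Finset.mem_filter.mp hT).2) γ hγ0 hG
      rw [hγ] at g7
      have hx := num_x hα30 hα3 g1 g4 g5 g6 hl0.le g7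
      rw [hY]
      rw [← hW] at g3
      exact num_y hα30 hx hl0.le (by linarith) hyi hL0 g3
    · push Not at hyi
      exact hyi.trans (by positivity)
  have hRW : (m : ℝ) * (1 - 3 * l) * Y ≤ (1 - l) * b * W := by
    have e1 : (n : ℝ) * (1 - 3 * l) ≤ (1 - l) * (b * L) := by
      have : (1 - l) * ((n : ℝ) * (1 - 2 * l)) ≤ (1 - l) * (b * L) := by
        apply mul_le_mul_of_nonneg_left hblow; linarith
      nlinarith [mul_nonneg hn0.le (sq_nonneg l)]
    rw [hWY, ← hαn]
    have : (n : ℝ) * (1 - 3 * l) * (α * Y) ≤ (1 - l) * (b * L) * (α * Y) := by gcongr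
    (first | linarith | nlinarith)
  let Bd : Finset (Fin m) := Finset.univ.filter (fun i => y i < (1 - η) * Y)
  have hBd : (Bd.card : ℝ) ≤ δ * m := by
    have h1 : ∑ i, y i ≤ ∑ i, ((1 + 24000 * l) * Y - if i ∈ Bd then η * Y else 0) := by
      apply Finset.sum_le_sum
      intro i _
      by_cases hi : i ∈ Bd
      · rw [if_pos hi]
        have := (Finset.mem_filter.mp hi).2
        nlinarith [mul_pos hl0 hY0]
      · rw [if_neg hi]; have := hyup i; linarith
    rw [Finset.sum_sub_distrib, Finset.sum_ite_mem, Finset.univ_inter] at h1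
    simp only [Finset.sum_const, Finset.card_univ, Fintype.card_fin, nsmul_eq_mul] at h1
    have h2 : (Bd.card : ℝ) * η * Y < m * (25000 * l) * Y := by nlinarith [mul_pos (mul_pos hm0 hl0) hY0]
    have h3 := lt_of_mul_lt_mul_right h2 hY0.le
    have h4 : (Bd.card : ℝ) * η ≤ (δ * m) * η := by (first | linarith | nlinarith)
    exact le_of_mul_le_mul_right h4 hη0
  have hgood : ∃ i, i ∉ Bd := by
    by_contra hcon
    push Not at hcon
    have : Bd = Finset.univ := Finset.eq_univ_iff_forall.mpr hcon
    rw [this, Finset.card_univ, Fintype.card_fin] at hBd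
    (first | linarith | nlinarith)
  have hgoody : ∀ i ∉ Bd, (1 - η) * Y ≤ y i := by
    intro i hi
    by_contra hcon
    push Not at hcon
    exact hi (Finset.mem_filter.mpr ⟨Finset.mem_univ _, hcon⟩)
  obtain ⟨i₀, hi₀⟩ := hgood
  have hyG : 0 < (1 - η) * Y := by apply mul_pos _ hY0; linarith
  have hG := G_card hb1 hbL (F' i₀) (h3 i₀) (hin i₀) ω ((1 - η) * Y) 
    (fun e he => (hgoody i₀ hi₀).trans (hy i₀ e he)) γ hγ0 (hcard i₀)
  obtain ⟨x, σ, d, AS, AD, g1, g2, g3, g4, g5, g6, g7, g8, g9, g10, g11⟩ := sg_norm L ω hω ((1 - η) * Y) hyG _ 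
        (fun T hT => (Finset.mem_filter.mp hT).2) γ hγ0 hG
  rw [hγ] at g7
  have hxlow := num_x hα30 hα3 g1 g4 g5 g6 hl0.le g7
  rw [← hW, hWY] at g3
  have hx1 : x * (1 - η) ≤ α := by
    have : (x * (1 - η)) * (L * Y) ≤ α * (L * Y) := by (first | linarith | nlinarith)
    exact le_of_mul_le_mul_right this (by positivity)
  have hx2 : x ≤ α * (1 + 2 * η) := by
    have e1 : (x * (1 - η)) * (1 + 2 * η) ≤ α * (1 + 2 * η) := by gcongr
    have e2 : x * 1 ≤ x * ((1 - η) * (1 + 2 * η)) := by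
      apply mul_le_mul_of_nonneg_left _ g1; (first | linarith | nlinarith)
    linarith
  have hgx := gg_upper hα0.le hα3 g1 g2 hη0.le (by (first | linarith | nlinarith) : x ≤ α + η)
  have hM := num_M (x := x) (σ := σ) (d := d) (η := η) (by linarith) g4 g5 g6 (by linarith)
  have hxn : x * n ≤ m * (1 + 2 * η) := by
    have : x * n ≤ α * (1 + 2 * η) * n := by gcongr
    (first | linarith | nlinarith)
  have hηδ : 2 * η ≤ δ := by linarith
  have hyy : ∀ i ∉ Bd, ∀ e ∈ F i, inrg b L e → (1 - η) * Y ≤ ∑ j, ω j * ldE b e j := by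
    intro i hi e he hie
    exact (hgoody i hi).trans (hy i e ((hmemF' i e).mpr ⟨he, hie⟩))
  have hVsub : ∀ A, VAset n b L A ⊆ Finset.Icc 1 n := fun A => Finset.filter_subset _ _
  have hfin : n ^ 3 * l + (9 * (96100 * η)) / 6 * n ^ 3 ≤ δ * (n:ℝ) ^ 3 := by
    have : (l + 9 * (96100 * η) / 6) * (n:ℝ) ^ 3 ≤ δ * (n:ℝ) ^ 3 := by
      gcongr
      linarith
    linarith
  have hnot : ∀ i A e, e ∈ F i → inrg b L e → ∀ v ∈ e, v ∉ VAset n b L A → blk b L v ∉ A := by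
    intro i A e he hie v hv hvA hbA
    apply hvA
    simp only [VAset, Finset.mem_filter]
    exact ⟨(hKG i e he).1 hv, hie v hv, hbA⟩
  have hVc : ∀ (A : Finset (Fin L)) (c : ℝ), 0 ≤ c → (A.card : ℝ) ≤ c * (x * L) → ((VAset n b L A).card : ℝ) ≤ c * ((1 + δ) * m) := by
    intro A c hc0 hA
    have e1 : ((VAset n b L A).card : ℝ) ≤ b * A.card := by exact_mod_cast VAset_card hb1 A
    have e2 : (b:ℝ) * A.card ≤ b * (c * (x * L)) := by gcongr
    have e3 : c * (x * (b * L)) ≤ c * (x * n) := by gcongr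
    have e4 : c * (x * n) ≤ c * ((1 + δ) * m) := by
      apply mul_le_mul_of_nonneg_left _ hc0
      (first | linarith | nlinarith)
    (first | linarith | nlinarith)
  rcases hM with hM | hM
  · refine ⟨VAset n b L AS, Bd, hVsub _, hBd, Or.inl ⟨?_, ?_⟩⟩
    · have := hVc AS 1 (by norm_num) (by linarith)
      linarith
    · intro i hi
      refine le_trans ?_ hfin
      refine bad_count hb1 hbL (F i) (fun e he => (hKG i e he).2) ω ((1 - η) * Y) (hyy i hi) (fun T => ∀ k, T k ∉ AS) _ ?_ _ _ (by positivity) (hrem i) (g10.trans ?_)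
      · intro e he hie hdis t ht k
        have hv : t k ∈ e := (ht _).mpr ⟨k, rfl⟩
        exact hnot i AS e he hie _ hv (Finset.disjoint_left.mp hdis hv)
      · gcongr
  · refine ⟨VAset n b L AD, Bd, hVsub _, hBd, Or.inr ⟨?_, ?_⟩⟩
    · have := hVc AD 3 (by norm_num) (by linarith)
      linarith
    · intro i hi
      refine le_trans ?_ hfin
      refine bad_count hb1 hbL (F i) (fun e he => (hKG i e he).2) ω ((1 - η) * Y) (hyy i hi) (fun T => ¬ ∀ k, T k ∈ AD) _ ?_ _ _ (by positivity) (hrem i) (g11.trans ?_)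
      · intro e he hie hdis t ht hall
        obtain ⟨v, hv, hvA⟩ := Finset.not_subset.mp hdis
        obtain ⟨k, rfl⟩ := (ht v).mp hv
        exact hnot i AD e he hie _ hv hvA (hall k)
      · gcongr

end

/-! Part P6S -/
section
open Finset

lemma enumI {ι : Type*} [DecidableEq ι] (I : Finset ι) : ∃ c : ι → ℕ, (∀ i ∈ I, c i < I.card) ∧ 
    ∀ i ∈ I, ∀ j ∈ I, c i = c j → i = j := by
  refine ⟨fun i => if h : i ∈ I then (I.equivFin ⟨i, h⟩).1 else 0, ?_, ?_⟩
  · intro i hi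
    simp only [dif_pos hi]
    exact (I.equivFin ⟨i, hi⟩).2
  · intro i hi j hj h
    simp only [dif_pos hi, dif_pos hj] at h
    have := I.equivFin.injective (Fin.ext h)
    exact congrArg Subtype.val this

lemma enumS (S : Finset ℕ) (N : ℕ) (h : N ≤ S.card) : ∃ g : ℕ → ℕ, (∀ k < N, g k ∈ S) ∧ 
    ∀ k < N, ∀ l < N, k < l → g k < g l := by
  refine ⟨fun k => if hk : k < N then S.orderEmbOfCardLe h ⟨k, hk⟩ else 0, ?_, ?_⟩
  · intro k hk
    simp only [dif_pos hk]
    exact S.orderEmbOfCardLe_mem h _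
  · intro k hk l hl hkl
    simp only [dif_pos hk, dif_pos hl]
    exact (S.orderEmbOfCardLe h).strictMono hkl

lemma S_match {n m p q : ℕ} {F : Fin m → Finset (Finset ℕ)} (hsh : ∀ i, ShiftedP (F i)) (I1 : Finset (Fin m))
    (hI1 : I1.card + p = m) (hpq : p < q) (hgood : ∀ i ∉ I1, ({p, q, q + 1} : Finset ℕ) ∈ F i)
    (F1 : Fin m → Finset (Finset ℕ)) (hF1 : ∀ i, F1 i ⊆ F i) 
    (hF1c : ∀ i, ∀ e ∈ F1 i, e ⊆ Finset.Icc (p + 1) n ∧ e.card = 3)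
    (hRM : RM I1 F1) (hroom : 3 * I1.card + 2 * p ≤ q - p) : RM univ F := by
  classical
  obtain ⟨e1, he1, hd1⟩ := hRM
  obtain ⟨c, hc, hcinj⟩ := enumI (I1ᶜ)
  have hcc : (I1ᶜ).card = p := by
    rw [Finset.card_compl, Fintype.card_fin]; omega
  rw [hcc] at hc
  let U := I1.biUnion e1
  have hU : U.card ≤ 3 * I1.card := by
    refine Finset.card_biUnion_le.trans ?_
    refine (Finset.sum_le_sum (fun i hi => le_of_eq (hF1c i _ (he1 i hi)).2)).trans ?_
    simp [mul_comm]
  let S := Finset.Icc (p + 1) q \ U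
  have hS : 2 * p ≤ S.card := by
    have := Finset.le_card_sdiff U (Finset.Icc (p + 1) q)
    rw [Nat.card_Icc] at this
    have e : S.card = (Finset.Icc (p + 1) q \ U).card := rfl
    omega
  obtain ⟨g, hgS, hgm⟩ := enumS S (2 * p) hS
  have hgS' : ∀ k < 2 * p, p + 1 ≤ g k ∧ g k ≤ q ∧ g k ∉ U := by
    intro k hk
    have := hgS k hk
    simp only [S, Finset.mem_sdiff, Finset.mem_Icc] at this
    tauto
  have hginj : ∀ k < 2 * p, ∀ l < 2 * p, g k = g l → k = l := by
    intro k hk l hl h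
    rcases lt_trichotomy k l with h1 | h1 | h1
    · have := hgm k hk l hl h1; omega
    · exact h1
    · have := hgm l hl k hk h1; omega
  have hlow : ∀ i ∈ I1, ∀ v ∈ e1 i, p + 1 ≤ v := by
    intro i hi v hv
    exact (Finset.mem_Icc.mp ((hF1c i _ (he1 i hi)).1 hv)).1
  have hinU : ∀ i ∈ I1, ∀ v ∈ e1 i, v ∈ U := fun i hi v hv => Finset.mem_biUnion.mpr ⟨i, hi, hv⟩
  have hmix : ∀ i ∈ I1, ∀ j ∉ I1, Disjoint (e1 i) {c j + 1, g (2 * c j), g (2 * c j + 1)} := by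
    intro i hi j hj
    rw [Finset.disjoint_left]
    intro v hv hv2
    have hcj := hc j (by simpa using hj)
    have a1 := hgS' (2 * c j) (by omega)
    have a2 := hgS' (2 * c j + 1) (by omega)
    have a3 := hlow i hi v hv
    have a4 := hinU i hi v hv
    simp only [Finset.mem_insert, Finset.mem_singleton] at hv2
    rcases hv2 with rfl | rfl | rfl
    · omega
    · exact a1.2.2 a4
    · exact a2.2.2 a4
  refine ⟨fun i => if i ∈ I1 then e1 i else {c i + 1, g (2 * c i), g (2 * c i + 1)}, ?_, ?_⟩
  · intro i _
    by_cases hi : i ∈ I1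
    · simp only [if_pos hi]; exact hF1 i (he1 i hi)
    · simp only [if_neg hi]
      have hci := hc i (by simpa using hi)
      have a1 := hgS' (2 * c i) (by omega)
      have a2 := hgS' (2 * c i + 1) (by omega)
      have a3 := hgm (2 * c i) (by omega) (2 * c i + 1) (by omega) (by omega)
      exact shifted_triple (hsh i) hpq (Nat.lt_succ_self q) (by omega) a3 (by omega) (by omega) (by omega) (by omega) (hgood i hi)
  · intro i _ j _ hij
    by_cases hi : i ∈ I1 <;> by_cases hj : j ∈ I1
    · simp only [if_pos hi, if_pos hj]; exact hd1 i hi j hj hij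
    · simp only [if_pos hi, if_neg hj]; exact hmix i hi j hj
    · simp only [if_neg hi, if_pos hj]; exact (hmix j hj i hi).symm
    · simp only [if_neg hi, if_neg hj]
      have hci := hc i (by simpa using hi)
      have hcj := hc j (by simpa using hj)
      have hcij : c i ≠ c j := fun h => hij (hcinj i (by simpa using hi) j (by simpa using hj) h)
      have a1 := hgS' (2 * c i) (by omega)
      have a2 := hgS' (2 * c i + 1) (by omega)
      have b1 := hgS' (2 * c j) (by omega)
      have b2 := hgS' (2 * c j + 1) (by omega)
      have c1 := hginj (2 * c i) (by omega) (2 * c j) (by omega)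
      have c2 := hginj (2 * c i) (by omega) (2 * c j + 1) (by omega)
      have c3 := hginj (2 * c i + 1) (by omega) (2 * c j) (by omega)
      have c4 := hginj (2 * c i + 1) (by omega) (2 * c j + 1) (by omega)
      rw [Finset.disjoint_left]
      intro v hv hv2
      simp only [Finset.mem_insert, Finset.mem_singleton] at hv hv2
      rcases hv with h | h | h <;> rcases hv2 with h' | h' | h' <;> rw [h] at h' <;> omega

lemma S_count0 {n : ℕ} {F : Finset (Finset ℕ)} (hF : KG n F) (VA : Finset ℕ) (hVA : VA ⊆ Finset.Icc 1 n) (M : Finset (Finset ℕ))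
    (hM : ∀ e ∈ M, e ⊆ Finset.Icc 1 n ∧ e.card = 3 ∧ ¬ Disjoint e VA ∧ e ∉ F) :
    F.card + M.card + (n - VA.card).choose 3 ≤ n.choose 3 + (F.filter (fun e => Disjoint e VA)).card := by
  classical
  have h1 := Finset.card_filter_add_card_filter_not (s := F) (fun e => Disjoint e VA)
  have h2 : (F.filter (fun e => ¬ Disjoint e VA) ∪ M ∪ (Finset.Icc 1 n \ VA).powersetCard 3).card ≤ n.choose 3 := by
    have : ((Finset.Icc 1 n).powersetCard 3).card = n.choose 3 := by simp
    rw [← this]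
    apply Finset.card_le_card
    intro e he
    rw [Finset.mem_powersetCard]
    simp only [Finset.mem_union, Finset.mem_filter, Finset.mem_powersetCard] at he
    rcases he with (he | he) | he
    · exact hF e he.1
    · exact ⟨(hM e he).1, (hM e he).2.1⟩
    · exact ⟨he.1.trans Finset.sdiff_subset, he.2⟩
  rw [Finset.card_union_of_disjoint, Finset.card_union_of_disjoint, Finset.card_powersetCard, Finset.card_sdiff_of_subset hVA, Nat.card_Icc] at h2
  · simp only [Nat.add_sub_cancel] at h2; omega
  · rw [Finset.disjoint_left]
    intro e he he2
    exact (hM e he2).2.2.2 (Finset.mem_filter.mp he).1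
  · rw [Finset.disjoint_left]
    intro e he he2
    rw [Finset.mem_powersetCard] at he2
    have hd : Disjoint e VA := Finset.disjoint_of_subset_left he2.1 Finset.sdiff_disjoint
    rcases Finset.mem_union.mp he with he | he
    · exact (Finset.mem_filter.mp he).2 hd
    · exact (hM e he).2.2.1 hd

lemma S_count {n p q : ℕ} {F : Finset (Finset ℕ)} (hF : KG n F) (hsh : ShiftedP F) (VA : Finset ℕ) (hVA : VA ⊆ Finset.Icc 1 n)
    (hp : 1 ≤ p) (hpq : p < q) (hno : ({p, q, q + 1} : Finset ℕ) ∉ F) :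
    F.card + (VA ∩ Finset.Ico p q).card * (n + 1 - q).choose 2 + (n - VA.card).choose 3 ≤ 
      n.choose 3 + (F.filter (fun e => Disjoint e VA)).card := by
  classical
  let M : Finset (Finset ℕ) := ((VA ∩ Finset.Ico p q) ×ˢ (Finset.Icc q n).powersetCard 2).image (fun a => insert a.1 a.2)
  have hMc : M.card = (VA ∩ Finset.Ico p q).card * (n + 1 - q).choose 2 := by
    rw [Finset.card_image_of_injOn, Finset.card_product, Finset.card_powersetCard, Nat.card_Icc]
    rintro ⟨x, s⟩ h1 ⟨x', s'⟩ h2 h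
    simp only [Finset.coe_product, Set.mem_prod, Finset.mem_coe, Finset.mem_inter, Finset.mem_Ico, Finset.mem_powersetCard] at h1 h2
    simp only at h
    obtain ⟨⟨hx1, hx2⟩, hs, hs2⟩ := h1
    obtain ⟨⟨hx1', hx2'⟩, hs', hs2'⟩ := h2
    have e1 : x = x' := by
      have : x ∈ insert x' s' := h ▸ Finset.mem_insert_self x s
      rcases Finset.mem_insert.mp this with h' | h'
      · exact h'
      · have := Finset.mem_Icc.mp (hs' h'); omega
    subst e1
    have n1 : x ∉ s := fun hh => by have := Finset.mem_Icc.mp (hs hh); omega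
    have n2 : x ∉ s' := fun hh => by have := Finset.mem_Icc.mp (hs' hh); omega
    have : s = s' := by rw [← Finset.erase_insert n1, ← Finset.erase_insert n2, h]
    rw [this]
  rw [← hMc]
  apply S_count0 hF VA hVA
  intro e he
  simp only [M, Finset.mem_image, Finset.mem_product, Finset.mem_inter, Finset.mem_Ico, Finset.mem_powersetCard] at he
  obtain ⟨⟨x, s⟩, ⟨⟨hx1, hx2⟩, hs, hs2⟩, rfl⟩ := he
  have n1 : x ∉ s := fun hh => by have := Finset.mem_Icc.mp (hs hh); omega
  refine ⟨?_, ?_, ?_, ?_⟩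
  · apply Finset.insert_subset (hVA hx1)
    exact hs.trans (Finset.Icc_subset_Icc (by omega) le_rfl)
  · rw [Finset.card_insert_of_notMem n1, hs2]
  · exact Finset.not_disjoint_iff.mpr ⟨x, Finset.mem_insert_self _ _, hx1⟩
  · intro hmem
    apply hno
    obtain ⟨y, z, hyz, rfl⟩ := Finset.card_eq_two.mp hs2
    have hy := Finset.mem_Icc.mp (hs (by simp : y ∈ ({y, z} : Finset ℕ)))
    have hz := Finset.mem_Icc.mp (hs (by simp : z ∈ ({y, z} : Finset ℕ)))
    rcases lt_or_gt_of_ne hyz with h | h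
    · exact shifted_triple hsh (by omega) h hpq (Nat.lt_succ_self q) hp hx2.1 hy.1 (by omega) hmem
    · rw [Finset.pair_comm] at hmem
      exact shifted_triple hsh (by omega) h hpq (Nat.lt_succ_self q) hp hx2.1 hz.1 (by omega) hmem

lemma choose_upper (a s : ℕ) : (a + s).choose 3 ≤ a.choose 3 + s * (a + s).choose 2 := by
  induction s with
  | zero => simp
  | succ s ih =>
    have e : (a + (s + 1)).choose 3 = (a + s).choose 2 + (a + s).choose 3 := Nat.choose_succ_succ _ _
    have e2 : (a + s).choose 2 ≤ (a + (s + 1)).choose 2 := Nat.choose_le_choose 2 (by omega)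
    rw [e]
    nlinarith

lemma mul3_le {a x y z : ℝ} (ha : 0 ≤ a) (hx : a ≤ x) (hy : a ≤ y) (hz : a ≤ z) : a * a * a ≤ x * y * z := by
  have h1 : a * a ≤ x * y := mul_le_mul hx hy ha (by linarith)
  exact mul_le_mul h1 hz ha (mul_nonneg (by linarith) (by linarith))

lemma S_small {n m : ℕ} {δ : ℝ} (hδ : 0 < δ) (hδ1 : δ ≤ 1 / 10 ^ 14) (hm : 10 ^ 14 ≤ m) (hmn : 3 * m ≤ n)
    {F : Finset (Finset ℕ)} (hF : KG n F) (hc2 : (3 * m - 1).choose 3 < F.card)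
    (VA : Finset ℕ) (hVA : VA ⊆ Finset.Icc 1 n) (hv : (VA.card : ℝ) ≤ (1 + δ) * m)
    (hA : ((F.filter (fun e => Disjoint e VA)).card : ℝ) ≤ δ * n ^ 3) : 10 * m ≤ 3 * n := by
  by_contra hcon
  push Not at hcon
  have h := S_count0 hF VA hVA ∅ (by simp)
  have hvn : VA.card ≤ n := by simpa using Finset.card_le_card hVA
  have h' : ((3 * m - 1).choose 3 : ℝ) + ((n - VA.card).choose 3 : ℝ) ≤ n.choose 3 + δ * n ^ 3 := by
    have e1 : ((3 * m - 1).choose 3 : ℝ) ≤ F.card := by exact_mod_cast hc2.le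
    have e2 : (F.card : ℝ) + (n - VA.card).choose 3 ≤ n.choose 3 + (F.filter (fun e => Disjoint e VA)).card := by
      exact_mod_cast (by simpa using h)
    linarith
  have a := six_choose (3 * m - 1)
  have c := six_choose (n - VA.card)
  have d := six_choose n
  rw [Nat.cast_sub (by omega)] at a
  rw [Nat.cast_sub hvn] at c
  push_cast at a c
  have hm' : (10:ℝ) ^ 14 ≤ m := by exact_mod_cast hm
  have hmn' : (3:ℝ) * m ≤ n := by exact_mod_cast hmn
  have hcon' : (3:ℝ) * n < 10 * m := by exact_mod_cast hcon
  generalize (VA.card : ℝ) = v at *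
  generalize (m : ℝ) = μ at *
  generalize (n : ℝ) = ν at *
  have hv' : v ≤ 0.334 * ν := by nlinarith
  have hν : (10:ℝ) ^ 14 ≤ ν := by linarith
  have hν0 : 0 < ν := lt_of_lt_of_le (by norm_num) hν
  have f1 : (0.665 * ν) * (0.665 * ν) * (0.665 * ν) ≤ (ν - v) * (ν - v - 1) * (ν - v - 2) := by
    have : 0.665 * ν ≤ ν - v - 2 := by linarith
    exact mul3_le (by positivity) (by linarith) (by linarith) (by linarith)
  have f2 : (0.899 * ν) * (0.899 * ν) * (0.899 * ν) ≤ (3 * μ - 1) * (3 * μ - 1 - 1) * (3 * μ - 1 - 2) := by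
    have : 0.899 * ν ≤ 3 * μ - 3 := by linarith
    exact mul3_le (by positivity) (by linarith) (by linarith) (by linarith)
  have f3 : ν * (ν - 1) * (ν - 2) ≤ ν * ν * ν := by
    gcongr <;> linarith
  have f4 : δ * ν ^ 3 ≤ 1 / 10 ^ 14 * ν ^ 3 := by gcongr
  have f5 : 0 < ν ^ 3 := by positivity
  nlinarith

lemma S_key {n m k p q : ℕ} {δ : ℝ} (hδ : 0 < δ) (hδ1 : δ ≤ 1 / 10 ^ 14) (hm : 10 ^ 14 ≤ m) (hmn : 3 * m ≤ n) (hnm : n ≤ 30 * m)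
    (hk : k = m / 1000) (hp : p + 10 * k = m) (hq : q + k = n + 1)
    {F : Finset (Finset ℕ)} (hF : KG n F) (hsh : ShiftedP F) (hc1 : n.choose 3 < F.card + (n - m + 1).choose 3) 
    (VA : Finset ℕ) (hVA : VA ⊆ Finset.Icc 1 n) (hv : (VA.card : ℝ) ≤ (1 + δ) * m)
    (hA : ((F.filter (fun e => Disjoint e VA)).card : ℝ) ≤ δ * n ^ 3) : ({p, q, q + 1} : Finset ℕ) ∈ F := by
  by_contra hno
  have h := S_count hF hsh VA hVA (by omega) (by omega) hno
  have hnq : n + 1 - q = k := by omega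
  rw [hnq] at h
  obtain ⟨w, hw⟩ : ∃ w, w = (VA ∩ Finset.Ico p q).card := ⟨_, rfl⟩
  rw [← hw] at h
  have hvn : VA.card ≤ n := by simpa using Finset.card_le_card hVA
  have hvw : VA.card ≤ (p - 1) + w + k := by
    have hs : VA ⊆ Finset.Icc 1 (p - 1) ∪ (VA ∩ Finset.Ico p q) ∪ Finset.Icc q n := by
      intro x hx
      have := Finset.mem_Icc.mp (hVA hx)
      simp only [Finset.mem_union, Finset.mem_inter, Finset.mem_Icc, Finset.mem_Ico]
      by_cases h1 : x < p
      · left; left; omega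
      · by_cases h2 : x < q
        · left; right; exact ⟨hx, by omega, h2⟩
        · right; omega
    have h1 := Finset.card_le_card hs
    have h2 := Finset.card_union_le (Finset.Icc 1 (p - 1) ∪ (VA ∩ Finset.Ico p q)) (Finset.Icc q n)
    have h3 := Finset.card_union_le (Finset.Icc 1 (p - 1)) (VA ∩ Finset.Ico p q)
    rw [Nat.card_Icc] at h2 h3
    omega
  have hmain : ((w * k.choose 2 : ℕ) : ℝ) + ((n - VA.card).choose 3 : ℕ) < ((n - m + 1).choose 3 : ℕ) + δ * n ^ 3 := by
    have e1 : (((w * k.choose 2 : ℕ) : ℝ)) + ((n - VA.card).choose 3 : ℕ) < ((n - m + 1).choose 3 : ℕ) + (F.filter (fun e => Disjoint e VA)).card := by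
      exact_mod_cast (by omega : w * k.choose 2 + (n - VA.card).choose 3 < (n - m + 1).choose 3 + (F.filter (fun e => Disjoint e VA)).card)
    linarith
  have hm' : (10:ℝ) ^ 14 ≤ m := by exact_mod_cast hm
  have hm0 : (0:ℝ) < m := lt_of_lt_of_le (by norm_num) hm'
  have hmn' : (3:ℝ) * m ≤ n := by exact_mod_cast hmn
  have hnm' : (n:ℝ) ≤ 30 * m := by exact_mod_cast hnm
  have hk' : (m:ℝ) / 1001 ≤ k - 1 := by
    have : m < 1000 * k + 1000 := by omega
    have : (m:ℝ) < 1000 * k + 1000 := by exact_mod_cast this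
    linarith
  have hδn : δ * (n:ℝ) ^ 3 ≤ 1 / 10 ^ 14 * (30 * m) ^ 3 := by gcongr
  have hNc : ((n - m + 1).choose 2 : ℝ) = (n - m + 1) * (n - m) / 2 := by
    rw [Nat.cast_choose_two, Nat.cast_add, Nat.cast_sub (by omega)]; push_cast; ring
  by_cases hw4 : w ≤ 4 * k
  · have h1 : n - m + 1 + 5 * k ≤ n - VA.card := by omega
    have h2 := (choose_lower (n - m + 1) (5 * k)).trans (Nat.choose_le_choose 3 h1)
    have h2' : ((n - m + 1).choose 3 : ℝ) + 5 * k * (n - m + 1).choose 2 ≤ (n - VA.card).choose 3 := by exact_mod_cast h2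
    rw [hNc] at h2'
    have h3 : (2 * m) * (2 * m) / 2 ≤ ((n:ℝ) - m + 1) * (n - m) / 2 := by gcongr <;> linarith
    have h4 : 5 * (m / 1001) * ((2 * m) * (2 * m) / 2) ≤ 5 * (k:ℝ) * (((n:ℝ) - m + 1) * (n - m) / 2) := by
      gcongr; linarith
    have h5 : (0:ℝ) ≤ ((w * k.choose 2 : ℕ) : ℝ) := by positivity
    have h6 : (0:ℝ) < (m:ℝ) ^ 3 := by positivity
    nlinarith
  · push Not at hw4
    have hs : ∃ s : ℕ, n - m + 1 ≤ (n - VA.card) + s ∧ (n - VA.card) + s ≤ n ∧ (s : ℝ) ≤ δ * m + 1 := by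
      by_cases hvm : VA.card ≤ m - 1
      · exact ⟨0, by omega, by omega, by simp; positivity⟩
      · refine ⟨VA.card + 1 - m, by omega, by omega, ?_⟩
        rw [Nat.cast_sub (by omega)]; push_cast; linarith
    obtain ⟨s, hs1, hs2, hs3⟩ := hs
    have h2 : (n - m + 1).choose 3 ≤ (n - VA.card).choose 3 + s * n.choose 2 := by
      refine (Nat.choose_le_choose 3 hs1).trans ((choose_upper _ _).trans ?_)
      have := Nat.choose_le_choose 2 hs2
      gcongr
    have h2' : ((n - m + 1).choose 3 : ℝ) ≤ (n - VA.card).choose 3 + s * n.choose 2 := by exact_mod_cast h2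
    have h3 : (s : ℝ) * n.choose 2 ≤ (2 / 10 ^ 14 * m) * ((30 * m) * (30 * m) / 2) := by
      rw [Nat.cast_choose_two]
      have a1 : (s:ℝ) ≤ 2 / 10 ^ 14 * m := by
        have : δ * m ≤ 1 / 10 ^ 14 * m := by gcongr
        linarith
      have a2 : (n:ℝ) * (n - 1) / 2 ≤ (30 * m) * (30 * m) / 2 := by gcongr <;> linarith
      exact mul_le_mul a1 a2 (by have : (0:ℝ) ≤ n - 1 := by linarith
                                 positivity) (by positivity)
    have h4 : (4 * (m / 1001)) * ((m / 1001) * (m / 1001) / 2) ≤ ((w * k.choose 2 : ℕ) : ℝ) := by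
      rw [Nat.cast_mul, Nat.cast_choose_two]
      have : (4:ℝ) * k ≤ w := by exact_mod_cast hw4.le
      gcongr <;> linarith
    have h6 : (0:ℝ) < (m:ℝ) ^ 3 := by positivity
    nlinarith

lemma S_case {n m : ℕ} {δ : ℝ} (hδ : 0 < δ) (hδ1 : δ ≤ 1 / 10 ^ 14) (hm : 10 ^ 14 ≤ m) (hmn : 3 * m ≤ n) (hnm : n ≤ 30 * m)
    (F : Fin m → Finset (Finset ℕ)) (hF : ∀ i, KG n (F i)) (hsh : ∀ i, ShiftedP (F i)) 
    (hc1 : ∀ i, n.choose 3 < (F i).card + (n - m + 1).choose 3) (hc2 : ∀ i, (3 * m - 1).choose 3 < (F i).card)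
    (VA : Finset ℕ) (Bd : Finset (Fin m)) (hVA : VA ⊆ Finset.Icc 1 n) (hBd : (Bd.card : ℝ) ≤ δ * m)
    (hv : (VA.card : ℝ) ≤ (1 + δ) * m)
    (hA : ∀ i ∉ Bd, (((F i).filter (fun e => Disjoint e VA)).card : ℝ) ≤ δ * n ^ 3) : RM univ F := by
  classical
  have hm' : (10:ℝ) ^ 14 ≤ m := by exact_mod_cast hm
  obtain ⟨k, hk⟩ : ∃ k, k = m / 1000 := ⟨_, rfl⟩
  have hBk : Bd.card ≤ 10 * k := by
    have h1 : (Bd.card : ℝ) ≤ 1 / 10 ^ 14 * m := hBd.trans (by gcongr)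
    have h2 : (Bd.card : ℝ) * 1000 ≤ m := by linarith
    have h3 : Bd.card * 1000 ≤ m := by exact_mod_cast h2
    omega
  obtain ⟨I1, hI1, -, hI1c⟩ := Finset.exists_subsuperset_card_eq (Finset.subset_univ Bd) hBk (by rw [Finset.card_univ, Fintype.card_fin]; omega)
  have hex : ∃ i, i ∉ Bd := by
    by_contra hcon
    push Not at hcon
    have : Bd = Finset.univ := Finset.eq_univ_iff_forall.mpr hcon
    rw [this, Finset.card_univ, Fintype.card_fin] at hBk
    omega
  obtain ⟨i₀, hi₀⟩ := hex
  have h3n := S_small hδ hδ1 hm hmn (hF i₀) (hc2 i₀) VA hVA hv (hA i₀ hi₀)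
  obtain ⟨p, hp⟩ : ∃ p, p + 10 * k = m := ⟨m - 10 * k, by omega⟩
  obtain ⟨q, hq⟩ : ∃ q, q + k = n + 1 := ⟨n + 1 - k, by omega⟩
  apply S_match (n := n) hsh I1 (p := p) (q := q) (by omega) (by omega) ?_ (fun i => (F i).filter (fun e => e ⊆ Finset.Icc (p + 1) n))
    (fun i => Finset.filter_subset _ _) (fun i e he => ⟨(Finset.mem_filter.mp he).2, (hF i e (Finset.mem_filter.mp he).1).2⟩) ?_ (by omega)
  · intro i hi
    exact S_key hδ hδ1 hm hmn hnm hk hp hq (hF i) (hsh i) (hc1 i) VA hVA hv (hA i (fun h => hi (hI1 h)))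
  · have hcV : (Finset.Icc (p + 1) n).card = n - p := by rw [Nat.card_Icc]; omega
    apply small_m (10 * k) I1 (Finset.Icc (p + 1) n) _ hI1c (by rw [hcV]; omega)
    · intro i _ e he
      exact ⟨(Finset.mem_filter.mp he).2, (hF i e (Finset.mem_filter.mp he).1).2⟩
    · intro i _
      rw [hcV]
      have e1 : n - p - 10 * k + 1 = n - m + 1 := by omega
      rw [e1]
      have hs := S_count0 (hF i) (Finset.Icc 1 p) (Finset.Icc_subset_Icc le_rfl (by omega)) ∅ (by simp)
      rw [Nat.card_Icc] at hs
      simp only [Nat.add_sub_cancel, Finset.card_empty, add_zero] at hs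
      have e2 : ((F i).filter (fun e => Disjoint e (Finset.Icc 1 p))).card ≤ ((F i).filter (fun e => e ⊆ Finset.Icc (p + 1) n)).card := by
        apply Finset.card_le_card
        intro e he
        rw [Finset.mem_filter] at he ⊢
        refine ⟨he.1, fun x hx => ?_⟩
        have h1 := Finset.mem_Icc.mp ((hF i e he.1).1 hx)
        have h2 := Finset.disjoint_left.mp he.2 hx
        rw [Finset.mem_Icc] at h2 ⊢
        omega
      have := hc1 i
      omega

end

/-! Part P6D -/
section
open Finset

lemma D_match {m J : ℕ} {F : Fin m → Finset (Finset ℕ)} (hsh : ∀ i, ShiftedP (F i)) (I1 : Finset (Fin m))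
    (hI1 : I1.card = J) (hJm : J < m) 
    (hall : ∀ i, ∀ c < J, ({2 * c + 1, 2 * c + 2, 3 * m - c} : Finset ℕ) ∈ F i)
    (hgood : ∀ i ∉ I1, ({3 * m - J - 2, 3 * m - J - 1, 3 * m - J} : Finset ℕ) ∈ F i) : RM univ F := by
  classical
  obtain ⟨c, hc, hcinj⟩ := enumI I1
  obtain ⟨c', hc', hcinj'⟩ := enumI I1ᶜ
  have hcc : (I1ᶜ).card = m - J := by
    rw [Finset.card_compl, Fintype.card_fin]; omega
  rw [hcc] at hc'
  rw [hI1] at hc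
  have hc'' : ∀ i ∉ I1, c' i < m - J := fun i hi => hc' i (by simpa using hi)
  have hmix : ∀ i ∈ I1, ∀ j ∉ I1, Disjoint ({2 * c i + 1, 2 * c i + 2, 3 * m - c i} : Finset ℕ) 
      {2 * J + 3 * c' j + 1, 2 * J + 3 * c' j + 2, 2 * J + 3 * c' j + 3} := by
    intro i hi j hj
    have h1 := hc i hi
    have h2 := hc'' j hj
    rw [Finset.disjoint_left]
    intro v hv hv2
    simp only [Finset.mem_insert, Finset.mem_singleton] at hv hv2
    omega
  refine ⟨fun i => if i ∈ I1 then {2 * c i + 1, 2 * c i + 2, 3 * m - c i} else 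
    {2 * J + 3 * c' i + 1, 2 * J + 3 * c' i + 2, 2 * J + 3 * c' i + 3}, ?_, ?_⟩
  · intro i _
    by_cases hi : i ∈ I1
    · simp only [if_pos hi]; exact hall i _ (hc i hi)
    · simp only [if_neg hi]
      have h2 := hc'' i hi
      exact shifted_triple (hsh i) (by omega) (by omega) (by omega) (by omega) (by omega) (by omega) (by omega) (by omega) (hgood i hi)
  · intro i _ j _ hij
    by_cases hi : i ∈ I1 <;> by_cases hj : j ∈ I1
    · simp only [if_pos hi, if_pos hj]
      have h1 := hc i hi
      have h2 := hc j hj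
      have h3 : c i ≠ c j := fun h => hij (hcinj i hi j hj h)
      rw [Finset.disjoint_left]
      intro v hv hv2
      simp only [Finset.mem_insert, Finset.mem_singleton] at hv hv2
      omega
    · simp only [if_pos hi, if_neg hj]; exact hmix i hi j hj
    · simp only [if_neg hi, if_pos hj]; exact (hmix j hj i hi).symm
    · simp only [if_neg hi, if_neg hj]
      have h3 : c' i ≠ c' j := fun h => hij (hcinj' i (by simpa using hi) j (by simpa using hj) h)
      rw [Finset.disjoint_left]
      intro v hv hv2
      simp only [Finset.mem_insert, Finset.mem_singleton] at hv hv2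
      omega

/-- edges inside a set, with a family of missing triples -/
lemma D_count0 {n : ℕ} {F : Finset (Finset ℕ)} (hF : KG n F) (VA : Finset ℕ) (M : Finset (Finset ℕ))
    (hM : ∀ e ∈ M, e ⊆ VA ∧ e.card = 3 ∧ e ∉ F) :
    F.card + M.card ≤ VA.card.choose 3 + (F.filter (fun e => ¬ e ⊆ VA)).card := by
  classical
  have h1 := Finset.card_filter_add_card_filter_not (s := F) (fun e => e ⊆ VA)
  have h2 : (F.filter (fun e => e ⊆ VA) ∪ M).card ≤ VA.card.choose 3 := by
    rw [← Finset.card_powersetCard]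
    apply Finset.card_le_card
    intro e he
    rw [Finset.mem_powersetCard]
    rcases Finset.mem_union.mp he with he | he
    · rw [Finset.mem_filter] at he
      exact ⟨he.2, (hF e he.1).2⟩
    · exact ⟨(hM e he).1, (hM e he).2.1⟩
  rw [Finset.card_union_of_disjoint] at h2
  · omega
  · rw [Finset.disjoint_left]
    intro e he he2
    exact (hM e he2).2.2 (Finset.mem_filter.mp he).1

lemma D_all_count {n m c : ℕ} (hmn : 3 * m ≤ n) (hc : 100 * c < m) {F : Finset (Finset ℕ)} (hF : KG n F) (hsh : ShiftedP F)
    (hno : ({2 * c + 1, 2 * c + 2, 3 * m - c} : Finset ℕ) ∉ F) : 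
    F.card + c * (3 * m - 3 * c - 1).choose 2 ≤ (3 * m - 1).choose 3 + 2 * c * (n.choose 2 - (3 * m - 1).choose 2) := by
  classical
  let M : Finset (Finset ℕ) := ((Finset.Icc (3 * m - c) (3 * m - 1)) ×ˢ (Finset.Icc (2 * c + 1) (3 * m - c - 1)).powersetCard 2).image (fun a => insert a.1 a.2)
  have hMc : M.card = c * (3 * m - 3 * c - 1).choose 2 := by
    rw [Finset.card_image_of_injOn, Finset.card_product, Finset.card_powersetCard, Nat.card_Icc, Nat.card_Icc]
    · have e1 : 3 * m - 1 + 1 - (3 * m - c) = c := by omega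
      have e2 : 3 * m - c - 1 + 1 - (2 * c + 1) = 3 * m - 3 * c - 1 := by omega
      rw [e1, e2]
    rintro ⟨x, s⟩ h1 ⟨x', s'⟩ h2 h
    simp only [Finset.coe_product, Set.mem_prod, Finset.mem_coe, Finset.mem_Icc, Finset.mem_powersetCard] at h1 h2
    simp only at h
    obtain ⟨hx, hs, hs2⟩ := h1
    obtain ⟨hx', hs', hs2'⟩ := h2
    have e1 : x = x' := by
      have : x ∈ insert x' s' := h ▸ Finset.mem_insert_self x s
      rcases Finset.mem_insert.mp this with h' | h'
      · exact h'
      · have := Finset.mem_Icc.mp (hs' h'); omega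
    subst e1
    have n1 : x ∉ s := fun hh => by have := Finset.mem_Icc.mp (hs hh); omega
    have n2 : x ∉ s' := fun hh => by have := Finset.mem_Icc.mp (hs' hh); omega
    have : s = s' := by rw [← Finset.erase_insert n1, ← Finset.erase_insert n2, h]
    rw [this]
  have h1 := D_count0 hF (Finset.Icc 1 (3 * m - 1)) M (by
    intro e he
    simp only [M, Finset.mem_image, Finset.mem_product, Finset.mem_Icc, Finset.mem_powersetCard] at he
    obtain ⟨⟨x, s⟩, ⟨hx, hs, hs2⟩, rfl⟩ := he
    have n1 : x ∉ s := fun hh => by have := Finset.mem_Icc.mp (hs hh); omega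
    refine ⟨?_, ?_, ?_⟩
    · apply Finset.insert_subset
      · rw [Finset.mem_Icc]; simp only at hx ⊢; omega
      · exact hs.trans (Finset.Icc_subset_Icc (by omega) (by omega))
    · rw [Finset.card_insert_of_notMem n1, hs2]
    · intro hmem
      apply hno
      obtain ⟨y, z, hyz, rfl⟩ := Finset.card_eq_two.mp hs2
      have hy := Finset.mem_Icc.mp (hs (by simp : y ∈ ({y, z} : Finset ℕ)))
      have hz := Finset.mem_Icc.mp (hs (by simp : z ∈ ({y, z} : Finset ℕ)))
      simp only at hx hmem
      rcases lt_or_gt_of_ne hyz with h | h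
      · have e : ({x, y, z} : Finset ℕ) = {y, z, x} := by ext; simp; tauto
        rw [e] at hmem
        exact shifted_triple hsh h (by omega) (by omega) (by omega) (by omega) (by omega) (by omega) (by omega) hmem
      · have e : ({x, y, z} : Finset ℕ) = {z, y, x} := by ext; simp; tauto
        rw [e] at hmem
        exact shifted_triple hsh h (by omega) (by omega) (by omega) (by omega) (by omega) (by omega) (by omega) hmem)
  have h2 : (F.filter (fun e => ¬ e ⊆ Finset.Icc 1 (3 * m - 1))).card ≤ 2 * c * (n.choose 2 - (3 * m - 1).choose 2) := by
    let N : Finset (Finset ℕ) := ((Finset.Icc 1 (2 * c)) ×ˢ ((Finset.Icc 1 n).powersetCard 2 \ (Finset.Icc 1 (3 * m - 1)).powersetCard 2)).image (fun a => insert a.1 a.2)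
    have hN : N.card ≤ 2 * c * (n.choose 2 - (3 * m - 1).choose 2) := by
      refine Finset.card_image_le.trans ?_
      rw [Finset.card_product, Finset.card_sdiff_of_subset (Finset.powersetCard_mono (Finset.Icc_subset_Icc le_rfl (by omega)))]
      simp
    refine le_trans (Finset.card_le_card ?_) hN
    intro e he
    rw [Finset.mem_filter] at he
    obtain ⟨heF, hesub⟩ := he
    obtain ⟨x, y, z, hxy, hyz, rfl⟩ := card3_sorted (hF e heF).2
    have hx := Finset.mem_Icc.mp ((hF _ heF).1 (by simp : x ∈ ({x, y, z} : Finset ℕ)))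
    have hy := Finset.mem_Icc.mp ((hF _ heF).1 (by simp : y ∈ ({x, y, z} : Finset ℕ)))
    have hz := Finset.mem_Icc.mp ((hF _ heF).1 (by simp : z ∈ ({x, y, z} : Finset ℕ)))
    have hz3 : 3 * m ≤ z := by
      by_contra hcon
      apply hesub
      intro v hv
      simp only [Finset.mem_insert, Finset.mem_singleton] at hv
      rw [Finset.mem_Icc]; omega
    have hx2 : x ≤ 2 * c := by
      by_contra hcon
      apply hno
      exact shifted_triple hsh hxy hyz (by omega) (by omega) (by omega) (by omega) (by omega) (by omega) heF
    rw [Finset.mem_image]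
    refine ⟨(x, {y, z}), ?_, rfl⟩
    rw [Finset.mem_product, Finset.mem_sdiff, Finset.mem_powersetCard, Finset.mem_powersetCard]
    refine ⟨Finset.mem_Icc.mpr ⟨hx.1, hx2⟩, ⟨?_, Finset.card_pair (by omega)⟩, ?_⟩
    · intro v hv
      simp only [Finset.mem_insert, Finset.mem_singleton] at hv
      rw [Finset.mem_Icc]; omega
    · intro hh
      have := Finset.mem_Icc.mp (hh.1 (by simp : z ∈ ({y, z} : Finset ℕ)))
      omega
  rw [Nat.card_Icc, hMc] at h1
  simp only [Nat.add_sub_cancel] at h1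
  omega

lemma D_small {n m : ℕ} {δ : ℝ} (hδ : 0 < δ) (hδ1 : δ ≤ 1 / 10 ^ 14) (hm : 10 ^ 14 ≤ m) (hmn : 3 * m ≤ n) (hnm : n ≤ 30 * m)
    {F : Finset (Finset ℕ)} (hF : KG n F) (hc1 : n.choose 3 < F.card + (n - m + 1).choose 3)
    (VA : Finset ℕ) (hv : (VA.card : ℝ) ≤ (1 + δ) * (3 * m))
    (hA : ((F.filter (fun e => ¬ e ⊆ VA)).card : ℝ) ≤ δ * n ^ 3) : 28 * n ≤ 100 * m := by
  by_contra hcon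
  push Not at hcon
  have h := D_count0 hF VA ∅ (by simp)
  have h' : (n.choose 3 : ℝ) ≤ VA.card.choose 3 + δ * n ^ 3 + (n - m + 1).choose 3 := by
    have e1 : (n.choose 3 : ℝ) ≤ F.card + (n - m + 1).choose 3 := by exact_mod_cast hc1.le
    have e2 : (F.card : ℝ) ≤ VA.card.choose 3 + (F.filter (fun e => ¬ e ⊆ VA)).card := by
      exact_mod_cast (by simpa using h)
    linarith
  have a := six_choose VA.card
  have c := six_choose (n - m + 1)
  have d := six_choose n
  have a0 : (VA.card : ℝ) * (VA.card - 1) * (VA.card - 2) ≤ VA.card ^ 3 := by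
    rw [← a]
    have := Nat.choose_le_pow_div (α := ℝ) 3 VA.card
    simp only [Nat.factorial] at this
    push_cast at this
    linarith
  have v0 : (0:ℝ) ≤ VA.card := by positivity
  rw [Nat.cast_add, Nat.cast_sub (by omega)] at c
  push_cast at c
  have hm' : (10:ℝ) ^ 14 ≤ m := by exact_mod_cast hm
  have hmn' : (3:ℝ) * m ≤ n := by exact_mod_cast hmn
  have hnm' : (n:ℝ) ≤ 30 * m := by exact_mod_cast hnm
  have hcon' : (100:ℝ) * m < 28 * n := by exact_mod_cast hcon
  generalize (VA.card : ℝ) = v at *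
  generalize (m : ℝ) = μ at *
  generalize (n : ℝ) = ν at *
  have hν : (10:ℝ) ^ 14 ≤ ν := by linarith
  have hν0 : 0 < ν := lt_of_lt_of_le (by norm_num) hν
  have hμ0 : 0 < μ := lt_of_lt_of_le (by norm_num) hm'
  have f1 : v ^ 3 ≤ 27 * μ ^ 3 + 0.001 * μ ^ 3 := by
    have : v ^ 3 ≤ ((1 + 1 / 10 ^ 14) * (3 * μ)) ^ 3 := by
      apply pow_le_pow_left₀ v0
      refine hv.trans ?_
      gcongr
    have e : ((1 + 1 / 10 ^ 14) * (3 * μ)) ^ 3 = ((1 + 1 / 10 ^ 14) ^ 3 * 27) * μ ^ 3 := by ring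
    have e2 : ((1 + 1 / 10 ^ 14) ^ 3 * 27 : ℝ) * μ ^ 3 ≤ (27 + 0.001) * μ ^ 3 := by
      gcongr; norm_num
    linarith
  have f2 : ν ^ 3 - 3 * ν ^ 2 ≤ ν * (ν - 1) * (ν - 2) := by nlinarith
  have f3 : (ν - μ + 1) * (ν - μ + 1 - 1) * (ν - μ + 1 - 2) ≤ (ν - μ) ^ 3 := by nlinarith
  have f4 : δ * ν ^ 3 ≤ 1 / 10 ^ 14 * ν ^ 3 := by gcongr
  have f5 : 3 * ν ^ 2 ≤ 0.0001 * ν ^ 3 := by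
    have : ν ^ 2 * 3 ≤ ν ^ 2 * (0.0001 * ν) := by gcongr; linarith
    linarith
  have f6 : ν ^ 3 ≤ 27 * μ ^ 3 + 0.001 * μ ^ 3 + (ν - μ) ^ 3 + 0.0002 * ν ^ 3 := by
    have : 0 < ν ^ 3 := by positivity
    linarith
  -- 3ν²μ ≤ 26.001 μ³ + 3νμ² + 0.0002ν³ , ν ≤ 30 μ
  have f7 : 0.0002 * ν ^ 3 ≤ 0.006 * ν ^ 2 * μ := by
    have : ν ^ 2 * (0.0002 * ν) ≤ ν ^ 2 * (0.006 * μ) :=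
      mul_le_mul_of_nonneg_left (by linarith) (by positivity)
    linarith
  have f8 : μ * (2.994 * ν ^ 2) ≤ μ * (26.001 * μ ^ 2 + 3 * ν * μ) := by
    clear a0 f1 f2 f3 f4 f5
    have e : (ν - μ) ^ 3 = ν ^ 3 - 3 * ν ^ 2 * μ + 3 * ν * μ ^ 2 - μ ^ 3 := by ring
    rw [e] at f6
    linarith
  have f9 := le_of_mul_le_mul_left f8 hμ0
  have f10 : μ ≤ 0.28 * ν := by linarith
  have f11 : μ ^ 2 ≤ (0.28 * ν) ^ 2 := pow_le_pow_left₀ hμ0.le f10 2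
  have f12 : ν * μ ≤ ν * (0.28 * ν) := mul_le_mul_of_nonneg_left f10 hν0.le
  have f13 : 0 < ν ^ 2 := by positivity
  clear a0 f1 f2 f3 f4 f5 f6 f7 f8
  linarith

lemma D_all {n m c : ℕ} (hm : 10 ^ 14 ≤ m) (hmn : 3 * m ≤ n) (h28 : 28 * n ≤ 100 * m) (hc : 100 * c < m) 
    {F : Finset (Finset ℕ)} (hF : KG n F) (hsh : ShiftedP F) (hc2 : (3 * m - 1).choose 3 < F.card) :
    ({2 * c + 1, 2 * c + 2, 3 * m - c} : Finset ℕ) ∈ F := by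
  by_contra hno
  have h := D_all_count hmn hc hF hsh hno
  have key : 2 * (n.choose 2 - (3 * m - 1).choose 2) ≤ (3 * m - 3 * c - 1).choose 2 := by
    have : (2:ℝ) * n.choose 2 ≤ (3 * m - 3 * c - 1).choose 2 + 2 * (3 * m - 1).choose 2 := by
      rw [Nat.cast_choose_two, Nat.cast_choose_two, Nat.cast_choose_two]
      have e1 : (2.96 : ℝ) * m ≤ ((3 * m - 3 * c - 1 : ℕ) : ℝ) - 1 := by
        have : 296 * m + 100 ≤ 100 * (3 * m - 3 * c - 1) := by omega
        have : (296 : ℝ) * m + 100 ≤ 100 * ((3 * m - 3 * c - 1 : ℕ) : ℝ) := by exact_mod_cast this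
        linarith
      have e2 : (2.999 : ℝ) * m ≤ ((3 * m - 1 : ℕ) : ℝ) - 1 := by
        have : 2999 * m + 1000 ≤ 1000 * (3 * m - 1) := by omega
        have : (2999 : ℝ) * m + 1000 ≤ 1000 * ((3 * m - 1 : ℕ) : ℝ) := by exact_mod_cast this
        linarith
      have e3 : (28:ℝ) * n ≤ 100 * m := by exact_mod_cast h28
      generalize ((3 * m - 3 * c - 1 : ℕ) : ℝ) = A at *
      generalize ((3 * m - 1 : ℕ) : ℝ) = B at *
      have m0 : (0:ℝ) ≤ m := by positivity
      have n0 : (0:ℝ) ≤ n := by positivity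
      have f1 : (2.96 * (m:ℝ)) * (2.96 * m) ≤ A * (A - 1) := mul_le_mul (by linarith) e1 (by positivity) (by linarith)
      have f2 : (2.999 * (m:ℝ)) * (2.999 * m) ≤ B * (B - 1) := mul_le_mul (by linarith) e2 (by positivity) (by linarith)
      have f3 : (n:ℝ) * (n - 1) ≤ (100 / 28 * m) * (100 / 28 * m) := by nlinarith
      nlinarith
    have : 2 * n.choose 2 ≤ (3 * m - 3 * c - 1).choose 2 + 2 * (3 * m - 1).choose 2 := by exact_mod_cast this
    omega
  have h3 := Nat.mul_le_mul_left c key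
  have e : 2 * c * (n.choose 2 - (3 * m - 1).choose 2) = c * (2 * (n.choose 2 - (3 * m - 1).choose 2)) := by ring
  omega

lemma D_key {n m J : ℕ} {δ : ℝ} (hδ : 0 < δ) (hδ1 : δ ≤ 1 / 10 ^ 14) (hm : 10 ^ 14 ≤ m) (hnm : n ≤ 30 * m)
    (hJ : J = m / 100)
    {F : Finset (Finset ℕ)} (hF : KG n F) (hsh : ShiftedP F) (hc2 : (3 * m - 1).choose 3 < F.card)
    (VA : Finset ℕ) (hVA : VA ⊆ Finset.Icc 1 n) (hv : (VA.card : ℝ) ≤ (1 + δ) * (3 * m))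
    (hA : ((F.filter (fun e => ¬ e ⊆ VA)).card : ℝ) ≤ δ * n ^ 3) : 
    ({3 * m - J - 2, 3 * m - J - 1, 3 * m - J} : Finset ℕ) ∈ F := by
  by_contra hno
  obtain ⟨r, hr⟩ : ∃ r, r = 3 * m - J - 2 := ⟨_, rfl⟩
  obtain ⟨u, hu⟩ : ∃ u, u = VA ∩ Finset.Icc r n := ⟨_, rfl⟩
  have h := D_count0 hF VA (u.powersetCard 3) (by
    intro e he
    rw [Finset.mem_powersetCard] at he
    refine ⟨he.1.trans (hu ▸ Finset.inter_subset_left), he.2, ?_⟩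
    intro heF
    obtain ⟨x, y, z, hxy, hyz, rfl⟩ := card3_sorted he.2
    have hx : x ∈ u := he.1 (by simp)
    rw [hu, Finset.mem_inter, Finset.mem_Icc] at hx
    apply hno
    exact shifted_triple hsh hxy hyz (by omega) (by omega) (by omega) (by omega) (by omega) (by omega) heF)
  rw [Finset.card_powersetCard] at h
  have huc : VA.card ≤ (r - 1) + u.card := by
    have hs : VA ⊆ Finset.Icc 1 (r - 1) ∪ u := by
      intro x hx
      have := Finset.mem_Icc.mp (hVA hx)
      rw [hu]
      simp only [Finset.mem_union, Finset.mem_inter, Finset.mem_Icc]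
      by_cases h1 : x < r
      · left; omega
      · right; exact ⟨hx, by omega, this.2⟩
    have h1 := Finset.card_le_card hs
    have h3 := Finset.card_union_le (Finset.Icc 1 (r - 1)) u
    rw [Nat.card_Icc] at h3
    omega
  have hmain : ((3 * m - 1).choose 3 : ℝ) + u.card.choose 3 < VA.card.choose 3 + δ * n ^ 3 := by
    have e1 : ((3 * m - 1).choose 3 : ℝ) + u.card.choose 3 < VA.card.choose 3 + (F.filter (fun e => ¬ e ⊆ VA)).card := by
      exact_mod_cast (by omega : (3 * m - 1).choose 3 + u.card.choose 3 < VA.card.choose 3 + (F.filter (fun e => ¬ e ⊆ VA)).card)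
    linarith
  have hm' : (10:ℝ) ^ 14 ≤ m := by exact_mod_cast hm
  have hm0 : (0:ℝ) < m := lt_of_lt_of_le (by norm_num) hm'
  have hnm' : (n:ℝ) ≤ 30 * m := by exact_mod_cast hnm
  have hδn : δ * (n:ℝ) ^ 3 ≤ 1 / 10 ^ 14 * (30 * m) ^ 3 := by gcongr
  have h6 : (0:ℝ) < (m:ℝ) ^ 3 := by positivity
  obtain ⟨k, hk⟩ : ∃ k, k = m / 300 := ⟨_, rfl⟩
  have hk' : (m:ℝ) / 301 ≤ k - 2 := by
    have : m < 300 * k + 300 := by omega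
    have : (m:ℝ) < 300 * k + 300 := by exact_mod_cast this
    linarith
  by_cases hvk : VA.card + k ≤ 3 * m - 1
  · obtain ⟨s, hs⟩ : ∃ s, s + k = 3 * m - 1 := ⟨3 * m - 1 - k, by omega⟩
    have h1 : VA.card.choose 3 ≤ s.choose 3 := Nat.choose_le_choose 3 (by omega)
    have h2 := choose_lower s k
    rw [hs] at h2
    have h3 : (VA.card.choose 3 : ℝ) + k * s.choose 2 ≤ (3 * m - 1).choose 3 := by exact_mod_cast (by omega : VA.card.choose 3 + k * s.choose 2 ≤ (3 * m - 1).choose 3)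
    have h4 : (m / 301) * (m * m / 2) ≤ (k:ℝ) * s.choose 2 := by
      rw [Nat.cast_choose_two]
      have : (m:ℝ) + 1 ≤ s := by exact_mod_cast (by omega : m + 1 ≤ s)
      have q1 : (m:ℝ) * m ≤ s * (s - 1) := mul_le_mul (by linarith) (by linarith) hm0.le (by linarith)
      exact mul_le_mul (by linarith) (by linarith) (by positivity) (by linarith)
    have h5 : (0:ℝ) ≤ (u.card.choose 3 : ℝ) := by positivity
    nlinarith
  · push Not at hvk
    have h1 : k.choose 3 ≤ u.card.choose 3 := Nat.choose_le_choose 3 (by omega)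
    have h1' : (k.choose 3 : ℝ) ≤ u.card.choose 3 := by exact_mod_cast h1
    have h2 := six_choose k
    have h3 : (m / 301 : ℝ) * (m / 301) * (m / 301) ≤ (k:ℝ) * (k - 1) * (k - 2) :=
      mul3_le (by positivity) (by linarith) (by linarith) (by linarith)
    have hs : ∃ s : ℕ, VA.card ≤ (3 * m - 1) + s ∧ (s : ℝ) ≤ 4 / 10 ^ 14 * m := by
      refine ⟨VA.card - (3 * m - 1), by omega, ?_⟩
      by_cases hh : VA.card ≤ 3 * m - 1
      · rw [Nat.sub_eq_zero_of_le hh]; simp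
      · rw [Nat.cast_sub (by omega), Nat.cast_sub (by omega)]
        push_cast
        have : δ * m ≤ 1 / 10 ^ 14 * m := by gcongr
        linarith
    obtain ⟨s, hs1, hs2⟩ := hs
    have h4 : (VA.card.choose 3 : ℝ) ≤ (3 * m - 1).choose 3 + s * (3 * m - 1 + s).choose 2 := by
      exact_mod_cast (Nat.choose_le_choose 3 hs1).trans (choose_upper _ _)
    have h5 : ((3 * m - 1 + s).choose 2 : ℝ) ≤ (4 * m) * (4 * m) / 2 := by
      rw [Nat.cast_choose_two, Nat.cast_add, Nat.cast_sub (by omega)]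
      push_cast
      have s0 : (0:ℝ) ≤ s := by positivity
      gcongr <;> linarith
    have h7 : (s:ℝ) * (3 * m - 1 + s).choose 2 ≤ (4 / 10 ^ 14 * m) * ((4 * m) * (4 * m) / 2) := by gcongr
    nlinarith

lemma D_case {n m : ℕ} {δ : ℝ} (hδ : 0 < δ) (hδ1 : δ ≤ 1 / 10 ^ 14) (hm : 10 ^ 14 ≤ m) (hmn : 3 * m ≤ n) (hnm : n ≤ 30 * m)
    (F : Fin m → Finset (Finset ℕ)) (hF : ∀ i, KG n (F i)) (hsh : ∀ i, ShiftedP (F i)) 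
    (hc1 : ∀ i, n.choose 3 < (F i).card + (n - m + 1).choose 3) (hc2 : ∀ i, (3 * m - 1).choose 3 < (F i).card)
    (VA : Finset ℕ) (Bd : Finset (Fin m)) (hVA : VA ⊆ Finset.Icc 1 n) (hBd : (Bd.card : ℝ) ≤ δ * m)
    (hv : (VA.card : ℝ) ≤ (1 + δ) * (3 * m))
    (hA : ∀ i ∉ Bd, (((F i).filter (fun e => ¬ e ⊆ VA)).card : ℝ) ≤ δ * n ^ 3) : RM univ F := by
  classical
  have hm' : (10:ℝ) ^ 14 ≤ m := by exact_mod_cast hm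
  obtain ⟨J, hJ⟩ : ∃ J, J = m / 100 := ⟨_, rfl⟩
  have hBk : Bd.card ≤ J := by
    have h1 : (Bd.card : ℝ) ≤ 1 / 10 ^ 14 * m := hBd.trans (by gcongr)
    have h2 : (Bd.card : ℝ) * 1000 ≤ m := by linarith
    have h3 : Bd.card * 1000 ≤ m := by exact_mod_cast h2
    omega
  obtain ⟨I1, hI1, -, hI1c⟩ := Finset.exists_subsuperset_card_eq (Finset.subset_univ Bd) hBk (by rw [Finset.card_univ, Fintype.card_fin]; omega)
  have hex : ∃ i, i ∉ Bd := by
    by_contra hcon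
    push Not at hcon
    have : Bd = Finset.univ := Finset.eq_univ_iff_forall.mpr hcon
    rw [this, Finset.card_univ, Fintype.card_fin] at hBk
    omega
  obtain ⟨i₀, hi₀⟩ := hex
  have h28 := D_small hδ hδ1 hm hmn hnm (hF i₀) (hc1 i₀) VA hv (hA i₀ hi₀)
  apply D_match hsh I1 hI1c (by omega)
  · intro i c hc
    exact D_all hm hmn h28 (by omega) (hF i) (hsh i) (hc2 i)
  · intro i hi
    exact D_key hδ hδ1 hm hnm hJ (hF i) (hsh i) (hc2 i) VA hVA hv (hA i (fun h => hi (hI1 h)))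

end

/-! Part P8 -/
section
open Finset

theorem main_RM : ∃ n₀ : ℕ, ∀ n : ℕ, n₀ ≤ n → ∀ m : ℕ, 0 < m → 3 * m ≤ n → ∀ F : Fin m → Finset (Finset ℕ),
    (∀ i, KG n (F i)) → (∀ i, n.choose 3 < (F i).card + (n - m + 1).choose 3) → (∀ i, (3 * m - 1).choose 3 < (F i).card) →
    RM univ F := by
  obtain ⟨n₁, hn₁⟩ := stability (1 / 10 ^ 14) (by norm_num) (by norm_num)
  refine ⟨max n₁ (30 * 10 ^ 14), ?_⟩
  intro n hn m hm hmn F hF hc1 hc2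
  have hn1 : n₁ ≤ n := (le_max_left _ _).trans hn
  have hn2 : 30 * 10 ^ 14 ≤ n := (le_max_right _ _).trans hn
  by_cases h30 : 30 * m ≤ n
  · apply small_m m univ (Finset.Icc 1 n) F (by simp) (by simpa using h30) (fun i _ => hF i)
    intro i _
    simpa using hc1 i
  · by_contra hno
    obtain ⟨F', hK, hS, hcard, hno'⟩ := exists_shifted univ n _ F rfl (fun i _ => hF i) hno
    have hK' : ∀ i, KG n (F' i) := fun i => hK i (Finset.mem_univ i)
    have hS' : ∀ i, ShiftedP (F' i) := fun i => hS i (Finset.mem_univ i)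
    have hcard' : ∀ i, (F' i).card = (F i).card := fun i => hcard i (Finset.mem_univ i)
    have d1 : ∀ i, n.choose 3 < (F' i).card + (n - m + 1).choose 3 := fun i => by rw [hcard' i]; exact hc1 i
    have d2 : ∀ i, (3 * m - 1).choose 3 < (F' i).card := fun i => by rw [hcard' i]; exact hc2 i
    obtain ⟨VA, Bd, hVA, hBd, h⟩ := hn₁ n hn1 m hmn (by omega) F' hK' hS' d1 d2 hno'
    apply hno'
    rcases h with ⟨h1, h2⟩ | ⟨h1, h2⟩
    · exact S_case (by norm_num) le_rfl (by omega) hmn (by omega) F' hK' hS' d1 d2 VA Bd hVA hBd h1 h2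
    · exact D_case (by norm_num) le_rfl (by omega) hmn (by omega) F' hK' hS' d1 d2 VA Bd hVA hBd h1 h2

end

/-- the rainbow matching conjecture for 3-graphs, for large `n`. -/
theorem rainbow_matching_three_uniform :
    ∃ n₀ : ℕ, ∀ n : ℕ, n ≥ n₀ → ∀ m : ℕ, 0 < m → n ≥ 3 * m →
      ∀ F : Fin m → Finset (Finset ℕ), (∀ i, IsKGraphOn n 3 (F i)) →
        (∀ i, (F i).card > fEMC n m 3) → HasRainbowMatching F := by
  obtain ⟨n₀, h⟩ := main_RM
  refine ⟨n₀, fun n hn m hm hmn F hF hc => ?_⟩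
  have hc1 : ∀ i, n.choose 3 < (F i).card + (n - m + 1).choose 3 := by
    intro i
    have h1 := hc i
    have h2 : n.choose 3 - (n - m + 1).choose 3 ≤ fEMC n m 3 := le_max_left _ _
    omega
  have hc2 : ∀ i, (3 * m - 1).choose 3 < (F i).card := by
    intro i
    have h1 := hc i
    have h2 : (3 * m - 1).choose 3 ≤ fEMC n m 3 := le_max_right _ _
    omega
  obtain ⟨e, h1, h2⟩ := h n hn m hm hmn F hF hc1 hc2
  exact ⟨e, fun i => h1 i (Finset.mem_univ i),
    fun i j hij => h2 i (Finset.mem_univ _) j (Finset.mem_univ _) hij⟩
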